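/- Let N ≥ 3, m > 1, T > 0, and let ρ satisfy the weight condition. Let u be a non-negative very weak solution of ρ u_t = Δ(u^m) in ℝ^N×(0,T) with u ∈ L^∞_loc(ℝ^N×(0,T)), and let τ₁ ∈ (0,T) be a Lebesgue time of u (i.e. a time as in the localization Lemma, for which u(τ₁) is a well-defined L¹_{ρ,loc} Lebesgue value of t ↦ u(t)). Let v be the weak energy solution of the Cauchy problem ρ v_t = Δ(v^m), v(0) = v₀, with initial datum v₀ ∈ L¹_ρ(ℝ^N) ∩ L^∞(ℝ^N). If 0 ≤ v₀ ≤ u(τ₁) a.e., then v(x,t) ≤ u(x,t+τ₁) for a.e. (x,t) ∈ ℝ^N×(0,T−τ₁). -/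

import Mathlib

open MeasureTheory Set Metric Filter
open scoped ENNReal Topology

noncomputable section

abbrev Eu (N : ℕ) := EuclideanSpace ℝ (Fin N)

/-- Signed power `a^q = |a|^{q-1} a`. -/
def spow (a q : ℝ) : ℝ := |a| ^ (q - 1) * a

/-- The weight condition \eqref{weight-cond}: `ρ` is measurable and
`C̲ (1+|x|)^{-γ} ≤ ρ(x) ≤ C̄ |x|^{-γ}` for a.e. `x`, with `γ ∈ [0,2)` and `0 < C̲ < C̄`. -/
def WeightCond (N : ℕ) (γ Cl Cu : ℝ) (ρ : Eu N → ℝ) : Prop :=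
  Measurable ρ ∧ 0 ≤ γ ∧ γ < 2 ∧ 0 < Cl ∧ Cl < Cu ∧
    ∀ᵐ x ∂(volume : Measure (Eu N)), Cl * (1 + ‖x‖) ^ (-γ) ≤ ρ x ∧ ρ x ≤ Cu * ‖x‖ ^ (-γ)

/-- Time derivative `ψ_t` of a space-time test function. -/
def ptder {N : ℕ} (ψ : Eu N × ℝ → ℝ) (p : Eu N × ℝ) : ℝ := fderiv ℝ ψ p (0, 1)

/-- Spatial Laplacian `Δψ` of a space-time test function. -/
def lapX {N : ℕ} (ψ : Eu N × ℝ → ℝ) (p : Eu N × ℝ) : ℝ :=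
  ∑ i : Fin N, fderiv ℝ (fun q => fderiv ℝ ψ q (EuclideanSpace.single i 1, 0)) p
    (EuclideanSpace.single i 1, 0)

/-- Very weak solution of `ρ u_t = Δ(u^m)` in `Ω × (τ₁, τ₂)` (Definitions 2.6 / 2.8). -/
structure VWS {N : ℕ} (ρ : Eu N → ℝ) (m : ℝ) (Ω : Set (Eu N)) (τ₁ τ₂ : ℝ)
    (u : Eu N → ℝ → ℝ) : Prop where
  aemeas : AEMeasurable (fun p : Eu N × ℝ => u p.1 p.2)
    (volume.restrict (Ω ×ˢ Ioo τ₁ τ₂))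
  locint : ∀ K : Set (Eu N × ℝ), IsCompact K → K ⊆ Ω ×ˢ Ioo τ₁ τ₂ →
    IntegrableOn (fun p : Eu N × ℝ => |u p.1 p.2| * ρ p.1) K ∧
      IntegrableOn (fun p : Eu N × ℝ => |u p.1 p.2| ^ m) K
  weak : ∀ ψ : Eu N × ℝ → ℝ, ContDiff ℝ (⊤ : ℕ∞) ψ → HasCompactSupport ψ →
    tsupport ψ ⊆ Ω ×ˢ Ioo τ₁ τ₂ →
    ∫ p in Ω ×ˢ Ioo τ₁ τ₂,
      (u p.1 p.2 * ptder ψ p * ρ p.1 + spow (u p.1 p.2) m * lapX ψ p) = 0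

/-- `u ∈ L^∞_loc(Ω × (τ₁,τ₂))`. -/
def LinftyLoc {N : ℕ} (Ω : Set (Eu N)) (τ₁ τ₂ : ℝ) (u : Eu N → ℝ → ℝ) : Prop :=
  ∀ K : Set (Eu N × ℝ), IsCompact K → K ⊆ Ω ×ˢ Ioo τ₁ τ₂ →
    ∃ M : ℝ, ∀ᵐ p ∂(volume.restrict K : Measure (Eu N × ℝ)), |u p.1 p.2| ≤ M

/-- `λ = (N-γ)/((N-γ)(m-1)+2-γ)`. -/
def lamC (N : ℕ) (γ m : ℝ) : ℝ := ((N:ℝ) - γ) / (((N:ℝ) - γ) * (m - 1) + 2 - γ)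

/-- `θ = (2-γ)/(N-γ)`. -/
def thetC (N : ℕ) (γ : ℝ) : ℝ := (2 - γ) / ((N:ℝ) - γ)

/-- `α(N)`: the Lebesgue measure of the unit ball of `ℝ^N`. -/
def alphaN (N : ℕ) : ℝ := (volume (ball (0 : Eu N) 1)).toReal

/-- The Green function `G(x,y) = (N(N-2)α(N))⁻¹ |x-y|^{2-N}` of `-Δ` on `ℝ^N`, `N ≥ 3`. -/
def GreenFn (N : ℕ) (x y : Eu N) : ℝ :=
  ((N : ℝ) * ((N : ℝ) - 2) * alphaN N)⁻¹ * ‖x - y‖ ^ (2 - (N : ℝ))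

/-- **Weak energy solution** (Definition 3.1) of `ρ u_t = Δ(u^m)` on `ℝ^N × (0,∞)` with
initial datum `u₀ ∈ L¹_ρ(ℝ^N) ∩ L^∞(ℝ^N)`; `g` is the weak spatial gradient of `u^m`,
witnessing `u^m ∈ L²_loc([0,∞); Ḣ¹(ℝ^N))`. -/
structure WES {N : ℕ} (ρ : Eu N → ℝ) (m : ℝ) (u : Eu N → ℝ → ℝ) (u₀ : Eu N → ℝ)
    (g : Eu N → ℝ → Eu N) : Prop where
  u0int : Integrable (fun x : Eu N => |u₀ x| * ρ x)
  u0bdd : ∃ M : ℝ, ∀ᵐ x ∂(volume : Measure (Eu N)), |u₀ x| ≤ M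
  meas : AEMeasurable (fun p : Eu N × ℝ => u p.1 p.2)
    (volume.restrict ((univ : Set (Eu N)) ×ˢ Ioi 0))
  init : ∀ᵐ x ∂(volume : Measure (Eu N)), u x 0 = u₀ x
  int : ∀ t : ℝ, 0 ≤ t → Integrable (fun x : Eu N => |u x t| * ρ x)
  contL1 : ∀ t₀ : ℝ, 0 ≤ t₀ →
    Tendsto (fun t => ∫ x, |u x t - u x t₀| * ρ x) (𝓝[Ici 0] t₀) (𝓝 0)
  bdd : ∃ M : ℝ, ∀ t : ℝ, 0 < t → ∀ᵐ x ∂(volume : Measure (Eu N)), |u x t| ≤ M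
  gradL2 : ∀ S : ℝ, 0 < S →
    IntegrableOn (fun p : Eu N × ℝ => ‖g p.1 p.2‖ ^ 2) ((univ : Set (Eu N)) ×ˢ Ioo 0 S)
  gradProp : ∀ φ : Eu N × ℝ → ℝ, ContDiff ℝ (⊤ : ℕ∞) φ → HasCompactSupport φ →
    tsupport φ ⊆ (univ : Set (Eu N)) ×ˢ Ioi 0 → ∀ i : Fin N,
      ∫ p in (univ : Set (Eu N)) ×ˢ Ioi (0:ℝ),
          spow (u p.1 p.2) m * fderiv ℝ φ p (EuclideanSpace.single i 1, 0) =
        -∫ p in (univ : Set (Eu N)) ×ˢ Ioi (0:ℝ), g p.1 p.2 i * φ p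
  weakEq : ∀ ψ : Eu N × ℝ → ℝ, ContDiff ℝ (⊤ : ℕ∞) ψ → HasCompactSupport ψ →
    tsupport ψ ⊆ (univ : Set (Eu N)) ×ˢ Ioi 0 →
    ∫ p in (univ : Set (Eu N)) ×ˢ Ioi (0:ℝ), u p.1 p.2 * ptder ψ p * ρ p.1 =
      ∫ p in (univ : Set (Eu N)) ×ˢ Ioi (0:ℝ),
        ∑ i : Fin N, g p.1 p.2 i * fderiv ℝ ψ p (EuclideanSpace.single i 1, 0)

instance instAddHaarEuProd (N : ℕ) : (volume : Measure (Eu N × ℝ)).IsAddHaarMeasure := by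
  rw [Measure.volume_eq_prod]; infer_instance

/-- The convolution of a function with a measure. -/
def cv {N : ℕ} (m : Measure (Eu N × ℝ)) (f : Eu N × ℝ → ℝ) (p : Eu N × ℝ) : ℝ :=
  ∫ q, f (p - q) ∂m

/-- Bounded measurable functions with bounded support. -/
structure BM {N : ℕ} (f : Eu N × ℝ → ℝ) : Prop where
  meas : Measurable f
  bdd : ∃ C, ∀ p, |f p| ≤ C
  supp : ∃ R, ∀ p, R < ‖p‖ → f p = 0

/-- Finite measures with bounded support. -/
structure FB {N : ℕ} (m : Measure (Eu N × ℝ)) : Prop where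
  fin : IsFiniteMeasure m
  supp : ∃ r, ∀ᵐ q ∂m, ‖q‖ ≤ r

section

variable {N : ℕ} {f g : Eu N × ℝ → ℝ} {m m₁ m₂ : Measure (Eu N × ℝ)}

theorem cv_measurable [SFinite m] (hf : Measurable f) : Measurable (cv m f) := by
  have : StronglyMeasurable (fun p => ∫ q, f (p - q) ∂m) := by
    apply StronglyMeasurable.integral_prod_right
    exact (hf.comp (measurable_fst.sub measurable_snd)).stronglyMeasurable
  exact this.measurable

theorem slice_integrable [IsFiniteMeasure m] (hf : Measurable f) {C : ℝ}
    (hC : ∀ p, |f p| ≤ C) (p : Eu N × ℝ) : Integrable (fun q => f (p - q)) m :=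
  Integrable.of_bound (hf.comp (measurable_const.sub measurable_id)).aestronglyMeasurable C
    (Eventually.of_forall fun _ => hC _)

theorem cv_abs_le [IsFiniteMeasure m] {C : ℝ}
    (hC : ∀ p, |f p| ≤ C) (p : Eu N × ℝ) : |cv m f p| ≤ C * m.real univ := by
  have := norm_integral_le_of_norm_le_const (μ := m) (f := fun q => f (p - q)) (C := C)
    (Eventually.of_forall fun _ => hC _)
  simpa [cv] using this

namespace BM

theorem integrable (hf : BM f) : Integrable f := by
  obtain ⟨C, hC⟩ := hf.bdd
  obtain ⟨R, hR⟩ := hf.supp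
  have : IntegrableOn f (closedBall 0 R) :=
    Measure.integrableOn_of_bounded (M := C) measure_closedBall_lt_top.ne
      hf.meas.aestronglyMeasurable (Eventually.of_forall fun p => hC p)
  refine (integrableOn_iff_integrable_of_support_subset ?_).1 this
  intro p hp
  by_contra h
  exact hp (hR p (by simpa using h))

theorem slice (hf : BM f) [IsFiniteMeasure m] (p : Eu N × ℝ) :
    Integrable (fun q => f (p - q)) m := by
  obtain ⟨C, hC⟩ := hf.bdd
  exact slice_integrable hf.meas hC p

theorem add (hf : BM f) (hg : BM g) : BM (fun p => f p + g p) := by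
  obtain ⟨C, hC⟩ := hf.bdd
  obtain ⟨R, hR⟩ := hf.supp
  obtain ⟨C', hC'⟩ := hg.bdd
  obtain ⟨R', hR'⟩ := hg.supp
  refine ⟨hf.meas.add hg.meas, ⟨C + C', fun p => ?_⟩, ⟨max R R', fun p hp => ?_⟩⟩
  · exact (abs_add_le _ _).trans (add_le_add (hC p) (hC' p))
  · rw [hR p ((le_max_left _ _).trans_lt hp), hR' p ((le_max_right _ _).trans_lt hp), add_zero]

/-- Domination by a bounded function with bounded support. -/
theorem mono (hg : BM g) (hf : Measurable f) {C : ℝ} (h : ∀ p, |f p| ≤ C * |g p|) : BM f := by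
  obtain ⟨C', hC'⟩ := hg.bdd
  obtain ⟨R, hR⟩ := hg.supp
  refine ⟨hf, ⟨|C| * C', fun p => ?_⟩, ⟨R, fun p hp => ?_⟩⟩
  · refine (h p).trans ?_
    exact mul_le_mul (le_abs_self _) (hC' p) (abs_nonneg _) (abs_nonneg _)
  · have := h p
    rw [hR p hp] at this
    simpa using this

theorem bmul (hg : BM g) (hf : Measurable f) {C : ℝ} (h : ∀ p, |f p| ≤ C) :
    BM (fun p => f p * g p) :=
  hg.mono (hf.mul hg.meas) (C := C) fun p => by
    rw [abs_mul]; exact mul_le_mul_of_nonneg_right (h p) (abs_nonneg _)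

theorem mul (hf : BM f) (hg : BM g) : BM (fun p => f p * g p) := by
  obtain ⟨C, hC⟩ := hf.bdd
  exact hg.bmul hf.meas hC

theorem const_mul (hf : BM f) (c : ℝ) : BM (fun p => c * f p) :=
  hf.bmul measurable_const (C := |c|) fun _ => le_rfl

theorem sub (hf : BM f) (hg : BM g) : BM (fun p => f p - g p) := by
  have := hf.add (hg.const_mul (-1))
  simpa [sub_eq_add_neg] using this

theorem abs (hf : BM f) : BM (fun p => |f p|) :=
  hf.mono hf.meas.abs (C := 1) fun p => by simp

theorem cv (hf : BM f) (hm : FB m) : BM (cv m f) := by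
  have := hm.fin
  obtain ⟨C, hC⟩ := hf.bdd
  obtain ⟨R, hR⟩ := hf.supp
  obtain ⟨r, hr⟩ := hm.supp
  refine ⟨cv_measurable hf.meas, ⟨_, cv_abs_le hC⟩, ⟨R + r, fun p hp => ?_⟩⟩
  rw [_root_.cv, integral_eq_zero_of_ae]
  filter_upwards [hr] with q hq
  refine hR _ ?_
  have : ‖p‖ ≤ ‖p - q‖ + ‖q‖ := by simpa using norm_add_le (p - q) q
  linarith

theorem integrable_mul {h : Eu N × ℝ → ℝ} (hf : BM f) (hh : Integrable h) :
    Integrable (fun p => h p * f p) := by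
  obtain ⟨C, hC⟩ := hf.bdd
  exact hh.mul_bdd hf.meas.aestronglyMeasurable (Eventually.of_forall hC)

end BM

theorem cv_add (hf : BM f) (hg : BM g) [IsFiniteMeasure m] (p : Eu N × ℝ) :
    cv m (fun p => f p + g p) p = cv m f p + cv m g p :=
  integral_add (hf.slice p) (hg.slice p)

theorem cv_const_mul (c : ℝ) (p : Eu N × ℝ) :
    cv m (fun p => c * f p) p = c * cv m f p :=
  integral_const_mul _ _

theorem cv_nonneg (hf : ∀ p, 0 ≤ f p) (p : Eu N × ℝ) : 0 ≤ cv m f p :=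
  integral_nonneg fun _ => hf _

/-- Integrability of `h (p - q)` on the product. -/
theorem integrable_sub_prod [IsFiniteMeasure m] {h : Eu N × ℝ → ℝ} (hh : Integrable h) :
    Integrable (fun z : (Eu N × ℝ) × (Eu N × ℝ) => h (z.1 - z.2)) (volume.prod m) := by
  have := (hh.comp_fst m)
  exact (measurePreserving_sub_prod volume m).integrable_comp_of_integrable this

theorem integrable_cv [IsFiniteMeasure m] {h : Eu N × ℝ → ℝ} (hh : Integrable h) :
    Integrable (cv m h) :=
  (integrable_sub_prod hh).integral_prod_left

theorem integral_cv [IsFiniteMeasure m] {h : Eu N × ℝ → ℝ} (hh : Integrable h) :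
    ∫ p, cv m h p = m.real univ * ∫ p, h p := by
  unfold cv
  rw [integral_integral_swap (integrable_sub_prod hh)]
  simp [integral_sub_right_eq_self]

theorem cv_symm [IsFiniteMeasure m] {h : Eu N × ℝ → ℝ} (hh : Integrable h)
    (hg : Measurable g) {C : ℝ} (hC : ∀ p, |g p| ≤ C) :
    ∫ p, cv m h p * g p = ∫ p, h p * cv (m.map Neg.neg) g p := by
  have h1 : Integrable (fun z : (Eu N × ℝ) × (Eu N × ℝ) => h (z.1 - z.2) * g z.1)
      (volume.prod m) :=
    (integrable_sub_prod hh).mul_bdd (hg.comp measurable_fst).aestronglyMeasurable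
      (Eventually.of_forall fun z => hC _)
  have h2 : Integrable (fun z : (Eu N × ℝ) × (Eu N × ℝ) => h z.1 * g (z.1 + z.2))
      (volume.prod m) :=
    (hh.comp_fst m).mul_bdd (hg.comp (measurable_fst.add measurable_snd)).aestronglyMeasurable
      (Eventually.of_forall fun z => hC _)
  calc ∫ p, cv m h p * g p = ∫ p, ∫ q, h (p - q) * g p ∂m := by
        simp only [cv, integral_mul_const]
    _ = ∫ q, (∫ p, h (p - q) * g p) ∂m := integral_integral_swap h1
    _ = ∫ q, (∫ p, h p * g (p + q)) ∂m := by
        congr 1; ext q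
        rw [← integral_sub_right_eq_self (fun p => h p * g (p + q)) q]
        simp
    _ = ∫ p, ∫ q, h p * g (p + q) ∂m := (integral_integral_swap h2).symm
    _ = ∫ p, h p * cv (m.map Neg.neg) g p := by
        congr 1; ext p
        rw [integral_const_mul, cv, integral_map measurable_neg.aemeasurable]
        · simp
        · exact (hg.comp (measurable_const.sub measurable_id)).aestronglyMeasurable

theorem integral_mul_cv_self_le (hf : BM f) [IsFiniteMeasure m] :
    ∫ p, f p * cv m f p ≤ m.real univ * ∫ p, f p ^ 2 := by
  have h2 : Integrable (fun p => f p ^ 2) := by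
    simpa [pow_two] using (hf.mul hf).integrable
  obtain ⟨C, hC⟩ := hf.bdd
  have hi : Integrable (fun z : (Eu N × ℝ) × (Eu N × ℝ) => f z.1 * f (z.1 - z.2))
      (volume.prod m) :=
    (hf.integrable.comp_fst m).mul_bdd
      (hf.meas.comp (measurable_fst.sub measurable_snd)).aestronglyMeasurable
      (Eventually.of_forall fun z => hC _)
  have hj : Integrable (fun z : (Eu N × ℝ) × (Eu N × ℝ) => f z.1 ^ 2 / 2 + f (z.1 - z.2) ^ 2 / 2)
      (volume.prod m) :=
    ((h2.comp_fst m).div_const 2).add ((integrable_sub_prod h2).div_const 2)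
  calc ∫ p, f p * cv m f p = ∫ p, ∫ q, f p * f (p - q) ∂m := by
        simp only [cv, integral_const_mul]
    _ = ∫ z, f z.1 * f (z.1 - z.2) ∂(volume.prod m) := (integral_prod _ hi).symm
    _ ≤ ∫ z, (f z.1 ^ 2 / 2 + f (z.1 - z.2) ^ 2 / 2) ∂(volume.prod m) := by
        refine integral_mono hi hj fun z => ?_
        simp only
        nlinarith [sq_nonneg (f z.1 - f (z.1 - z.2))]
    _ = m.real univ * ∫ p, f p ^ 2 := by
        rw [integral_add ((h2.comp_fst m).div_const 2) ((integrable_sub_prod h2).div_const 2),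
          integral_div, integral_div]
        have e1 : ∫ z : (Eu N × ℝ) × (Eu N × ℝ), f z.1 ^ 2 ∂(volume.prod m)
            = m.real univ * ∫ p, f p ^ 2 := by
          rw [integral_fun_fst (fun p => f p ^ 2)]; simp
        have e2 : ∫ z : (Eu N × ℝ) × (Eu N × ℝ), f (z.1 - z.2) ^ 2 ∂(volume.prod m)
            = m.real univ * ∫ p, f p ^ 2 := by
          rw [integral_prod _ (integrable_sub_prod h2)]
          exact integral_cv h2
        rw [e1, e2]; ring

end

section

variable {N : ℕ} {f g : Eu N × ℝ → ℝ} {m : Measure (Eu N × ℝ)}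

theorem BM.of_continuous (hf : Continuous f) (hc : HasCompactSupport f) : BM f := by
  obtain ⟨C, hC⟩ := hc.exists_bound_of_continuous hf
  obtain ⟨R, hR⟩ := hc.isCompact.isBounded.subset_closedBall 0
  refine ⟨hf.measurable, ⟨C, hC⟩, ⟨R, fun p hp => ?_⟩⟩
  by_contra h
  have := hR (subset_tsupport f h)
  simp at this
  linarith

theorem contDiff_fderiv_apply (hf : ContDiff ℝ (⊤ : ℕ∞) f) (d : Eu N × ℝ) :
    ContDiff ℝ (⊤ : ℕ∞) (fun p => fderiv ℝ f p d) :=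
  (hf.fderiv_right (m := ((⊤ : ℕ∞) : WithTop ℕ∞)) (by simp)).clm_apply contDiff_const

theorem cv_contDiff [IsFiniteMeasure m] (hf : ContDiff ℝ (⊤ : ℕ∞) f) (hc : HasCompactSupport f) :
    ContDiff ℝ (⊤ : ℕ∞) (cv m f) := by
  have : cv m f = convolution (fun _ => (1 : ℝ)) f (ContinuousLinearMap.lsmul ℝ ℝ) m := by
    ext p; simp [cv, convolution]
  rw [this]
  exact hc.contDiff_convolution_right _ (locallyIntegrable_const 1) hf

theorem cv_hasCompactSupport (hm : FB m) (hf : BM f) : HasCompactSupport (cv m f) := by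
  obtain ⟨R, hR⟩ := (hf.cv hm).supp
  refine HasCompactSupport.of_support_subset_isCompact (isCompact_closedBall 0 R) fun p hp => ?_
  by_contra h
  exact hp (hR p (by simpa using h))

theorem fderiv_cv [IsFiniteMeasure m] (hf : ContDiff ℝ (⊤ : ℕ∞) f) (hc : HasCompactSupport f)
    (p d : Eu N × ℝ) :
    fderiv ℝ (cv m f) p d = cv m (fun p => fderiv ℝ f p d) p := by
  have hfd : Continuous (fderiv ℝ f) := hf.continuous_fderiv (by simp)
  obtain ⟨C, hC⟩ := hc.exists_bound_of_continuous hf.continuous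
  obtain ⟨C', hC'⟩ := (hc.fderiv ℝ).exists_bound_of_continuous hfd
  have hi : ∀ p, Integrable (fun q => fderiv ℝ f (p - q)) m := fun p =>
    Integrable.of_bound (hfd.comp (continuous_const.sub continuous_id)).aestronglyMeasurable C'
      (Eventually.of_forall fun q => hC' _)
  have := hasFDerivAt_integral_of_dominated_of_fderiv_le (μ := m) (x₀ := p) (s := univ)
    (F := fun p q => f (p - q)) (F' := fun p q => fderiv ℝ f (p - q)) (bound := fun _ => C')
    univ_mem
    (Eventually.of_forall fun x =>
      (hf.continuous.comp (continuous_const.sub continuous_id)).aestronglyMeasurable)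
    (slice_integrable hf.continuous.measurable hC p)
    (hi p).aestronglyMeasurable
    (Eventually.of_forall fun q x _ => hC' _) (integrable_const _)
    (Eventually.of_forall fun q x _ => by
      have h1 : HasFDerivAt f (fderiv ℝ f (x - q)) (x - q) :=
        (hf.differentiable (by simp) _).hasFDerivAt
      simpa [Function.comp_def] using h1.comp x ((hasFDerivAt_id x).sub_const q))
  have h2 : HasFDerivAt (cv m f) (∫ q, fderiv ℝ f (p - q) ∂m) p := this
  rw [h2.fderiv, ContinuousLinearMap.integral_apply (hi p)]
  rfl

theorem lapX_contDiff (hf : ContDiff ℝ (⊤ : ℕ∞) f) : ContDiff ℝ (⊤ : ℕ∞) (lapX f) := by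
  unfold lapX
  exact ContDiff.sum fun i _ => contDiff_fderiv_apply (contDiff_fderiv_apply hf _) _

theorem fderiv_apply_hasCompactSupport (hc : HasCompactSupport f) (d : Eu N × ℝ) :
    HasCompactSupport (fun p => fderiv ℝ f p d) :=
  (hc.fderiv ℝ).comp_left (g := fun L : (Eu N × ℝ) →L[ℝ] ℝ => L d) (by simp)

theorem tsupport_fderiv_apply (d : Eu N × ℝ) :
    tsupport (fun p => fderiv ℝ f p d) ⊆ tsupport f := by
  refine (closure_mono ?_).trans (tsupport_fderiv_subset ℝ (f := f))
  intro p hp h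
  exact hp (by simp [h])

theorem tsupport_lapX : tsupport (lapX f) ⊆ tsupport f := by
  refine closure_minimal ?_ (isClosed_tsupport _)
  intro p hp
  by_contra h
  refine hp (Finset.sum_eq_zero fun i _ => ?_)
  by_contra h'
  exact h (tsupport_fderiv_apply _ (tsupport_fderiv_apply _ (subset_tsupport _ h')))

theorem lapX_hasCompactSupport (hc : HasCompactSupport f) : HasCompactSupport (lapX f) :=
  hc.of_isClosed_subset (isClosed_tsupport _) tsupport_lapX

theorem lapX_cv [IsFiniteMeasure m] (hf : ContDiff ℝ (⊤ : ℕ∞) f) (hc : HasCompactSupport f)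
    (p : Eu N × ℝ) : lapX (cv m f) p = cv m (lapX f) p := by
  have hbm : ∀ i : Fin N, BM (fun p : Eu N × ℝ => fderiv ℝ (fun q => fderiv ℝ f q
      (EuclideanSpace.single i 1, 0)) p (EuclideanSpace.single i 1, 0)) := fun i =>
    BM.of_continuous (contDiff_fderiv_apply (contDiff_fderiv_apply hf _) _).continuous
      (fderiv_apply_hasCompactSupport (fderiv_apply_hasCompactSupport hc _) _)
  unfold lapX
  rw [cv, integral_finsetSum _ fun i _ => (hbm i).slice p]
  refine Finset.sum_congr rfl fun i _ => ?_
  have : (fun q => fderiv ℝ (cv m f) q (EuclideanSpace.single i 1, 0)) =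
      cv m (fun q => fderiv ℝ f q (EuclideanSpace.single i 1, 0)) :=
    funext fun q => fderiv_cv hf hc q _
  rw [this, fderiv_cv (contDiff_fderiv_apply hf _) (fderiv_apply_hasCompactSupport hc _)]
  rfl

theorem ptder_cv [IsFiniteMeasure m] (hf : ContDiff ℝ (⊤ : ℕ∞) f) (hc : HasCompactSupport f)
    (p : Eu N × ℝ) : ptder (cv m f) p = cv m (ptder f) p :=
  fderiv_cv hf hc p _

/-- Convolution with a probability measure concentrated near `0` is close to the identity. -/
theorem cv_approx (hg : Integrable g) {η : ℝ} (hη : 0 < η) :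
    ∃ ε₀ > 0, ∀ k : Measure (Eu N × ℝ), IsProbabilityMeasure k →
      (∀ᵐ q ∂k, ‖q‖ ≤ ε₀) → ∫ p, |g p - cv k g p| ≤ η := by
  obtain ⟨h, hc, hgh, hcont, h_int⟩ := hg.exists_hasCompactSupport_integral_sub_le
    (show 0 < η / 3 by positivity)
  obtain ⟨R, hR⟩ := (BM.of_continuous hcont hc).supp
  set B : Set (Eu N × ℝ) := closedBall 0 (R + 1) with hB
  have hBfin : volume B < ⊤ := measure_closedBall_lt_top
  set V := (volume B).toReal + 1 with hV
  have hVpos : 0 < V := by positivity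
  have huc := hc.uniformContinuous_of_continuous hcont
  obtain ⟨δ, hδ, hδ'⟩ := Metric.uniformContinuous_iff.1 huc (η / 3 / V) (by positivity)
  refine ⟨min (δ / 2) 1, by positivity, fun k hk hkε => ?_⟩
  have hle : ∀ p, |h p - cv k h p| ≤ B.indicator (fun _ => η / 3 / V) p := by
    intro p
    have hi : Integrable (fun q => h (p - q)) k := (BM.of_continuous hcont hc).slice p
    have e : h p - cv k h p = ∫ q, (h p - h (p - q)) ∂k := by
      rw [integral_sub (integrable_const _) hi]; simp [cv]
    rw [e]
    by_cases hp : p ∈ B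
    · rw [indicator_of_mem hp]
      have := norm_integral_le_of_norm_le_const (μ := k) (f := fun q => h p - h (p - q))
        (C := η / 3 / V) ?_
      · simpa using this
      · filter_upwards [hkε] with q hq
        have : dist p (p - q) < δ := by
          rw [dist_eq_norm]; simp only [sub_sub_cancel]
          exact (hq.trans (min_le_left _ _)).trans_lt (by linarith)
        have := (hδ' this).le
        rwa [Real.dist_eq] at this
    · rw [indicator_of_notMem hp, integral_eq_zero_of_ae, abs_zero]
      filter_upwards [hkε] with q hq
      have hp' : R + 1 < ‖p‖ := by simpa [hB] using hp
      have hq1 : ‖q‖ ≤ 1 := hq.trans (min_le_right _ _)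
      have h3 : ‖p‖ ≤ ‖p - q‖ + ‖q‖ := by simpa using norm_add_le (p - q) q
      rw [hR p (by linarith), hR (p - q) (by linarith)]; simp
  have hik := integrable_cv (m := k) hg
  have hikh := integrable_cv (m := k) h_int
  have i1 : Integrable (fun p => |g p - h p|) := (hg.sub h_int).abs
  have i2 : Integrable (fun p => |h p - cv k h p|) := (h_int.sub hikh).abs
  have i3 : Integrable (fun p => |cv k g p - cv k h p|) := (hik.sub hikh).abs
  have e1 : ∫ p, |h p - cv k h p| ≤ η / 3 := by
    calc ∫ p, |h p - cv k h p| ≤ ∫ p, B.indicator (fun _ => η / 3 / V) p := by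
          refine integral_mono (h_int.sub hikh).abs ?_ hle
          exact (integrableOn_const hBfin.ne).integrable_indicator measurableSet_closedBall
      _ = (volume B).toReal * (η / 3 / V) := by
          rw [integral_indicator measurableSet_closedBall, setIntegral_const]; rfl
      _ ≤ V * (η / 3 / V) := by
          refine mul_le_mul_of_nonneg_right (by linarith) (by positivity)
      _ = η / 3 := by field_simp
  have e2 : ∫ p, |cv k g p - cv k h p| ≤ η / 3 := by
    calc ∫ p, |cv k g p - cv k h p| ≤ ∫ p, cv k (fun p => |g p - h p|) p := by
          refine integral_mono_ae i3 (integrable_cv i1) ?_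
          filter_upwards [(integrable_sub_prod (m := k) hg).prod_right_ae,
            (integrable_sub_prod (m := k) h_int).prod_right_ae] with p h1 h2
          simp only [cv]
          rw [← integral_sub h1 h2]
          exact abs_integral_le_integral_abs
      _ = ∫ p, |g p - h p| := by
          rw [integral_cv i1]; simp
      _ ≤ η / 3 := hgh
  calc ∫ p, |g p - cv k g p|
      ≤ ∫ p, (|g p - h p| + |h p - cv k h p| + |cv k g p - cv k h p|) := by
        refine integral_mono (hg.sub hik).abs ((i1.add i2).add i3) fun p => ?_
        have h1 := abs_sub_le (g p) (h p) (cv k g p)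
        have h2 := abs_sub_le (h p) (cv k h p) (cv k g p)
        rw [abs_sub_comm (cv k h p)] at h2
        simp only
        linarith
    _ = (∫ p, |g p - h p|) + (∫ p, |h p - cv k h p|) + ∫ p, |cv k g p - cv k h p| := by
        rw [integral_add (by exact i1.add i2) i3, integral_add i1 i2]
    _ ≤ η := by
        have : ∫ p, |g p - h p| ≤ η / 3 := hgh
        linarith

end

/-- Radial profile of the smoothing kernel. -/
def kprof (s : ℝ) : ℝ := Real.smoothTransition (1 - s)

/-- Smooth radial bump. -/
def kbump {N : ℕ} (y : Eu N) : ℝ := kprof (‖y‖ ^ 2)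

/-- Radial density with `∇ kbump y = - mbump y • y`. -/
def mbump {N : ℕ} (y : Eu N) : ℝ := -2 * deriv kprof (‖y‖ ^ 2)

theorem kprof_contDiff : ContDiff ℝ (⊤ : ℕ∞) kprof :=
  Real.smoothTransition.contDiff.comp (contDiff_const.sub contDiff_id)

theorem kprof_antitone : Antitone kprof := fun _ _ h =>
  Real.smoothTransition.monotone (by linarith)

theorem kprof_zero {s : ℝ} (h : 1 ≤ s) : kprof s = 0 :=
  Real.smoothTransition.zero_of_nonpos (by linarith)

theorem deriv_kprof_zero {s : ℝ} (h : 1 < s) : deriv kprof s = 0 := by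
  have : kprof =ᶠ[𝓝 s] fun _ => 0 := by
    filter_upwards [Ioi_mem_nhds h] with t ht
    exact kprof_zero (le_of_lt ht)
  rw [this.deriv_eq]; simp

section

variable {N : ℕ}

theorem kbump_contDiff : ContDiff ℝ (⊤ : ℕ∞) (kbump : Eu N → ℝ) :=
  kprof_contDiff.comp (contDiff_norm_sq ℝ)

theorem kbump_nonneg (y : Eu N) : 0 ≤ kbump y := Real.smoothTransition.nonneg _

theorem mbump_nonneg (y : Eu N) : 0 ≤ mbump y := by
  have : deriv kprof (‖y‖ ^ 2) ≤ 0 := kprof_antitone.deriv_nonpos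
  unfold mbump; linarith

theorem mbump_continuous : Continuous (mbump : Eu N → ℝ) := by
  have : Continuous (deriv kprof) := kprof_contDiff.continuous_deriv (by simp)
  unfold mbump; fun_prop

theorem kbump_zero {y : Eu N} (h : 1 < ‖y‖) : kbump y = 0 :=
  kprof_zero (by nlinarith)

theorem mbump_zero {y : Eu N} (h : 1 < ‖y‖) : mbump y = 0 := by
  unfold mbump; rw [deriv_kprof_zero (by nlinarith)]; simp

theorem kbump_hasCompactSupport : HasCompactSupport (kbump : Eu N → ℝ) :=
  HasCompactSupport.of_support_subset_isCompact (isCompact_closedBall 0 1) fun p hp => by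
    by_contra h
    exact hp (kbump_zero (by simpa using h))

theorem mbump_hasCompactSupport : HasCompactSupport (mbump : Eu N → ℝ) :=
  HasCompactSupport.of_support_subset_isCompact (isCompact_closedBall 0 1) fun p hp => by
    by_contra h
    exact hp (mbump_zero (by simpa using h))

theorem fderiv_kbump (y d : Eu N) : fderiv ℝ kbump y d = -mbump y * inner ℝ y d := by
  have h1 : HasDerivAt kprof (deriv kprof (‖y‖ ^ 2)) (‖y‖ ^ 2) :=
    (kprof_contDiff.differentiable (by simp) _).hasDerivAt
  have h2 := (hasStrictFDerivAt_norm_sq y).hasFDerivAt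
  have h3 := h1.comp_hasFDerivAt y h2
  have h4 : fderiv ℝ kbump y = deriv kprof (‖y‖ ^ 2) • (2 • innerSL ℝ y) := h3.fderiv
  rw [h4]; simp [mbump]; ring

theorem kbump_integral_pos : 0 < ∫ y : Eu N, kbump y := by
  refine Continuous.integral_pos_of_hasCompactSupport_nonneg_nonzero (x := 0)
    kbump_contDiff.continuous kbump_hasCompactSupport kbump_nonneg ?_
  simp [kbump, kprof, Real.smoothTransition.one_of_one_le]

theorem sum_single_smul (y : Eu N) :
    ((y, 0) : Eu N × ℝ) = ∑ i, y i • ((EuclideanSpace.single i 1, 0) : Eu N × ℝ) := by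
  rw [Prod.ext_iff]
  constructor
  · rw [Prod.fst_sum]
    ext j
    simp [Finset.sum_apply, Pi.single_apply]
  · rw [Prod.snd_sum]; simp

theorem hasFDerivAt_shift (p : Eu N × ℝ) (s : ℝ) (y : Eu N) {h : Eu N × ℝ → ℝ}
    (hh : ContDiff ℝ (⊤ : ℕ∞) h) :
    HasFDerivAt (fun y : Eu N => h (p - (s • y, 0)))
      ((fderiv ℝ h (p - (s • y, 0))).comp (-(s • ContinuousLinearMap.inl ℝ (Eu N) ℝ))) y := by
  have h1 : HasFDerivAt h (fderiv ℝ h (p - (s • y, 0))) (p - (s • y, 0)) :=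
    (hh.differentiable (by simp) _).hasFDerivAt
  have h2 : HasFDerivAt (fun y : Eu N => p - ((s • y, 0) : Eu N × ℝ))
      (-(s • ContinuousLinearMap.inl ℝ (Eu N) ℝ)) y := by
    have h3 : HasFDerivAt (fun y : Eu N => (s • ContinuousLinearMap.inl ℝ (Eu N) ℝ) y)
      (s • ContinuousLinearMap.inl ℝ (Eu N) ℝ) y := ContinuousLinearMap.hasFDerivAt _
    have h4 := h3.const_sub p
    have e : (fun y : Eu N => p - (s • ContinuousLinearMap.inl ℝ (Eu N) ℝ) y) =
      fun y : Eu N => p - ((s • y, 0) : Eu N × ℝ) := by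
      ext y <;> simp
    rwa [e] at h4
  exact h1.comp y h2

theorem kernel_ibp {g : Eu N × ℝ → ℝ} (hg : ContDiff ℝ (⊤ : ℕ∞) g) (p : Eu N × ℝ) (s : ℝ) :
    ∫ y : Eu N, mbump y * fderiv ℝ g (p - (s • y, 0)) (y, 0) =
      -(s * ∫ y : Eu N, kbump y * lapX g (p - (s • y, 0))) := by
  have hcs : Continuous fun y : Eu N => p - ((s • y, 0) : Eu N × ℝ) := by fun_prop
  set Dg : Fin N → Eu N × ℝ → ℝ := fun i q => fderiv ℝ g q (EuclideanSpace.single i 1, 0) with hDg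
  have hD : ∀ i, ContDiff ℝ (⊤ : ℕ∞) (Dg i) := fun i => contDiff_fderiv_apply hg _
  have hDD : ∀ i, ContDiff ℝ (⊤ : ℕ∞) (fun q => fderiv ℝ (Dg i) q (EuclideanSpace.single i 1, 0)) :=
    fun i => contDiff_fderiv_apply (hD i) _
  have hci : ∀ f : Eu N → ℝ, Continuous f → Integrable (fun y => mbump y * f y) := fun f hf =>
    (mbump_continuous.mul hf).integrable_of_hasCompactSupport (mbump_hasCompactSupport.mul_right)
  have hki : ∀ f : Eu N → ℝ, Continuous f → Integrable (fun y => kbump y * f y) := fun f hf =>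
    (kbump_contDiff.continuous.mul hf).integrable_of_hasCompactSupport
      (kbump_hasCompactSupport.mul_right)
  have hfd : ∀ i (y : Eu N), fderiv ℝ (fun y => Dg i (p - (s • y, 0))) y
      (EuclideanSpace.single i 1) =
      -s * fderiv ℝ (Dg i) (p - (s • y, 0)) (EuclideanSpace.single i 1, 0) := by
    intro i y
    rw [(hasFDerivAt_shift p s y (hD i)).fderiv]
    simp
  have key : ∀ i, ∫ y : Eu N, mbump y * (y i * Dg i (p - (s • y, 0))) =
      -s * ∫ y : Eu N, kbump y *
        fderiv ℝ (Dg i) (p - (s • y, 0)) (EuclideanSpace.single i 1, 0) := by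
    intro i
    have hDc : Continuous fun y : Eu N => Dg i (p - (s • y, 0)) := (hD i).continuous.comp hcs
    have hfk : ∀ y : Eu N, fderiv ℝ kbump y (EuclideanSpace.single i 1) = -mbump y * y i := by
      intro y; rw [fderiv_kbump]; simp [EuclideanSpace.inner_single_right]
    have hyc : Continuous fun y : Eu N => y i := by fun_prop
    have := integral_mul_fderiv_eq_neg_fderiv_mul_of_integrable (μ := (volume : Measure (Eu N)))
      (f := kbump) (g := fun y => Dg i (p - (s • y, 0))) (v := EuclideanSpace.single i 1)
      (by
        simp only [hfk]
        have := (hci _ (hyc.mul hDc)).neg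
        refine this.congr (Eventually.of_forall fun y => ?_)
        simp; ring)
      (by
        simp only [hfd]
        exact hki _ (continuous_const.mul ((hDD i).continuous.comp hcs)))
      (hki _ hDc)
      (fun x _ => kbump_contDiff.differentiable (by simp) x)
      (fun x _ => (hasFDerivAt_shift p s x (hD i)).differentiableAt)
    simp only [hfk, hfd] at this
    rw [← integral_const_mul]
    calc _ = -∫ y : Eu N, -mbump y * y i * Dg i (p - (s • y, 0)) := by
          rw [← integral_neg]; congr 1; ext y; ring
      _ = _ := by rw [← this]; congr 1; ext y; ring
  calc ∫ y : Eu N, mbump y * fderiv ℝ g (p - (s • y, 0)) (y, 0)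
      = ∫ y : Eu N, ∑ i, mbump y * (y i * Dg i (p - (s • y, 0))) := by
        congr 1; ext y
        rw [sum_single_smul y, map_sum, Finset.mul_sum]
        simp only [map_smul, smul_eq_mul, hDg]
    _ = ∑ i, ∫ y : Eu N, mbump y * (y i * Dg i (p - (s • y, 0))) :=
        integral_finsetSum _ fun i _ => hci _
          ((by fun_prop : Continuous fun y : Eu N => y i).mul ((hD i).continuous.comp hcs))
    _ = -(s * ∑ i, ∫ y : Eu N, kbump y *
        fderiv ℝ (Dg i) (p - (s • y, 0)) (EuclideanSpace.single i 1, 0)) := by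
        simp only [key]; rw [← Finset.mul_sum]; ring
    _ = _ := by
        have : ∫ y : Eu N, kbump y * lapX g (p - (s • y, 0)) = ∑ i, ∫ y : Eu N, kbump y *
            fderiv ℝ (Dg i) (p - (s • y, 0)) (EuclideanSpace.single i 1, 0) := by
          have h1 := integral_finsetSum (μ := (volume : Measure (Eu N))) Finset.univ
            (f := fun (i : Fin N) (y : Eu N) => kbump y *
              fderiv ℝ (Dg i) (p - (s • y, 0)) (EuclideanSpace.single i 1, 0))
            fun i _ => hki _ ((hDD i).continuous.comp hcs)
          rw [← h1]
          simp only [← Finset.mul_sum]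
          rfl
        rw [this]

theorem kernel_identity {g : Eu N × ℝ → ℝ} (hg : ContDiff ℝ (⊤ : ℕ∞) g) (p : Eu N × ℝ) {ε : ℝ}
    (hε : 0 ≤ ε) :
    ∫ y : Eu N, mbump y * (g (p - (ε • y, 0)) - g p) =
      ∫ s in Ioc 0 ε, s * ∫ y : Eu N, kbump y * lapX g (p - (s • y, 0)) := by
  have hG : Continuous fun z : Eu N × ℝ => mbump z.1 * fderiv ℝ g (p - (z.2 • z.1, 0)) (z.1, 0) := by
    have h1 : Continuous (fderiv ℝ g) := hg.continuous_fderiv (by simp)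
    have h2 : Continuous fun z : Eu N × ℝ => fderiv ℝ g (p - (z.2 • z.1, 0)) := by fun_prop
    exact (mbump_continuous.comp continuous_fst).mul (h2.clm_apply (by fun_prop))
  have h_int : Integrable (fun z : Eu N × ℝ => mbump z.1 * fderiv ℝ g (p - (z.2 • z.1, 0)) (z.1, 0))
      (volume.prod (volume.restrict (Ioc 0 ε))) := by
    have h1 : IntegrableOn (fun z : Eu N × ℝ => mbump z.1 * fderiv ℝ g (p - (z.2 • z.1, 0)) (z.1, 0))
        (closedBall 0 1 ×ˢ Icc 0 ε) :=
      hG.continuousOn.integrableOn_compact ((isCompact_closedBall 0 1).prod isCompact_Icc)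
    have h2 : IntegrableOn (fun z : Eu N × ℝ => mbump z.1 * fderiv ℝ g (p - (z.2 • z.1, 0)) (z.1, 0))
        (univ ×ˢ Ioc 0 ε) := by
      refine (h1.mono_set (t := closedBall 0 1 ×ˢ Icc 0 ε) (s := closedBall 0 1 ×ˢ Ioc 0 ε)
        (prod_mono le_rfl Ioc_subset_Icc_self)).of_forall_sdiff_eq_zero
        (MeasurableSet.univ.prod measurableSet_Ioc) ?_
      rintro ⟨y, s⟩ ⟨⟨_, hs⟩, h⟩
      have : 1 < ‖y‖ := by
        by_contra hy
        exact h ⟨by simpa using hy, hs⟩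
      simp [mbump_zero this]
    have h3 : (volume.prod (volume.restrict (Ioc 0 ε)) : Measure (Eu N × ℝ)) =
        volume.restrict (univ ×ˢ Ioc 0 ε) := by
      rw [Measure.volume_eq_prod, ← Measure.prod_restrict, Measure.restrict_univ]
    rw [h3]; exact h2
  have hftc : ∀ y : Eu N, g (p - (ε • y, 0)) - g p =
      ∫ s in Ioc 0 ε, -fderiv ℝ g (p - (s • y, 0)) (y, 0) := by
    intro y
    rw [← intervalIntegral.integral_of_le hε]
    have hd : ∀ s : ℝ, HasDerivAt (fun s : ℝ => g (p - (s • y, 0)))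
        (-fderiv ℝ g (p - (s • y, 0)) (y, 0)) s := by
      intro s
      have h1 : HasFDerivAt g (fderiv ℝ g (p - (s • y, 0))) (p - (s • y, 0)) :=
        (hg.differentiable (by simp) _).hasFDerivAt
      have h2 : HasDerivAt (fun s : ℝ => p - ((s • y, 0) : Eu N × ℝ)) (-(y, 0)) s := by
        have h3 : HasDerivAt (fun s : ℝ => s • ((y, 0) : Eu N × ℝ)) (y, 0) s := by
          simpa using (hasDerivAt_id s).smul_const ((y, 0) : Eu N × ℝ)
        have h4 := h3.const_sub p
        simpa using h4
      have h5 := h1.comp_hasDerivAt s h2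
      rw [map_neg] at h5
      exact h5
    rw [intervalIntegral.integral_eq_sub_of_hasDerivAt (fun s _ => hd s)]
    · have : ((0 : ℝ) • y, (0 : ℝ)) = (0 : Eu N × ℝ) := by simp
      rw [this, sub_zero]
    · refine Continuous.intervalIntegrable ?_ _ _
      have h1 : Continuous (fderiv ℝ g) := hg.continuous_fderiv (by simp)
      have h2 : Continuous fun s : ℝ => fderiv ℝ g (p - (s • y, 0)) := by fun_prop
      exact (h2.clm_apply continuous_const).neg
  calc ∫ y : Eu N, mbump y * (g (p - (ε • y, 0)) - g p)
      = ∫ y : Eu N, ∫ s in Ioc 0 ε, -(mbump y * fderiv ℝ g (p - (s • y, 0)) (y, 0)) := by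
        congr 1; ext y
        rw [hftc, ← integral_const_mul]; congr 1; ext s; ring
    _ = ∫ s in Ioc 0 ε, ∫ y : Eu N, -(mbump y * fderiv ℝ g (p - (s • y, 0)) (y, 0)) :=
        integral_integral_swap h_int.neg
    _ = _ := by
        congr 1; ext s
        rw [integral_neg, kernel_ibp hg, neg_neg]

end

/-- A smoothing kernel `k` and a positive symmetric measure `μ` with `k * Δ g = μ * g - lam g`. -/
structure Ker {N : ℕ} (ε lam : ℝ) (k μ : Measure (Eu N × ℝ)) : Prop where
  prob : IsProbabilityMeasure k
  fin : IsFiniteMeasure μ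
  ksymm : k.map Neg.neg = k
  msymm : μ.map Neg.neg = μ
  ksupp : ∀ᵐ q ∂k, ‖q.1‖ ≤ ε ∧ q.2 = 0
  msupp : ∀ᵐ q ∂μ, ‖q.1‖ ≤ ε ∧ q.2 = 0
  mass : μ.real univ = lam
  lap : ∀ g : Eu N × ℝ → ℝ, ContDiff ℝ (⊤ : ℕ∞) g → ∀ p,
    cv k (lapX g) p = cv μ g p - lam * g p

section

variable {N : ℕ}

theorem withDensity_map_neg {f : Eu N → ℝ} (hf : Measurable f) (he : ∀ y, f (-y) = f y) :
    ((volume : Measure (Eu N)).withDensity fun y => ENNReal.ofReal (f y)).map Neg.neg =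
      (volume : Measure (Eu N)).withDensity fun y => ENNReal.ofReal (f y) := by
  ext s hs
  rw [Measure.map_apply measurable_neg hs, withDensity_apply _ (measurable_neg hs),
    withDensity_apply _ hs, ← lintegral_indicator (measurable_neg hs), ← lintegral_indicator hs]
  rw [← (Measure.measurePreserving_neg (volume : Measure (Eu N))).lintegral_comp
    (hf.ennreal_ofReal.indicator hs)]
  congr 1; ext y
  simp only [indicator, he]
  rfl

theorem integral_withDensity_ofReal {f : Eu N → ℝ} (hf : Measurable f) (h0 : ∀ y, 0 ≤ f y)
    (g : Eu N → ℝ) :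
    ∫ y, g y ∂((volume : Measure (Eu N)).withDensity fun y => ENNReal.ofReal (f y)) =
      ∫ y, f y * g y := by
  rw [integral_withDensity_eq_integral_toReal_smul hf.ennreal_ofReal (by simp)]
  simp [ENNReal.toReal_ofReal, h0]

theorem integral_withDensity_id {ε : ℝ} (g : ℝ → ℝ) :
    ∫ s, g s ∂((volume.restrict (Ioc 0 ε)).withDensity fun s => ENNReal.ofReal s) =
      ∫ s in Ioc 0 ε, s * g s := by
  rw [integral_withDensity_eq_integral_toReal_smul ENNReal.measurable_ofReal (by simp)]
  refine setIntegral_congr_fun measurableSet_Ioc fun s hs => ?_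
  simp [ENNReal.toReal_ofReal hs.1.le]

theorem exists_ker (N : ℕ) : ∃ L : ℝ, 0 ≤ L ∧ ∀ ε : ℝ, 0 < ε →
    ∃ k μ : Measure (Eu N × ℝ), Ker ε (L / ε ^ 2) k μ := by
  set κ₀ : ℝ := ∫ y : Eu N, kbump y with hκ₀
  have hκ₀pos : 0 < κ₀ := kbump_integral_pos
  set M₀ : ℝ := ∫ y : Eu N, mbump y with hM₀
  have hM₀0 : 0 ≤ M₀ := integral_nonneg mbump_nonneg
  refine ⟨2 * M₀ / κ₀, by positivity, fun ε hε => ?_⟩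
  set c : ℝ := 2 / (κ₀ * ε ^ 2) with hc
  have hcpos : 0 < c := by positivity
  set K : Measure (Eu N) := volume.withDensity fun y => ENNReal.ofReal (kbump y) with hK
  set M : Measure (Eu N) := volume.withDensity fun y => ENNReal.ofReal (mbump y) with hM
  set S : Measure ℝ := (volume.restrict (Ioc 0 ε)).withDensity fun s => ENNReal.ofReal s with hS
  have hkm : Measurable (kbump : Eu N → ℝ) := kbump_contDiff.continuous.measurable
  have hmm : Measurable (mbump : Eu N → ℝ) := mbump_continuous.measurable
  have hkint : Integrable (kbump : Eu N → ℝ) :=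
    kbump_contDiff.continuous.integrable_of_hasCompactSupport kbump_hasCompactSupport
  have hmint : Integrable (mbump : Eu N → ℝ) :=
    mbump_continuous.integrable_of_hasCompactSupport mbump_hasCompactSupport
  have hKfin : IsFiniteMeasure K := isFiniteMeasure_withDensity_ofReal hkint.2
  have hMfin : IsFiniteMeasure M := isFiniteMeasure_withDensity_ofReal hmint.2
  have hidint : IntegrableOn (fun s : ℝ => s) (Ioc 0 ε) :=
    (continuous_id.integrableOn_Icc).mono_set Ioc_subset_Icc_self
  have hSfin : IsFiniteMeasure S := isFiniteMeasure_withDensity_ofReal hidint.2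
  have hKr : K.real univ = κ₀ := by
    have := integral_withDensity_ofReal hkm kbump_nonneg (fun _ => (1 : ℝ))
    simpa using this
  have hMr : M.real univ = M₀ := by
    have := integral_withDensity_ofReal hmm mbump_nonneg (fun _ => (1 : ℝ))
    simpa using this
  have hSr : S.real univ = ε ^ 2 / 2 := by
    have h1 := integral_withDensity_id (ε := ε) (fun _ => (1 : ℝ))
    rw [← intervalIntegral.integral_of_le hε.le] at h1
    simpa using h1
  have hKn : K.map Neg.neg = K := withDensity_map_neg hkm fun y => by simp [kbump]
  have hMn : M.map Neg.neg = M := withDensity_map_neg hmm fun y => by simp [mbump]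
  have hKs : ∀ᵐ y ∂K, ‖y‖ ≤ 1 := by
    rw [hK, ae_withDensity_iff hkm.ennreal_ofReal]
    refine Eventually.of_forall fun y hy => ?_
    by_contra h
    exact hy (by rw [kbump_zero (not_le.1 h)]; simp)
  have hMs : ∀ᵐ y ∂M, ‖y‖ ≤ 1 := by
    rw [hM, ae_withDensity_iff hmm.ennreal_ofReal]
    refine Eventually.of_forall fun y hy => ?_
    by_contra h
    exact hy (by rw [mbump_zero (not_le.1 h)]; simp)
  have hSs : ∀ᵐ s ∂S, s ∈ Ioc 0 ε := by
    refine (withDensity_absolutelyContinuous _ _).ae_le ?_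
    exact ae_restrict_mem measurableSet_Ioc
  set φ : ℝ × Eu N → Eu N × ℝ := fun z => (z.1 • z.2, 0) with hφ
  have hφm : Measurable φ := by
    have : Continuous φ := by fun_prop
    exact this.measurable
  set θ : Eu N → Eu N × ℝ := fun y => (ε • y, 0) with hθ
  have hθm : Measurable θ := by
    have : Continuous θ := by fun_prop
    exact this.measurable
  have hcr : (ENNReal.ofReal c).toReal = c := ENNReal.toReal_ofReal hcpos.le
  have hc0 : ENNReal.ofReal c ≠ ⊤ := ENNReal.ofReal_ne_top
  have hSK : (S.prod K).map φ univ = S univ * K univ := by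
    rw [Measure.map_apply hφm MeasurableSet.univ, preimage_univ, ← univ_prod_univ,
      Measure.prod_prod]
  have hfin1 : IsFiniteMeasure ((S.prod K).map φ) := Measure.isFiniteMeasure_map _ _
  have hfin2 : IsFiniteMeasure (M.map θ) := Measure.isFiniteMeasure_map _ _
  refine ⟨ENNReal.ofReal c • (S.prod K).map φ, ENNReal.ofReal c • M.map θ, ?_⟩
  have hfin3 : IsFiniteMeasure (ENNReal.ofReal c • (S.prod K).map φ) :=
    Measure.smul_finite _ hc0
  have hfin4 : IsFiniteMeasure (ENNReal.ofReal c • M.map θ) := Measure.smul_finite _ hc0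
  refine ⟨?_, hfin4, ?_, ?_, ?_, ?_, ?_, ?_⟩
  · refine ⟨?_⟩
    have : (ENNReal.ofReal c • (S.prod K).map φ).real univ = 1 := by
      rw [Measure.real, Measure.smul_apply, hSK, smul_eq_mul, ENNReal.toReal_mul,
        ENNReal.toReal_mul, hcr]
      change c * (S.real univ * K.real univ) = 1
      rw [hSr, hKr, hc]; field_simp
    have h2 := ENNReal.ofReal_toReal (measure_ne_top (ENNReal.ofReal c • (S.prod K).map φ) univ)
    rw [← h2]
    change ENNReal.ofReal (Measure.real _ univ) = 1
    rw [this]; simp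
  · rw [Measure.map_smul, Measure.map_map measurable_neg hφm]
    have e : Neg.neg ∘ φ = φ ∘ Prod.map id Neg.neg := by
      ext z <;> simp [hφ]
    rw [e, ← Measure.map_map hφm (measurable_id.prodMap measurable_neg),
      ← Measure.map_prod_map _ _ measurable_id measurable_neg, Measure.map_id, hKn]
  · rw [Measure.map_smul, Measure.map_map measurable_neg hθm]
    have e : Neg.neg ∘ θ = θ ∘ Neg.neg := by
      ext z <;> simp [hθ]
    rw [e, ← Measure.map_map hθm measurable_neg, hMn]
  · refine Measure.ae_smul_measure ?_ _
    rw [ae_map_iff hφm.aemeasurable]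
    · have h1 : ∀ᵐ z ∂(S.prod K), z.1 ∈ Ioc 0 ε :=
        Measure.quasiMeasurePreserving_fst.ae hSs
      have h2 : ∀ᵐ z ∂(S.prod K), ‖z.2‖ ≤ 1 :=
        Measure.quasiMeasurePreserving_snd.ae hKs
      filter_upwards [h1, h2] with z hz1 hz2
      refine ⟨?_, rfl⟩
      simp only [hφ, norm_smul, Real.norm_eq_abs, abs_of_pos hz1.1]
      calc z.1 * ‖z.2‖ ≤ ε * 1 := mul_le_mul hz1.2 hz2 (norm_nonneg _) hε.le
        _ = ε := mul_one _
    · exact ((measurableSet_le measurable_fst.norm measurable_const).inter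
        (measurable_snd (measurableSet_singleton 0)))
  · refine Measure.ae_smul_measure ?_ _
    rw [ae_map_iff hθm.aemeasurable]
    · filter_upwards [hMs] with y hy
      refine ⟨?_, rfl⟩
      simp only [hθ, norm_smul, Real.norm_eq_abs, abs_of_pos hε]
      nlinarith
    · exact ((measurableSet_le measurable_fst.norm measurable_const).inter
        (measurable_snd (measurableSet_singleton 0)))
  · rw [Measure.real, Measure.smul_apply, Measure.map_apply hθm MeasurableSet.univ, preimage_univ,
      smul_eq_mul, ENNReal.toReal_mul, hcr]
    change c * M.real univ = _
    rw [hMr, hc]; field_simp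
  · intro g hg p
    have hlc : Continuous (lapX g) := (lapX_contDiff hg).continuous
    have hps : ∀ h : Eu N × ℝ → ℝ, Continuous h → Continuous fun q => h (p - q) := fun h hh =>
      hh.comp (continuous_const.sub continuous_id)
    have hik : Integrable (fun z : ℝ × Eu N => lapX g (p - φ z)) (S.prod K) := by
      obtain ⟨C, hC⟩ := (((isCompact_Icc (a := (0 : ℝ)) (b := ε)).prod
        (isCompact_closedBall (0 : Eu N) 1))).exists_bound_of_continuousOn
        (f := fun z : ℝ × Eu N => lapX g (p - φ z))
        ((hlc.comp (continuous_const.sub (by fun_prop))).continuousOn)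
      refine Integrable.of_bound (hlc.measurable.comp
        (measurable_const.sub hφm)).aestronglyMeasurable C ?_
      have h1 : ∀ᵐ z ∂(S.prod K), z.1 ∈ Ioc 0 ε :=
        Measure.quasiMeasurePreserving_fst.ae hSs
      have h2 : ∀ᵐ z ∂(S.prod K), ‖z.2‖ ≤ 1 :=
        Measure.quasiMeasurePreserving_snd.ae hKs
      filter_upwards [h1, h2] with z hz1 hz2
      exact hC z ⟨Ioc_subset_Icc_self hz1, by simpa using hz2⟩
    have hgi : Integrable (fun y : Eu N => mbump y * g (p - (ε • y, 0))) :=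
      (mbump_continuous.mul (hg.continuous.comp (by fun_prop))).integrable_of_hasCompactSupport
        mbump_hasCompactSupport.mul_right
    have e1 : cv (ENNReal.ofReal c • (S.prod K).map φ) (lapX g) p =
        c * ∫ s in Ioc 0 ε, s * ∫ y : Eu N, kbump y * lapX g (p - (s • y, 0)) := by
      rw [cv, integral_smul_measure, hcr, smul_eq_mul,
        integral_map hφm.aemeasurable (hps _ hlc).aestronglyMeasurable, integral_prod _ hik,
        integral_withDensity_id]
      simp only [hK, integral_withDensity_ofReal hkm kbump_nonneg, hφ]
    have e2 : cv (ENNReal.ofReal c • M.map θ) g p =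
        c * ∫ y : Eu N, mbump y * g (p - (ε • y, 0)) := by
      rw [cv, integral_smul_measure, hcr, smul_eq_mul,
        integral_map hθm.aemeasurable (hps _ hg.continuous).aestronglyMeasurable,
        integral_withDensity_ofReal hmm mbump_nonneg]
    rw [e1, e2, ← kernel_identity hg p hε.le]
    simp only [mul_sub]
    rw [integral_sub hgi (hmint.mul_const _), integral_mul_const, ← hM₀, mul_sub, hc]
    field_simp

end

/-- Time-kernel operator. -/
def timeOp {N : ℕ} (κ : ℝ → ℝ → ℝ) (f : Eu N × ℝ → ℝ) (p : Eu N × ℝ) : ℝ :=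
  ∫ s, κ p.2 s * f (p.1, s)

/-- Bounded measurable time kernels supported in `(0,T)²`. -/
structure TK (T : ℝ) (κ : ℝ → ℝ → ℝ) : Prop where
  meas : Measurable (Function.uncurry κ)
  bdd : ∀ t s, |κ t s| ≤ 1
  supp : ∀ t s, κ t s ≠ 0 → t ∈ Ioo 0 T ∧ s ∈ Ioo 0 T

theorem TK.swap {T : ℝ} {κ : ℝ → ℝ → ℝ} (h : TK T κ) : TK T (fun t s => κ s t) :=
  ⟨h.meas.comp measurable_swap, fun t s => h.bdd s t, fun t s hs => (h.supp s t hs).symm⟩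

/-- Kernel of backward integration. -/
def kbwd (T t s : ℝ) : ℝ := if 0 < t ∧ t < s ∧ s < T then 1 else 0

/-- Kernel of integration over `(0,T)`. -/
def kall (T t s : ℝ) : ℝ := (Ioo 0 T).indicator (fun _ => 1) t * (Ioo 0 T).indicator (fun _ => 1) s

theorem TK_kbwd (T : ℝ) : TK T (kbwd T) := by
  refine ⟨?_, fun t s => ?_, fun t s h => ?_⟩
  · refine Measurable.ite ?_ measurable_const measurable_const
    exact (measurableSet_lt measurable_const measurable_fst).inter
      ((measurableSet_lt measurable_fst measurable_snd).inter
        (measurableSet_lt measurable_snd measurable_const))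
  · unfold kbwd; split_ifs <;> simp
  · unfold kbwd at h
    have h' : 0 < t ∧ t < s ∧ s < T := by
      by_contra h'
      exact h (if_neg h')
    exact ⟨⟨h'.1, h'.2.1.trans h'.2.2⟩, ⟨h'.1.trans h'.2.1, h'.2.2⟩⟩

theorem TK_kall (T : ℝ) : TK T (kall T) := by
  refine ⟨?_, fun t s => ?_, fun t s h => ?_⟩
  · exact ((measurable_const.indicator measurableSet_Ioo).comp measurable_fst).mul
      ((measurable_const.indicator measurableSet_Ioo).comp measurable_snd)
  · unfold kall indicator; split_ifs <;> simp
  · unfold kall at h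
    constructor
    · by_contra h'; exact h (by rw [indicator_of_notMem h']; simp)
    · by_contra h'; exact h (by rw [indicator_of_notMem h' (s := Ioo 0 T)]; simp)

/-- The difference operator `μ * f - lam f`. -/
def Aop {N : ℕ} (μ : Measure (Eu N × ℝ)) (lam : ℝ) (f : Eu N × ℝ → ℝ) (p : Eu N × ℝ) : ℝ :=
  cv μ f p - lam * f p

section

variable {N : ℕ} {f g : Eu N × ℝ → ℝ} {m : Measure (Eu N × ℝ)} {T : ℝ} {κ : ℝ → ℝ → ℝ}

theorem timeOp_measurable (hκ : TK T κ) (hf : Measurable f) : Measurable (timeOp κ f) := by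
  have : StronglyMeasurable (fun p : Eu N × ℝ => ∫ s, κ p.2 s * f (p.1, s)) := by
    apply StronglyMeasurable.integral_prod_right
    refine Measurable.stronglyMeasurable ?_
    exact (hκ.meas.comp ((measurable_snd.comp measurable_fst).prodMk measurable_snd)).mul
      (hf.comp ((measurable_fst.comp measurable_fst).prodMk measurable_snd))
  exact this.measurable

theorem kernel_mul_abs_le (hκ : TK T κ) {C : ℝ} (hC : ∀ p, |f p| ≤ C) (t s : ℝ) (x : Eu N) :
    |κ t s * f (x, s)| ≤ (Ioo 0 T).indicator (fun _ => C) s := by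
  have hC0 : 0 ≤ C := (abs_nonneg _).trans (hC (x, s))
  by_cases h : κ t s = 0
  · rw [h]; simp only [zero_mul, abs_zero]
    exact indicator_nonneg (fun _ _ => hC0) _
  · rw [indicator_of_mem (hκ.supp t s h).2, abs_mul]
    calc _ ≤ 1 * C := mul_le_mul (hκ.bdd _ _) (hC _) (abs_nonneg _) zero_le_one
      _ = C := one_mul _

theorem integrable_ind (T C : ℝ) : Integrable ((Ioo 0 T).indicator (fun _ => C)) :=
  (integrableOn_const (by simp)).integrable_indicator measurableSet_Ioo

theorem kernel_slice (hκ : TK T κ) (hf : Measurable f) {C : ℝ} (hC : ∀ p, |f p| ≤ C) (t : ℝ)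
    (x : Eu N) : Integrable (fun s => κ t s * f (x, s)) := by
  refine (integrable_ind T C).mono' ?_ (Eventually.of_forall fun s => kernel_mul_abs_le hκ hC t s x)
  exact ((hκ.meas.comp (measurable_const.prodMk measurable_id)).mul
    (hf.comp (measurable_const.prodMk measurable_id))).aestronglyMeasurable

theorem BM.timeOp (hf : BM f) (hκ : TK T κ) : BM (timeOp κ f) := by
  obtain ⟨C, hC⟩ := hf.bdd
  obtain ⟨R, hR⟩ := hf.supp
  refine ⟨timeOp_measurable hκ hf.meas, ⟨∫ s, (Ioo 0 T).indicator (fun _ => C) s, fun p => ?_⟩,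
    ⟨max R |T|, fun p hp => ?_⟩⟩
  · exact norm_integral_le_of_norm_le (f := fun s => κ p.2 s * f (p.1, s)) (integrable_ind T C)
      (Eventually.of_forall fun s => kernel_mul_abs_le hκ hC p.2 s p.1)
  · unfold _root_.timeOp
    rw [integral_eq_zero_of_ae]
    refine Eventually.of_forall fun s => ?_
    by_contra h
    have h1 := left_ne_zero_of_mul h
    have h2 := right_ne_zero_of_mul h
    have h3 := (hκ.supp _ _ h1).1
    have h4 : ‖(p.1, s)‖ ≤ R := by
      by_contra h'; exact h2 (hR _ (not_le.1 h'))
    have h5 : ‖p.1‖ ≤ R := (norm_fst_le (p.1, s)).trans h4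
    have h6 : ‖p.2‖ ≤ |T| := by
      rw [Real.norm_eq_abs, abs_of_pos h3.1]; exact h3.2.le.trans (le_abs_self _)
    have : ‖p‖ ≤ max R |T| := by
      rw [Prod.norm_def]; exact max_le_max h5 h6
    linarith

theorem timeOp_adjoint (hf : BM f) (hg : BM g) (hκ : TK T κ) :
    ∫ p, timeOp κ f p * g p = ∫ p, f p * timeOp (fun t s => κ s t) g p := by
  obtain ⟨C, hC⟩ := hf.bdd
  obtain ⟨C', hC'⟩ := hg.bdd
  have h1 := ((hf.timeOp hκ).mul hg).integrable
  have h2 := (hf.mul (hg.timeOp hκ.swap)).integrable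
  rw [Measure.volume_eq_prod] at h1 h2 ⊢
  rw [integral_prod _ h1, integral_prod _ h2]
  congr 1; ext x
  simp only [timeOp, ← integral_const_mul, ← integral_mul_const]
  have hi : Integrable (Function.uncurry fun t s : ℝ => κ t s * f (x, s) * g (x, t))
      (volume.prod volume) := by
    refine (((integrable_ind T C').mul_prod (integrable_ind T C))).mono' ?_ ?_
    · exact ((hκ.meas.mul (hf.meas.comp (measurable_const.prodMk measurable_snd))).mul
        (hg.meas.comp (measurable_const.prodMk measurable_fst))).aestronglyMeasurable
    · refine Eventually.of_forall fun z => ?_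
      have e1 := kernel_mul_abs_le hκ hC z.1 z.2 x
      by_cases h : κ z.1 z.2 = 0
      · simp only [Function.uncurry, h, zero_mul, norm_zero]
        refine mul_nonneg (indicator_nonneg (fun _ _ => ?_) _) (indicator_nonneg (fun _ _ => ?_) _)
        · exact (abs_nonneg _).trans (hC' (x, 0))
        · exact (abs_nonneg _).trans (hC (x, 0))
      · simp only [Function.uncurry, norm_mul, Real.norm_eq_abs]
        rw [indicator_of_mem (hκ.supp _ _ h).1, mul_comm, ← abs_mul]
        exact mul_le_mul (hC' _) e1 (abs_nonneg _) ((abs_nonneg _).trans (hC' (x, 0)))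
  rw [integral_integral_swap hi]
  congr 1; ext s; congr 1; ext t; ring

theorem cv_timeOp [IsFiniteMeasure m] (hm : ∀ᵐ q ∂m, q.2 = 0) (hf : BM f) (hκ : TK T κ)
    (p : Eu N × ℝ) : cv m (timeOp κ f) p = timeOp κ (cv m f) p := by
  obtain ⟨C, hC⟩ := hf.bdd
  have hi : Integrable (Function.uncurry fun (q : Eu N × ℝ) (s : ℝ) =>
      κ p.2 s * f (p.1 - q.1, s)) (m.prod volume) := by
    refine ((integrable_ind T C).comp_snd m).mono' ?_ ?_
    · exact ((hκ.meas.comp (measurable_const.prodMk measurable_snd)).mul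
        (hf.meas.comp ((measurable_const.sub (measurable_fst.comp measurable_fst)).prodMk
          measurable_snd))).aestronglyMeasurable
    · exact Eventually.of_forall fun z => kernel_mul_abs_le hκ hC _ _ _
  calc cv m (timeOp κ f) p = ∫ q, (∫ s, κ p.2 s * f (p.1 - q.1, s)) ∂m := by
        refine integral_congr_ae ?_
        filter_upwards [hm] with q hq
        simp [timeOp, hq]
    _ = ∫ s, ∫ q, κ p.2 s * f (p.1 - q.1, s) ∂m := integral_integral_swap hi
    _ = timeOp κ (cv m f) p := by
        unfold timeOp cv
        congr 1; ext s
        rw [integral_const_mul]; congr 1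
        refine integral_congr_ae ?_
        filter_upwards [hm] with q hq
        have : (p.1, s) - q = (p.1 - q.1, s) := by ext <;> simp [hq]
        rw [this]

theorem BM.Aop (hf : BM f) (hm : FB m) (lam : ℝ) : BM (Aop m lam f) :=
  (hf.cv hm).sub (hf.const_mul lam)

theorem timeOp_sub (hf : BM f) (hg : BM g) (hκ : TK T κ) (p : Eu N × ℝ) :
    timeOp κ (fun p => f p - g p) p = timeOp κ f p - timeOp κ g p := by
  obtain ⟨C, hC⟩ := hf.bdd
  obtain ⟨C', hC'⟩ := hg.bdd
  unfold timeOp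
  rw [← integral_sub (kernel_slice hκ hf.meas hC _ _) (kernel_slice hκ hg.meas hC' _ _)]
  simp only [mul_sub]

theorem timeOp_const_mul (c : ℝ) (p : Eu N × ℝ) :
    timeOp κ (fun p => c * f p) p = c * timeOp κ f p := by
  unfold timeOp
  rw [← integral_const_mul]
  congr 1; ext s; ring

theorem Aop_timeOp (hm : FB m) (hm0 : ∀ᵐ q ∂m, q.2 = 0) (lam : ℝ) (hf : BM f) (hκ : TK T κ)
    (p : Eu N × ℝ) : Aop m lam (timeOp κ f) p = timeOp κ (Aop m lam f) p := by
  have := hm.fin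
  have h := timeOp_sub (hf.cv hm) (hf.const_mul lam) hκ p
  unfold Aop
  rw [h, timeOp_const_mul, cv_timeOp hm0 hf hκ]

theorem Aop_symm (hm : FB m) (hs : m.map Neg.neg = m) (lam : ℝ) (hf : BM f) (hg : BM g) :
    ∫ p, Aop m lam f p * g p = ∫ p, f p * Aop m lam g p := by
  have := hm.fin
  obtain ⟨C, hC⟩ := hg.bdd
  have h := cv_symm (m := m) hf.integrable hg.meas hC
  rw [hs] at h
  unfold Aop
  simp only [sub_mul, mul_sub]
  rw [integral_sub ((hf.cv hm).mul hg).integrable ((hf.const_mul lam).mul hg).integrable,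
    integral_sub (hf.mul (hg.cv hm)).integrable (hf.mul (hg.const_mul lam)).integrable, h]
  congr 2; ext p; ring

theorem Aop_nonpos (hm : FB m) (hf : BM f) :
    ∫ p, f p * Aop m (m.real univ) f p ≤ 0 := by
  have := hm.fin
  have h := integral_mul_cv_self_le (m := m) hf
  unfold Aop
  simp only [mul_sub]
  rw [integral_sub (hf.mul (hf.cv hm)).integrable (hf.mul (hf.const_mul _)).integrable]
  have : ∫ p, f p * (m.real univ * f p) = m.real univ * ∫ p, f p ^ 2 := by
    rw [← integral_const_mul]; congr 1; ext p; ring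
  linarith

theorem timeOp_kall (p : Eu N × ℝ) : timeOp (kall T) f p =
    (Ioo 0 T).indicator (fun _ => 1) p.2 * ∫ s in Ioo 0 T, f (p.1, s) := by
  unfold timeOp kall
  rw [← integral_indicator measurableSet_Ioo, ← integral_const_mul]
  congr 1; ext s
  by_cases h : s ∈ Ioo 0 T <;> simp [h]

theorem timeOp_kall_kall (hT : 0 < T) (p : Eu N × ℝ) :
    timeOp (kall T) (timeOp (kall T) f) p = T * timeOp (kall T) f p := by
  rw [timeOp_kall]
  have : ∫ s in Ioo 0 T, timeOp (kall T) f (p.1, s) = T * ∫ s in Ioo 0 T, f (p.1, s) := by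
    calc _ = ∫ s in Ioo 0 T, ∫ s in Ioo 0 T, f (p.1, s) := by
          refine setIntegral_congr_fun measurableSet_Ioo fun s hs => ?_
          rw [timeOp_kall, indicator_of_mem hs, one_mul]
      _ = _ := by rw [setIntegral_const]; simp [Measure.real, hT.le]
  rw [this, timeOp_kall]; ring

theorem timeOp_kbwd_add (hf : BM f) (p : Eu N × ℝ) :
    timeOp (kbwd T) f p + timeOp (fun t s => kbwd T s t) f p = timeOp (kall T) f p := by
  obtain ⟨C, hC⟩ := hf.bdd
  unfold timeOp
  rw [← integral_add (kernel_slice (TK_kbwd T) hf.meas hC _ _)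
    (kernel_slice (TK_kbwd T).swap hf.meas hC _ _)]
  refine integral_congr_ae ?_
  have : ∀ᵐ s : ℝ, s ≠ p.2 := by simp [ae_iff]
  filter_upwards [this] with s hs
  rw [← add_mul]; congr 1
  unfold kbwd kall
  rcases lt_or_gt_of_ne hs with h | h
  · have h1 : ¬ (0 < p.2 ∧ p.2 < s ∧ s < T) := fun h' => absurd h'.2.1 (not_lt.2 h.le)
    rw [if_neg h1]
    by_cases h2 : 0 < s ∧ s < p.2 ∧ p.2 < T
    · rw [if_pos h2, indicator_of_mem, indicator_of_mem]
      · norm_num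
      · exact ⟨h2.1, h.trans h2.2.2⟩
      · exact ⟨h2.1.trans h, h2.2.2⟩
    · rw [if_neg h2]
      by_cases h3 : p.2 ∈ Ioo 0 T
      · rw [indicator_of_notMem (a := s)]
        · simp
        · exact fun h4 => h2 ⟨h4.1, h, h3.2⟩
      · rw [indicator_of_notMem h3]; simp
  · have h1 : ¬ (0 < s ∧ s < p.2 ∧ p.2 < T) := fun h' => absurd h'.2.1 (not_lt.2 h.le)
    rw [if_neg h1]
    by_cases h2 : 0 < p.2 ∧ p.2 < s ∧ s < T
    · rw [if_pos h2, indicator_of_mem, indicator_of_mem]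
      · norm_num
      · exact ⟨h2.1.trans h, h2.2.2⟩
      · exact ⟨h2.1, h.trans h2.2.2⟩
    · rw [if_neg h2]
      by_cases h3 : p.2 ∈ Ioo 0 T
      · rw [indicator_of_notMem (a := s)]
        · simp
        · exact fun h4 => h2 ⟨h3.1, h, h4.2⟩
      · rw [indicator_of_notMem h3]; simp

/-- The energy inequality for backward integration. -/
theorem energy_nonpos (hT : 0 < T) (hm : FB m) (hm0 : ∀ᵐ q ∂m, q.2 = 0) (hs : m.map Neg.neg = m)
    (hf : BM f) : ∫ p, f p * Aop m (m.real univ) (timeOp (kbwd T) f) p ≤ 0 := by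
  set lam := m.real univ with hlam
  set X := ∫ p, f p * Aop m lam (timeOp (kbwd T) f) p with hX
  have hb := TK_kbwd T
  have ha := TK_kall T
  have hX2 : X = ∫ p, f p * Aop m lam (timeOp (fun t s => kbwd T s t) f) p := by
    calc X = ∫ p, Aop m lam f p * timeOp (kbwd T) f p :=
          (Aop_symm hm hs lam hf (hf.timeOp hb)).symm
      _ = ∫ p, timeOp (fun t s => kbwd T s t) (Aop m lam f) p * f p := by
          have := timeOp_adjoint hf (hf.Aop hm lam) hb
          simp only [mul_comm] at this ⊢
          exact this
      _ = _ := by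
          congr 1; ext p; rw [Aop_timeOp hm hm0 lam hf hb.swap, mul_comm]
  have hsum : 2 * X = ∫ p, f p * Aop m lam (timeOp (kall T) f) p := by
    have e : ∀ p, f p * Aop m lam (timeOp (kall T) f) p =
        f p * Aop m lam (timeOp (kbwd T) f) p +
          f p * Aop m lam (timeOp (fun t s => kbwd T s t) f) p := by
      intro p
      have := hm.fin
      have e2 : timeOp (kall T) f =
          fun p => timeOp (kbwd T) f p + timeOp (fun t s => kbwd T s t) f p :=
        funext fun p => (timeOp_kbwd_add hf p).symm
      unfold Aop
      rw [e2, cv_add (hf.timeOp hb) (hf.timeOp hb.swap)]; ring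
    simp only [e]
    rw [integral_add (hf.mul ((hf.timeOp hb).Aop hm lam)).integrable
      (hf.mul ((hf.timeOp hb.swap).Aop hm lam)).integrable, ← hX2, ← hX]
    ring
  have hP : T * ∫ p, f p * Aop m lam (timeOp (kall T) f) p =
      ∫ p, timeOp (kall T) f p * Aop m lam (timeOp (kall T) f) p := by
    have hsw : (fun t s => kall T s t) = kall T := by
      ext t s; unfold kall; ring
    have h1 := timeOp_adjoint hf ((hf.timeOp ha).Aop hm lam) ha
    rw [hsw] at h1
    rw [h1, ← integral_const_mul]
    congr 1; ext p
    rw [← Aop_timeOp hm hm0 lam (hf.timeOp ha) ha]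
    have : timeOp (kall T) (timeOp (kall T) f) = fun p => T * timeOp (kall T) f p :=
      funext fun p => timeOp_kall_kall hT p
    rw [this]; unfold Aop; rw [cv_const_mul]; ring
  have hneg := Aop_nonpos hm (hf.timeOp ha)
  rw [← hlam, ← hP] at hneg
  have := nonpos_of_mul_nonpos_right hneg hT
  linarith

end

/-- Kernel of damped backward integration. -/
def kexp (Λ T t s : ℝ) : ℝ := kbwd T t s * Real.exp (-(Λ * (s - t)))

section

variable {N : ℕ} {f g h : Eu N × ℝ → ℝ} {m : Measure (Eu N × ℝ)} {T Λ : ℝ} {κ : ℝ → ℝ → ℝ}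

theorem kbwd_nonneg (T t s : ℝ) : 0 ≤ kbwd T t s := by
  unfold kbwd; split_ifs <;> norm_num

theorem kexp_nonneg (Λ T t s : ℝ) : 0 ≤ kexp Λ T t s :=
  mul_nonneg (kbwd_nonneg _ _ _) (Real.exp_pos _).le

theorem TK_kexp (hΛ : 0 ≤ Λ) (T : ℝ) : TK T (kexp Λ T) := by
  have hb := TK_kbwd T
  refine ⟨?_, fun t s => ?_, fun t s hs => hb.supp t s (left_ne_zero_of_mul hs)⟩
  · refine hb.meas.mul ?_
    exact Real.measurable_exp.comp
      ((measurable_const.mul (measurable_snd.sub measurable_fst)).neg)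
  · unfold kexp
    by_cases hts : 0 < t ∧ t < s ∧ s < T
    · rw [kbwd, if_pos hts, one_mul, abs_of_pos (Real.exp_pos _), Real.exp_le_one_iff]
      have := mul_nonneg hΛ (sub_nonneg.2 hts.2.1.le)
      linarith
    · rw [kbwd, if_neg hts]; simp

theorem kbwd_kexp_comp (t r : ℝ) :
    ∫ s, kbwd T t s * kexp Λ T s r * Λ = kbwd T t r - kexp Λ T t r := by
  by_cases htr : 0 < t ∧ t < r ∧ r < T
  · have e : ∀ s, kbwd T t s * kexp Λ T s r * Λ =
        (Ioo t r).indicator (fun s => Λ * Real.exp (-(Λ * (r - s)))) s := by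
      intro s
      unfold kexp kbwd
      by_cases hs : s ∈ Ioo t r
      · rw [indicator_of_mem hs, if_pos ⟨htr.1, hs.1, hs.2.trans htr.2.2⟩,
          if_pos ⟨htr.1.trans hs.1, hs.2, htr.2.2⟩]; ring
      · rw [indicator_of_notMem hs]
        by_cases h1 : 0 < t ∧ t < s ∧ s < T
        · rw [if_neg (c := 0 < s ∧ s < r ∧ r < T)]
          · simp
          · exact fun h2 => hs ⟨h1.2.1, h2.2.1⟩
        · rw [if_neg h1]; simp
    simp only [e]
    rw [integral_indicator measurableSet_Ioo, ← integral_Ioc_eq_integral_Ioo,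
      ← intervalIntegral.integral_of_le htr.2.1.le]
    rw [intervalIntegral.integral_eq_sub_of_hasDerivAt
      (f := fun s => Real.exp (-(Λ * (r - s))))]
    · simp [kexp, kbwd, htr]
    · intro s _
      have h1 : HasDerivAt (fun s => -(Λ * (r - s))) Λ s := by
        have := (((hasDerivAt_id s).const_sub r).const_mul Λ).neg
        exact this.congr_deriv (by ring)
      have := h1.exp
      rwa [mul_comm] at this
    · exact Continuous.intervalIntegrable (by fun_prop) _ _
  · have e : ∀ s, kbwd T t s * kexp Λ T s r * Λ = 0 := by
      intro s
      unfold kexp kbwd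
      by_cases h1 : 0 < t ∧ t < s ∧ s < T
      · rw [if_neg (c := 0 < s ∧ s < r ∧ r < T)]
        · simp
        · exact fun h2 => htr ⟨h1.1, h1.2.1.trans h2.2.1, h2.2.2⟩
      · rw [if_neg h1]; simp
    simp only [e, integral_zero]
    simp [kexp, kbwd, htr]

theorem integral_kexp_barrier {t : ℝ} (ht : t ∈ Ioo 0 T) :
    ∫ s, kexp Λ T t s * (Λ * (T - s) + 1) = T - t := by
  have e : ∀ s, kexp Λ T t s * (Λ * (T - s) + 1) =
      (Ioo t T).indicator (fun s => Real.exp (-(Λ * (s - t))) * (Λ * (T - s) + 1)) s := by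
    intro s
    unfold kexp kbwd
    by_cases hs : s ∈ Ioo t T
    · rw [indicator_of_mem hs, if_pos ⟨ht.1, hs.1, hs.2⟩]; ring
    · rw [indicator_of_notMem hs, if_neg fun h => hs ⟨h.2.1, h.2.2⟩]; simp
  simp only [e]
  rw [integral_indicator measurableSet_Ioo, ← integral_Ioc_eq_integral_Ioo,
    ← intervalIntegral.integral_of_le ht.2.le]
  rw [intervalIntegral.integral_eq_sub_of_hasDerivAt
    (f := fun s => -(Real.exp (-(Λ * (s - t))) * (T - s)))]
  · simp
  · intro s _
    have h1 : HasDerivAt (fun s => -(Λ * (s - t))) (-Λ) s := by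
      have := (((hasDerivAt_id s).sub_const t).const_mul Λ).neg
      exact this.congr_deriv (by ring)
    have h2 := (h1.exp.mul ((hasDerivAt_id s).const_sub T)).neg
    exact h2.congr_deriv (by simp only [id]; ring)
  · exact Continuous.intervalIntegrable (by fun_prop) _ _

theorem timeOp_kbwd_kexp (hΛ : 0 ≤ Λ) (hh : BM h) (p : Eu N × ℝ) :
    Λ * timeOp (kbwd T) (timeOp (kexp Λ T) h) p =
      timeOp (kbwd T) h p - timeOp (kexp Λ T) h p := by
  obtain ⟨C, hC⟩ := hh.bdd
  have hb := TK_kbwd T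
  have he := TK_kexp hΛ T
  obtain ⟨x, t⟩ := p
  have hi : Integrable (Function.uncurry fun s r : ℝ =>
      kbwd T t s * (kexp Λ T s r * h (x, r))) (volume.prod volume) := by
    refine ((integrable_ind T 1).mul_prod (integrable_ind T C)).mono' ?_ ?_
    · exact ((hb.meas.comp (measurable_const.prodMk measurable_fst)).mul
        (he.meas.mul (hh.meas.comp (measurable_const.prodMk measurable_snd)))).aestronglyMeasurable
    · refine Eventually.of_forall fun z => ?_
      have e1 := kernel_mul_abs_le he hC z.1 z.2 x
      have e2 := kernel_mul_abs_le (N := N) (f := fun _ => 1) hb (C := 1) (by simp) t z.1 x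
      simp only [mul_one] at e2
      simp only [Function.uncurry]
      rw [norm_mul]
      exact mul_le_mul e2 e1 (norm_nonneg _) ((abs_nonneg _).trans e2)
  calc Λ * timeOp (kbwd T) (timeOp (kexp Λ T) h) (x, t)
      = Λ * ∫ s, ∫ r, kbwd T t s * (kexp Λ T s r * h (x, r)) := by
        unfold timeOp; simp only [integral_const_mul]
    _ = Λ * ∫ r, ∫ s, kbwd T t s * (kexp Λ T s r * h (x, r)) := by
        rw [integral_integral_swap hi]
    _ = ∫ r, (∫ s, kbwd T t s * kexp Λ T s r * Λ) * h (x, r) := by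
        rw [← integral_const_mul]
        congr 1; ext r
        rw [← integral_const_mul, ← integral_mul_const]
        congr 1; ext s; ring
    _ = _ := by
        simp only [kbwd_kexp_comp, sub_mul]
        rw [integral_sub (kernel_slice hb hh.meas hC t x) (kernel_slice he hh.meas hC t x)]
        rfl

end

section

variable {N : ℕ} {f g h : Eu N × ℝ → ℝ} {m μ : Measure (Eu N × ℝ)} {T Λ : ℝ} {κ : ℝ → ℝ → ℝ}

theorem timeOp_mono (hκ : TK T κ) (h0 : ∀ t s, 0 ≤ κ t s) (hf : BM f) (hg : BM g)
    (hfg : ∀ p, f p ≤ g p) (p : Eu N × ℝ) : timeOp κ f p ≤ timeOp κ g p := by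
  obtain ⟨C, hC⟩ := hf.bdd
  obtain ⟨C', hC'⟩ := hg.bdd
  exact integral_mono (kernel_slice hκ hf.meas hC _ _) (kernel_slice hκ hg.meas hC' _ _)
    fun s => mul_le_mul_of_nonneg_left (hfg _) (h0 _ _)

theorem cv_mono [IsFiniteMeasure m] (hf : BM f) (hg : BM g) (hfg : ∀ p, f p ≤ g p)
    (p : Eu N × ℝ) : cv m f p ≤ cv m g p :=
  integral_mono (hf.slice p) (hg.slice p) fun _ => hfg _

theorem timeOp_tendsto (hκ : TK T κ) {φ : ℕ → Eu N × ℝ → ℝ} (hφ : ∀ n, Measurable (φ n)) {C : ℝ}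
    (hC : ∀ n p, |φ n p| ≤ C) (hlim : ∀ p, Tendsto (fun n => φ n p) atTop (𝓝 (f p)))
    (p : Eu N × ℝ) : Tendsto (fun n => timeOp κ (φ n) p) atTop (𝓝 (timeOp κ f p)) := by
  refine tendsto_integral_of_dominated_convergence _ (fun n => ?_) (integrable_ind T C)
    (fun n => Eventually.of_forall fun s => kernel_mul_abs_le hκ (hC n) p.2 s p.1)
    (Eventually.of_forall fun s => (hlim _).const_mul _)
  exact (kernel_slice hκ (hφ n) (hC n) p.2 p.1).aestronglyMeasurable

theorem cv_tendsto [IsFiniteMeasure m] {φ : ℕ → Eu N × ℝ → ℝ} (hφ : ∀ n, Measurable (φ n)) {C : ℝ}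
    (hC : ∀ n p, |φ n p| ≤ C) (hlim : ∀ p, Tendsto (fun n => φ n p) atTop (𝓝 (f p)))
    (p : Eu N × ℝ) : Tendsto (fun n => cv m (φ n) p) atTop (𝓝 (cv m f p)) := by
  refine tendsto_integral_of_dominated_convergence (fun _ => C) (fun n => ?_) (integrable_const _)
    (fun n => Eventually.of_forall fun s => hC n _)
    (Eventually.of_forall fun s => hlim _)
  exact (slice_integrable (hφ n) (hC n) p).aestronglyMeasurable

/-- The (shifted) right-hand side of the dual equation. -/
def dualRhs (μ : Measure (Eu N × ℝ)) (lam Λ : ℝ) (b f ω : Eu N × ℝ → ℝ) (z : Eu N × ℝ) : ℝ :=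
  b z * cv μ ω z + (Λ - lam * b z) * ω z + f z

/-- The Picard iterates of the dual equation. -/
def dualSeq (μ : Measure (Eu N × ℝ)) (lam Λ T : ℝ) (b f : Eu N × ℝ → ℝ) : ℕ → Eu N × ℝ → ℝ
  | 0 => fun _ => 0
  | n + 1 => timeOp (kexp Λ T) (dualRhs μ lam Λ b f (dualSeq μ lam Λ T b f n))

/-- Solvability of the nonlocal dual problem with a supersolution bound. -/
theorem dual_exists {ε lam R B : ℝ} {Φ : Eu N → ℝ} {b : Eu N × ℝ → ℝ} (hFB : FB μ)
    (hμs : ∀ᵐ q ∂μ, ‖q.1‖ ≤ ε ∧ q.2 = 0) (hlam : 0 ≤ lam) (hbm : Measurable b)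
    (hb0 : ∀ z, 0 ≤ b z) (hbB : ∀ z, b z ≤ B) (hbR : ∀ z, R ≤ ‖z.1‖ → b z = 0)
    (hf : BM f) (hf0 : ∀ z, 0 ≤ f z) (hfR : ∀ z, R ≤ ‖z.1‖ → f z = 0)
    (hΦm : Measurable Φ) {CΦ : ℝ} (hΦb : ∀ y, |Φ y| ≤ CΦ)
    (hΦ0 : ∀ y, ‖y‖ ≤ R + ε → 0 ≤ Φ y)
    (hΦs : ∀ z : Eu N × ℝ, cv μ (fun q => Φ q.1) z ≤ lam * Φ z.1)
    (hfΦ : ∀ z, ‖z.1‖ < R → f z ≤ Φ z.1) (hε : 0 ≤ ε) (hT : 0 < T) :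
    ∃ p ψ : Eu N × ℝ → ℝ, BM p ∧ BM ψ ∧ (∀ z, ψ z = timeOp (kbwd T) p z) ∧
      (∀ z, p z = b z * Aop μ lam ψ z + f z) ∧ (∀ z, 0 ≤ ψ z) ∧
      (∀ z, R ≤ ‖z.1‖ → ψ z = 0) ∧ (∀ z, z.2 ∉ Ioo 0 T → ψ z = 0) ∧
      (∀ z, ‖z.1‖ < R → ψ z ≤ T * Φ z.1) := by
  have := hFB.fin
  have hB : 0 ≤ B := (hb0 0).trans (hbB 0)
  set Λ := lam * B with hΛdef
  have hΛ : 0 ≤ Λ := mul_nonneg hlam hB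
  have hΛb : ∀ z, 0 ≤ Λ - lam * b z := fun z =>
    sub_nonneg.2 (mul_le_mul_of_nonneg_left (hbB z) hlam)
  have hκ := TK_kexp hΛ T
  have hCΦ : 0 ≤ CΦ := (abs_nonneg _).trans (hΦb 0)
  have habs : ∀ z, |b z| ≤ B := fun z => by rw [abs_of_nonneg (hb0 z)]; exact hbB z
  have habs2 : ∀ z, |Λ - lam * b z| ≤ Λ := fun z => by
    rw [abs_of_nonneg (hΛb z)]; linarith [mul_nonneg hlam (hb0 z)]
  set F := dualRhs μ lam Λ b f with hF
  set S := dualSeq μ lam Λ T b f with hS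
  have hS1 : ∀ n, S (n + 1) = timeOp (kexp Λ T) (F (S n)) := fun n => rfl
  have FBM : ∀ ω, BM ω → BM (F ω) := fun ω hω =>
    (((hω.cv hFB).bmul hbm habs).add
      (hω.bmul (measurable_const.sub (measurable_const.mul hbm)) habs2)).add hf
  have SBM : ∀ n, BM (S n) := by
    intro n
    induction n with
    | zero => exact ⟨measurable_const, ⟨0, fun _ => by simp [hS, dualSeq]⟩, ⟨0, fun _ _ => rfl⟩⟩
    | succ n ih => rw [hS1]; exact (FBM _ ih).timeOp hκ
  have FS_mono : ∀ ω ω', BM ω → BM ω' → (∀ z, ω z ≤ ω' z) → ∀ z, F ω z ≤ F ω' z := by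
    intro ω ω' h1 h2 h z
    have e1 := mul_le_mul_of_nonneg_left (cv_mono (m := μ) h1 h2 h z) (hb0 z)
    have e2 := mul_le_mul_of_nonneg_left (h z) (hΛb z)
    simp only [hF, dualRhs]; linarith
  have S_nonneg : ∀ n z, 0 ≤ S n z := by
    intro n
    induction n with
    | zero => intro z; exact le_rfl
    | succ n ih =>
      intro z
      rw [hS1]
      refine integral_nonneg fun s => mul_nonneg (kexp_nonneg _ _ _ _) ?_
      exact add_nonneg (add_nonneg (mul_nonneg (hb0 _) (cv_nonneg ih _))
        (mul_nonneg (hΛb _) (ih _))) (hf0 _)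
  have S_mono : ∀ n z, S n z ≤ S (n + 1) z := by
    intro n
    induction n with
    | zero => intro z; exact S_nonneg 1 z
    | succ n ih =>
      intro z
      rw [hS1 (n + 1), hS1 n]
      exact timeOp_mono hκ (kexp_nonneg _ _) (FBM _ (SBM n)) (FBM _ (SBM (n + 1)))
        (FS_mono _ _ (SBM n) (SBM (n + 1)) ih) z
  have S_supp : ∀ n z, R ≤ ‖z.1‖ → S n z = 0 := by
    intro n
    induction n with
    | zero => intro z _; rfl
    | succ n ih =>
      intro z hz
      rw [hS1, timeOp]
      have : ∀ s, F (S n) (z.1, s) = 0 := fun s => by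
        simp [hF, dualRhs, hbR (z.1, s) hz, hfR (z.1, s) hz, ih (z.1, s) hz]
      simp [this]
  have S_time : ∀ n z, z.2 ∉ Ioo 0 T → S n z = 0 := by
    intro n z hz
    cases n with
    | zero => rfl
    | succ n =>
      rw [hS1, timeOp]
      have : ∀ s, kexp Λ T z.2 s = 0 := fun s => by
        by_contra h
        exact hz (hκ.supp _ _ h).1
      simp [this]
  have S_bar : ∀ n z, ‖z.1‖ < R → z.2 ∈ Ioo 0 T → S n z ≤ (T - z.2) * Φ z.1 := by
    intro n
    induction n with
    | zero =>
      intro z hz ht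
      exact mul_nonneg (sub_nonneg.2 ht.2.le) (hΦ0 _ (by linarith))
    | succ n ih =>
      rintro ⟨x, t⟩ hx ht
      simp only at hx ht ⊢
      have key : ∀ s ∈ Ioo 0 T, F (S n) (x, s) ≤ (Λ * (T - s) + 1) * Φ x := by
        intro s hs
        have c1 : cv μ (S n) (x, s) ≤ (T - s) * cv μ (fun q => Φ q.1) (x, s) := by
          unfold cv
          rw [← integral_const_mul]
          refine integral_mono_ae ((SBM n).slice _) ?_ ?_
          · exact (slice_integrable (f := fun q : Eu N × ℝ => Φ q.1) (hΦm.comp measurable_fst)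
              (fun q => hΦb q.1) (x, s)).const_mul _
          · filter_upwards [hμs] with q hq
            have hq2 : ((x, s) - q).2 = s := by simp [hq.2]
            by_cases h1 : ‖((x, s) - q).1‖ < R
            · have := ih ((x, s) - q) h1 (by rw [hq2]; exact hs)
              rwa [hq2] at this
            · rw [S_supp n _ (not_lt.1 h1)]
              refine mul_nonneg (sub_nonneg.2 hs.2.le) (hΦ0 _ ?_)
              calc ‖x - q.1‖ ≤ ‖x‖ + ‖q.1‖ := norm_sub_le _ _
                _ ≤ R + ε := add_le_add hx.le hq.1
        have c2 := hΦs (x, s)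
        have c3 := ih (x, s) hx hs
        have c4 := hfΦ (x, s) hx
        simp only at c2 c3 c4
        have c5 : b (x, s) * cv μ (S n) (x, s) ≤ b (x, s) * ((T - s) * (lam * Φ x)) :=
          mul_le_mul_of_nonneg_left (c1.trans (mul_le_mul_of_nonneg_left c2
            (sub_nonneg.2 hs.2.le))) (hb0 _)
        have c6 := mul_le_mul_of_nonneg_left c3 (hΛb (x, s))
        simp only [hF, dualRhs]
        nlinarith
      calc S (n + 1) (x, t) = ∫ s, kexp Λ T t s * F (S n) (x, s) := by rw [hS1]; rfl
        _ ≤ ∫ s, kexp Λ T t s * (Λ * (T - s) + 1) * Φ x := by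
            obtain ⟨C, hC⟩ := (FBM _ (SBM n)).bdd
            refine integral_mono (kernel_slice hκ (FBM _ (SBM n)).meas hC t x) ?_ ?_
            · refine Integrable.mul_const ?_ _
              refine (integrable_ind T (Λ * T + 1)).mono' ?_ ?_
              · exact ((hκ.meas.comp (measurable_const.prodMk measurable_id)).mul
                  (by fun_prop)).aestronglyMeasurable
              · refine Eventually.of_forall fun s => ?_
                by_cases h : kexp Λ T t s = 0
                · rw [h]; simp only [zero_mul, norm_zero]
                  exact indicator_nonneg (fun _ _ => by positivity) _
                · have hs := (hκ.supp _ _ h).2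
                  rw [indicator_of_mem hs, norm_mul, Real.norm_eq_abs, Real.norm_eq_abs]
                  have d1 : 0 ≤ Λ * (T - s) := mul_nonneg hΛ (sub_nonneg.2 hs.2.le)
                  have d2 : Λ * (T - s) ≤ Λ * T :=
                    mul_le_mul_of_nonneg_left (by linarith [hs.1]) hΛ
                  rw [abs_of_nonneg (show 0 ≤ Λ * (T - s) + 1 by linarith)]
                  calc _ ≤ 1 * (Λ * (T - s) + 1) :=
                        mul_le_mul_of_nonneg_right (hκ.bdd _ _) (by linarith)
                    _ ≤ _ := by linarith
            · intro s
              by_cases h : kexp Λ T t s = 0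
              · simp [h]
              · simp only
                rw [mul_assoc]
                exact mul_le_mul_of_nonneg_left (key s (hκ.supp _ _ h).2) (kexp_nonneg _ _ _ _)
        _ = (T - t) * Φ x := by rw [integral_mul_const, integral_kexp_barrier ht]
  have S_le : ∀ n z, S n z ≤ T * CΦ := by
    intro n z
    by_cases h1 : ‖z.1‖ < R
    · by_cases h2 : z.2 ∈ Ioo 0 T
      · refine (S_bar n z h1 h2).trans (mul_le_mul (by linarith [h2.1])
          ((le_abs_self _).trans (hΦb _)) (hΦ0 _ (by linarith)) hT.le)
      · rw [S_time n z h2]; positivity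
    · rw [S_supp n z (not_lt.1 h1)]; positivity
  have S_abs : ∀ n z, |S n z| ≤ T * CΦ := fun n z => by
    rw [abs_of_nonneg (S_nonneg n z)]; exact S_le n z
  set ψ : Eu N × ℝ → ℝ := fun z => ⨆ n, S n z with hψ
  have lim : ∀ z, Tendsto (fun n => S n z) atTop (𝓝 (ψ z)) := fun z =>
    tendsto_atTop_ciSup (monotone_nat_of_le_succ fun n => S_mono n z)
      ⟨T * CΦ, by rintro _ ⟨n, rfl⟩; exact S_le n z⟩
  have ψ_nonneg : ∀ z, 0 ≤ ψ z := fun z => ge_of_tendsto' (lim z) fun n => S_nonneg n z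
  have ψ_supp : ∀ z, R ≤ ‖z.1‖ → ψ z = 0 := fun z hz => by
    simp [hψ, S_supp _ z hz]
  have ψ_time : ∀ z, z.2 ∉ Ioo 0 T → ψ z = 0 := fun z hz => by
    simp [hψ, S_time _ z hz]
  have ψ_BM : BM ψ := by
    refine ⟨measurable_of_tendsto_metrizable (fun n => (SBM n).meas) (tendsto_pi_nhds.2 lim),
      ⟨T * CΦ, fun z => ?_⟩, ⟨max R T, fun z hz => ?_⟩⟩
    · exact le_of_tendsto' (lim z).abs fun n => S_abs n z
    · by_cases h1 : R ≤ ‖z.1‖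
      · exact ψ_supp z h1
      · refine ψ_time z fun h2 => ?_
        rw [Prod.norm_def, lt_max_iff, max_lt_iff, max_lt_iff, Real.norm_eq_abs,
          abs_of_pos h2.1] at hz
        rcases hz with h | h
        · exact h1 h.1.le
        · exact absurd h.2 (not_lt.2 h2.2.le)
  have fix : ∀ z, ψ z = timeOp (kexp Λ T) (F ψ) z := by
    intro z
    obtain ⟨Cf, hCf⟩ := hf.bdd
    have l1 : Tendsto (fun n => S (n + 1) z) atTop (𝓝 (ψ z)) :=
      (lim z).comp (tendsto_add_atTop_nat 1)
    refine tendsto_nhds_unique l1 ?_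
    simp only [hS1]
    refine timeOp_tendsto hκ (fun n => (FBM _ (SBM n)).meas)
      (C := B * (T * CΦ * μ.real univ) + Λ * (T * CΦ) + Cf) (fun n y => ?_) (fun y => ?_) z
    · simp only [hF, dualRhs]
      refine (abs_add_le _ _).trans (add_le_add ((abs_add_le _ _).trans (add_le_add ?_ ?_)) (hCf y))
      · rw [abs_mul]
        exact mul_le_mul (habs y) (cv_abs_le (S_abs n) y) (abs_nonneg _) hB
      · rw [abs_mul]
        exact mul_le_mul (habs2 y) (S_abs n y) (abs_nonneg _) hΛ
    · exact ((((cv_tendsto (fun n => (SBM n).meas) S_abs lim y).const_mul _).add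
        ((lim y).const_mul _)).add_const _)
  have hpBM : BM (fun z => b z * Aop μ lam ψ z + f z) :=
    ((ψ_BM.Aop hFB lam).bmul hbm habs).add hf
  refine ⟨_, ψ, hpBM, ψ_BM, fun z => ?_, fun z => rfl, ψ_nonneg, ψ_supp, ψ_time, fun z hz => ?_⟩
  · have e1 : (fun z => b z * Aop μ lam ψ z + f z) = fun z => F ψ z - Λ * ψ z := by
      ext y; simp only [hF, dualRhs, Aop]; ring
    have hc : timeOp (kexp Λ T) (F ψ) = ψ := funext fun y => (fix y).symm
    have r := timeOp_kbwd_kexp (T := T) hΛ (FBM ψ ψ_BM) z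
    rw [e1, timeOp_sub (FBM ψ ψ_BM) (ψ_BM.const_mul Λ) (TK_kbwd T), timeOp_const_mul]
    rw [hc] at r
    linarith
  · refine le_of_tendsto' (lim z) fun n => ?_
    have hΦz : 0 ≤ Φ z.1 := hΦ0 _ (by linarith)
    by_cases h2 : z.2 ∈ Ioo 0 T
    · exact (S_bar n z hz h2).trans (mul_le_mul_of_nonneg_right (by linarith [h2.1]) hΦz)
    · rw [S_time n z h2]; positivity

end

/-- The superharmonic profile `(1 + |y|²)^(-α)`. -/
def barr {N : ℕ} (α : ℝ) (y : Eu N) : ℝ := (1 + ‖y‖ ^ 2) ^ (-α)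

section

variable {N : ℕ}

theorem barr_pos (α : ℝ) (y : Eu N) : 0 < barr α y := Real.rpow_pos_of_pos (by positivity) _

theorem barr_le_one {α : ℝ} (hα : 0 ≤ α) (y : Eu N) : barr α y ≤ 1 :=
  Real.rpow_le_one_of_one_le_of_nonpos (by nlinarith [sq_nonneg ‖y‖]) (by linarith)

theorem barr_measurable (α : ℝ) : Measurable (barr α : Eu N → ℝ) := by
  unfold barr; fun_prop

theorem barr_contDiff (α : ℝ) :
    ContDiff ℝ (⊤ : ℕ∞) (fun p : Eu N × ℝ => barr α p.1) := by
  unfold barr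
  refine ContDiff.rpow_const_of_ne ?_ fun p => by positivity
  exact contDiff_const.add (contDiff_fst.norm_sq ℝ)

theorem hasFDerivAt_sq (p : Eu N × ℝ) : HasFDerivAt (fun q : Eu N × ℝ => 1 + ‖q.1‖ ^ 2)
    ((2 • innerSL ℝ p.1).comp (ContinuousLinearMap.fst ℝ (Eu N) ℝ)) p := by
  have h1 := (hasStrictFDerivAt_norm_sq p.1).hasFDerivAt
  exact (h1.comp p hasFDerivAt_fst).const_add 1

theorem barr_fderiv (α : ℝ) (p : Eu N × ℝ) (i : Fin N) :
    fderiv ℝ (fun p : Eu N × ℝ => barr α p.1) p (EuclideanSpace.single i 1, 0) =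
      -(2 * α) * (barr (α + 1) p.1 * p.1 i) := by
  have h := (hasFDerivAt_sq p).rpow_const (p := -α) (Or.inl (by positivity))
  unfold barr
  rw [h.fderiv]
  simp [EuclideanSpace.inner_single_right]
  rw [show -α - 1 = -1 + -α by ring]; ring

theorem lapX_barr_term (α : ℝ) (p : Eu N × ℝ) (i : Fin N) :
    fderiv ℝ (fun q => fderiv ℝ (fun p : Eu N × ℝ => barr α p.1) q
      (EuclideanSpace.single i 1, 0)) p (EuclideanSpace.single i 1, 0) =
    -(2 * α) * (barr (α + 1) p.1 - 2 * (α + 1) * barr (α + 2) p.1 * (p.1 i) ^ 2) := by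
  simp only [barr_fderiv]
  have h1 : HasFDerivAt (fun p : Eu N × ℝ => barr (α + 1) p.1)
      (fderiv ℝ (fun p : Eu N × ℝ => barr (α + 1) p.1) p) p :=
    ((barr_contDiff (α + 1)).differentiable (by simp) p).hasFDerivAt
  have h2 : HasFDerivAt (fun p : Eu N × ℝ => p.1 i)
      ((EuclideanSpace.proj i).comp (ContinuousLinearMap.fst ℝ (Eu N) ℝ)) p :=
    ((EuclideanSpace.proj (𝕜 := ℝ) i).hasFDerivAt).comp p hasFDerivAt_fst
  have h3 : HasFDerivAt (fun q : Eu N × ℝ => -(2 * α) * (barr (α + 1) q.1 * q.1 i)) _ p :=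
    (h1.mul h2).const_mul _
  rw [h3.fderiv]
  have e := barr_fderiv (α + 1) p i
  have e4 : ((EuclideanSpace.proj i).comp (ContinuousLinearMap.fst ℝ (Eu N) ℝ))
      (EuclideanSpace.single i (1 : ℝ), (0 : ℝ)) = (1 : ℝ) := by simp
  simp only [smul_apply, add_apply, smul_eq_mul, e, e4]
  rw [show α + 1 + 1 = α + 2 by ring]; ring

theorem lapX_barr_nonpos (hN : 3 ≤ N) (p : Eu N × ℝ) :
    lapX (fun p : Eu N × ℝ => barr (((N : ℝ) - 2) / 2) p.1) p ≤ 0 := by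
  set α := ((N : ℝ) - 2) / 2 with hα
  have hN' : (3 : ℝ) ≤ N := by exact_mod_cast hN
  have hα0 : 0 ≤ α := by rw [hα]; linarith
  unfold lapX
  simp only [lapX_barr_term]
  rw [← Finset.mul_sum, Finset.sum_sub_distrib, ← Finset.mul_sum]
  have hs : ∑ i, (p.1 i) ^ 2 = ‖p.1‖ ^ 2 := by
    rw [EuclideanSpace.norm_sq_eq]; simp
  rw [hs]
  have e : barr (α + 1) p.1 = barr (α + 2) p.1 * (1 + ‖p.1‖ ^ 2) := by
    unfold barr
    rw [show -(α + 1) = -(α + 2) + 1 by ring, Real.rpow_add (by positivity), Real.rpow_one]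
  rw [e]
  simp only [Finset.sum_const, Finset.card_univ, Fintype.card_fin, nsmul_eq_mul]
  have e2 : 2 * (α + 1) = N := by rw [hα]; ring
  rw [e2]
  have := mul_nonneg hα0 (mul_nonneg (show (0 : ℝ) ≤ N by linarith) (barr_pos (α + 2) p.1).le)
  nlinarith

theorem barr_sub_le {α ε R : ℝ} (hα : 0 ≤ α) (hε : 0 < ε) (hεR : ε ≤ R / 2)
    {x : Eu N} (hx : R - ε ≤ ‖x‖) (hx2 : ‖x‖ ≤ R + ε) :
    barr α x - (1 + (R + ε) ^ 2) ^ (-α) ≤ 4 * α * ε * R * (R / 2) ^ (-(2 * α + 2)) := by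
  have hR : 0 < R := by linarith
  set a := 1 + ‖x‖ ^ 2 with ha
  set a1 := 1 + (R + ε) ^ 2 with ha1
  have ha0 : 0 < a := by positivity
  have ha10 : 0 < a1 := by positivity
  have h1 : a1 - a ≤ 4 * ε * R := by
    have : (R - ε) ^ 2 ≤ ‖x‖ ^ 2 := pow_le_pow_left₀ (by linarith) hx 2
    rw [ha, ha1]; nlinarith
  have h2 : a1 ^ (-α) ≥ a ^ (-α) * (1 - α * ((a1 - a) / a)) := by
    have e : a1 ^ (-α) = a ^ (-α) * Real.exp (-α * Real.log (a1 / a)) := by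
      rw [mul_comm (-α), ← Real.rpow_def_of_pos (by positivity), ← Real.mul_rpow ha0.le
        (by positivity), mul_div_cancel₀ _ ha0.ne']
    rw [e]
    refine mul_le_mul_of_nonneg_left ?_ (Real.rpow_nonneg ha0.le _)
    have l1 := Real.add_one_le_exp (-α * Real.log (a1 / a))
    have l2 := Real.log_le_sub_one_of_pos (show 0 < a1 / a by positivity)
    have l3 : a1 / a - 1 = (a1 - a) / a := by field_simp
    rw [l3] at l2
    nlinarith [mul_le_mul_of_nonneg_left l2 hα]
  have h3 : a ^ (-α) * (α * ((a1 - a) / a)) = α * (a1 - a) * a ^ (-α - 1) := by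
    rw [Real.rpow_sub_one ha0.ne']; ring
  have h4 : a ^ (-α - 1) ≤ (R / 2) ^ (-(2 * α + 2)) := by
    have : (R / 2) ^ (-(2 * α + 2)) = ((R / 2) ^ 2) ^ (-α - 1) := by
      rw [← Real.rpow_natCast, ← Real.rpow_mul (by positivity)]; congr 1; push_cast; ring
    rw [this]
    refine Real.rpow_le_rpow_of_nonpos (by positivity) ?_ (by linarith)
    have : (R / 2) ^ 2 ≤ ‖x‖ ^ 2 := pow_le_pow_left₀ (by linarith) (by linarith) 2
    linarith
  have h5 : 0 ≤ a1 - a := by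
    have : ‖x‖ ^ 2 ≤ (R + ε) ^ 2 := pow_le_pow_left₀ (norm_nonneg _) hx2 2
    rw [ha, ha1]; linarith
  calc barr α x - a1 ^ (-α) ≤ α * (a1 - a) * a ^ (-α - 1) := by
        rw [← h3]; unfold barr; rw [← ha]; linarith
    _ ≤ α * (4 * ε * R) * (R / 2) ^ (-(2 * α + 2)) := by
        refine mul_le_mul (mul_le_mul_of_nonneg_left h1 hα) h4
          (Real.rpow_nonneg ha0.le _) (by positivity)
    _ = _ := by ring

end

section

variable {N : ℕ} {ε lam : ℝ} {k μ : Measure (Eu N × ℝ)}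

theorem FB_of_supp [hm : IsFiniteMeasure μ] (h : ∀ᵐ q ∂μ, ‖q.1‖ ≤ ε ∧ q.2 = 0) : FB μ := by
  refine ⟨hm, max ε 0, ?_⟩
  filter_upwards [h] with q hq
  rw [Prod.norm_def, hq.2, norm_zero]
  exact max_le_max hq.1 le_rfl

theorem Ker.FBk (K : Ker ε lam k μ) : FB k := by
  have := K.prob
  exact FB_of_supp K.ksupp

theorem Ker.FBm (K : Ker ε lam k μ) : FB μ := by
  have := K.fin
  exact FB_of_supp K.msupp

theorem Ker.lam_nonneg (K : Ker ε lam k μ) : 0 ≤ lam := by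
  rw [← K.mass]; exact measureReal_nonneg

theorem Ker.cv_barr_le (hN : 3 ≤ N) (K : Ker ε lam k μ) (z : Eu N × ℝ) :
    cv μ (fun q => barr (((N : ℝ) - 2) / 2) q.1) z ≤ lam * barr (((N : ℝ) - 2) / 2) z.1 := by
  have h := K.lap _ (barr_contDiff (((N : ℝ) - 2) / 2)) z
  have : cv k (lapX fun p : Eu N × ℝ => barr (((N : ℝ) - 2) / 2) p.1) z ≤ 0 :=
    integral_nonpos fun q => lapX_barr_nonpos hN _
  linarith

theorem Ker.Aop_smooth (K : Ker ε lam k μ) {f : Eu N × ℝ → ℝ} (hf : ContDiff ℝ (⊤ : ℕ∞) f)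
    (z : Eu N × ℝ) : Aop μ lam f z = cv k (lapX f) z := by
  rw [K.lap f hf]; rfl

/-- Solution of the dual problem with boundary and energy estimates uniform in the kernel. -/
theorem dual_solution (hN : 3 ≤ N) {f : Eu N × ℝ → ℝ} {T : ℝ} (hT : 0 < T)
    (hf : ContDiff ℝ (⊤ : ℕ∞) f) (hfc : HasCompactSupport f) (hf0 : ∀ z, 0 ≤ f z) :
    ∃ C Rm CE : ℝ, 0 ≤ C ∧ 0 < Rm ∧ 0 ≤ CE ∧ (∀ z, Rm ≤ ‖z.1‖ → f z = 0) ∧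
      ∀ R₀ R ε lam : ℝ, ∀ k μ : Measure (Eu N × ℝ),
      Rm ≤ R₀ → R₀ ≤ R → R ≤ 2 * R₀ → 0 < ε → ε ≤ R₀ / 2 → Ker ε lam k μ →
      ∀ (b : Eu N × ℝ → ℝ) (B : ℝ), Measurable b → (∀ z, 0 ≤ b z) → (∀ z, b z ≤ B) →
      (∀ z, R ≤ ‖z.1‖ → b z = 0) →
      ∃ p ψ : Eu N × ℝ → ℝ, BM p ∧ BM ψ ∧ (∀ z, ψ z = timeOp (kbwd T) p z) ∧
      (∀ z, p z = b z * Aop μ lam ψ z + f z) ∧ (∀ z, 0 ≤ ψ z) ∧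
      (∀ z, R ≤ ‖z.1‖ → ψ z = 0) ∧ (∀ z, z.2 ∉ Ioo 0 T → ψ z = 0) ∧
      (∀ z, R - ε ≤ ‖z.1‖ → ψ z ≤ C * ε * R₀ / R₀ ^ N) ∧
      ∫ z, b z * Aop μ lam ψ z ^ 2 ≤ CE := by
  set α := ((N : ℝ) - 2) / 2 with hα
  have hN' : (3 : ℝ) ≤ N := by exact_mod_cast hN
  have hα0 : 0 < α := by rw [hα]; linarith
  have hfBM := BM.of_continuous hf.continuous hfc
  obtain ⟨Cf, hCf⟩ := hfBM.bdd
  obtain ⟨Rf, hRf⟩ := hfBM.supp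
  have hCf0 : 0 ≤ Cf := (abs_nonneg _).trans (hCf 0)
  set cf : ℝ := (1 + Rf ^ 2) ^ (-α) with hcf
  have hcf0 : 0 < cf := Real.rpow_pos_of_pos (by positivity) _
  have htend : Tendsto (fun r : ℝ => (1 + r ^ 2) ^ (-α)) atTop (𝓝 0) := by
    refine (tendsto_rpow_neg_atTop hα0).comp ?_
    exact tendsto_atTop_add_const_left _ _ (tendsto_pow_atTop (by norm_num))
  obtain ⟨r₁, hr₁⟩ := eventually_atTop.1
    (htend.eventually (eventually_le_nhds (show (0 : ℝ) < cf / 2 by positivity)))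
  set c := 2 * Cf / cf with hc
  have hc0 : 0 ≤ c := by positivity
  have hLBM : BM (lapX f) := BM.of_continuous (lapX_contDiff hf).continuous
    (lapX_hasCompactSupport hfc)
  have hRf' : ∀ z : Eu N × ℝ, Rf < ‖z.1‖ → f z = 0 := fun z hz =>
    hRf z (hz.trans_le (norm_fst_le z))
  refine ⟨8 * T * c * α * 2 ^ N, max (max r₁ (Rf + 1)) 1, T * c * ∫ z, |lapX f z|,
    by positivity, by positivity, ?_, fun z hz => hRf' z ?_, ?_⟩
  · have : 0 ≤ ∫ z, |lapX f z| := integral_nonneg fun _ => abs_nonneg _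
    positivity
  · have := (le_max_right r₁ (Rf + 1)).trans ((le_max_left _ 1).trans hz)
    linarith
  intro R₀ R ε lam k μ hR₀ hR hR2 hε hεR K b B hbm hb0 hbB hbR
  have hR₀r : r₁ ≤ R₀ := (le_max_left _ _).trans ((le_max_left _ _).trans hR₀)
  have hR₀f : Rf + 1 ≤ R₀ := (le_max_right _ _).trans ((le_max_left _ _).trans hR₀)
  have hR₀0 : 0 < R₀ := lt_of_lt_of_le (by positivity) hR₀
  have := K.fin
  have hlam := K.lam_nonneg
  set d : ℝ := (1 + (R + ε) ^ 2) ^ (-α) with hd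
  have hd0 : 0 < d := Real.rpow_pos_of_pos (by positivity) _
  have hdc : d ≤ cf / 2 := hr₁ _ (by linarith)
  have hd1 : d ≤ 1 :=
    Real.rpow_le_one_of_one_le_of_nonpos (by nlinarith [sq_nonneg (R + ε)]) (by linarith)
  set Φ : Eu N → ℝ := fun y => c * (barr α y - d) with hΦ
  have hΦ0 : ∀ y, ‖y‖ ≤ R + ε → 0 ≤ Φ y := fun y hy => by
    refine mul_nonneg hc0 (sub_nonneg.2 ?_)
    exact Real.rpow_le_rpow_of_nonpos (by positivity) (by gcongr) (by linarith)
  have hΦle : ∀ y, Φ y ≤ c := fun y => by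
    have := mul_le_mul_of_nonneg_left (barr_le_one hα0.le y) hc0
    simp only [hΦ]; nlinarith
  have hΦabs : ∀ y, |Φ y| ≤ c := fun y => by
    simp only [hΦ]
    rw [abs_mul, abs_of_nonneg hc0]
    have h1 := barr_pos α y
    have h2 := barr_le_one hα0.le y
    have : |barr α y - d| ≤ 1 := abs_le.2 ⟨by linarith, by linarith⟩
    nlinarith
  have hΦm : Measurable Φ := ((barr_measurable α).sub measurable_const).const_mul _
  have hΦs : ∀ z : Eu N × ℝ, cv μ (fun q => Φ q.1) z ≤ lam * Φ z.1 := by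
    intro z
    have h1 : cv μ (fun q => Φ q.1) z =
        c * (cv μ (fun q : Eu N × ℝ => barr α q.1) z - lam * d) := by
      unfold cv
      rw [integral_const_mul, integral_sub _ (integrable_const _), integral_const, K.mass,
        smul_eq_mul]
      exact slice_integrable (f := fun q : Eu N × ℝ => barr α q.1)
        ((barr_measurable α).comp measurable_fst) (C := 1)
        (fun q => by rw [abs_of_pos (barr_pos _ _)]; exact barr_le_one hα0.le _) z
    have h2 := mul_le_mul_of_nonneg_left (K.cv_barr_le hN z) hc0
    rw [h1]; simp only [hΦ]; linarith
  have hfΦ : ∀ z : Eu N × ℝ, ‖z.1‖ < R → f z ≤ Φ z.1 := by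
    intro z hz
    by_cases h : Rf < ‖z.1‖
    · rw [hRf' z h]; exact hΦ0 _ (by linarith)
    · have h1 : cf ≤ barr α z.1 :=
        Real.rpow_le_rpow_of_nonpos (by positivity)
          (by have := pow_le_pow_left₀ (norm_nonneg _) (not_lt.1 h) 2; linarith) (by linarith)
      calc f z ≤ Cf := (le_abs_self _).trans (hCf z)
        _ = c * (cf / 2) := by rw [hc]; field_simp
        _ ≤ Φ z.1 := mul_le_mul_of_nonneg_left (by linarith) hc0
  obtain ⟨p, ψ, hp, hψ, h1, h2, h3, h4, h5, h6⟩ := dual_exists K.FBm K.msupp hlam hbm hb0 hbB hbR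
    hfBM hf0 (fun z hz => hRf' z (by linarith)) hΦm hΦabs hΦ0 hΦs hfΦ hε.le hT
  have hbnd : 0 ≤ 8 * T * c * α * 2 ^ N * ε * R₀ / R₀ ^ N := by positivity
  have hψc : ∀ z, |ψ z| ≤ T * c := fun z => by
    rw [abs_of_nonneg (h3 z)]
    by_cases hz : ‖z.1‖ < R
    · exact (h6 z hz).trans (mul_le_mul_of_nonneg_left (hΦle _) hT.le)
    · rw [h4 z (not_lt.1 hz)]; positivity
  refine ⟨p, ψ, hp, hψ, h1, h2, h3, h4, h5, fun z hz => ?_, ?_⟩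
  · by_cases hz2 : ‖z.1‖ < R
    · have e := barr_sub_le hα0.le hε (show ε ≤ R / 2 by linarith) hz (by linarith)
      have e1 : (R / 2) ^ (-(2 * α + 2)) ≤ 2 ^ N / R₀ ^ N := by
        rw [show -(2 * α + 2) = -(N : ℝ) by rw [hα]; ring, Real.rpow_neg (by linarith),
          Real.rpow_natCast, ← div_pow, ← inv_pow]
        refine pow_le_pow_left₀ (inv_nonneg.2 (by linarith)) ?_ _
        rw [inv_div]
        exact div_le_div_of_nonneg_left (by norm_num) hR₀0 hR
      calc ψ z ≤ T * Φ z.1 := h6 z hz2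
        _ ≤ T * (c * (4 * α * ε * (2 * R₀) * (2 ^ N / R₀ ^ N))) := by
            refine mul_le_mul_of_nonneg_left (mul_le_mul_of_nonneg_left (e.trans ?_) hc0) hT.le
            have hRR : 0 ≤ R := by linarith
            gcongr
        _ = _ := by ring
    · rw [h4 z (not_lt.1 hz2)]; exact hbnd
  · have hA := hψ.Aop K.FBm lam
    have habs : ∀ z, |b z| ≤ B := fun z => by rw [abs_of_nonneg (hb0 z)]; exact hbB z
    have en := energy_nonpos hT K.FBm (K.msupp.mono fun _ h => h.2) K.msymm hp
    rw [K.mass, ← funext h1] at en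
    have e1 : ∫ z, p z * Aop μ lam ψ z =
        (∫ z, b z * Aop μ lam ψ z ^ 2) + ∫ z, f z * Aop μ lam ψ z := by
      rw [← integral_add]
      · congr 1; ext z; rw [h2]; ring
      · simp only [pow_two]; exact ((hA.mul hA).bmul hbm habs).integrable
      · exact (hfBM.mul hA).integrable
    have e2 : ∫ z, f z * Aop μ lam ψ z = ∫ z, cv k (lapX f) z * ψ z := by
      rw [← Aop_symm K.FBm K.msymm lam hfBM hψ]
      congr 1; ext z; rw [K.Aop_smooth hf]
    have hkp := K.prob
    have e3 : |∫ z, cv k (lapX f) z * ψ z| ≤ T * c * ∫ z, |lapX f z| := by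
      have i1 : ∫ z, |cv k (lapX f) z| ≤ ∫ z, |lapX f z| := by
        have := integral_cv (m := k) hLBM.abs.integrable
        rw [probReal_univ, one_mul] at this
        rw [← this]
        exact integral_mono (hLBM.cv K.FBk).abs.integrable (hLBM.abs.cv K.FBk).integrable
          fun z => abs_integral_le_integral_abs
      calc _ ≤ ∫ z, |cv k (lapX f) z * ψ z| := abs_integral_le_integral_abs
        _ ≤ ∫ z, T * c * |cv k (lapX f) z| := by
            refine integral_mono ((hLBM.cv K.FBk).mul hψ).abs.integrable
              ((hLBM.cv K.FBk).abs.const_mul _).integrable fun z => ?_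
            simp only
            rw [abs_mul, mul_comm]
            exact mul_le_mul_of_nonneg_right (hψc z) (abs_nonneg _)
        _ ≤ _ := by
            rw [integral_const_mul]
            exact mul_le_mul_of_nonneg_left i1 (by positivity)
    have := neg_abs_le (∫ z, cv k (lapX f) z * ψ z)
    linarith

end

/-- The measure whose convolution integrates forward in time over `(0,L)`. -/
def lineM (N : ℕ) (L : ℝ) : Measure (Eu N × ℝ) :=
  (volume.restrict (Ioo 0 L)).map (fun s : ℝ => ((0 : Eu N), -s))

/-- The cylinder `B_R × (0,T)`. -/
def cyl (N : ℕ) (R T : ℝ) : Set (Eu N × ℝ) := ball 0 R ×ˢ Ioo 0 T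

/-- The linear inequality satisfied by the difference of two solutions. -/
structure CoreHyp {N : ℕ} (ρ : Eu N → ℝ) (T : ℝ) (w a : Eu N × ℝ → ℝ) (w₀ : Eu N → ℝ) : Prop where
  hT : 0 < T
  ρm : Measurable ρ
  ρi : ∀ R, IntegrableOn ρ (ball 0 R)
  ρpos : ∀ R, ∃ c > 0, ∀ x, ‖x‖ < R → c ≤ ρ x
  wm : Measurable w
  am : Measurable a
  a0 : ∀ z, 0 ≤ a z
  wb : ∀ R, ∃ W, ∀ z ∈ cyl N R T, |w z| ≤ W
  ab : ∀ R, ∃ A, ∀ z ∈ cyl N R T, a z ≤ A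
  w0m : Measurable w₀
  w0neg : ∀ x, w₀ x ≤ 0
  w0i : ∀ R, IntegrableOn (fun x => ρ x * w₀ x) (ball 0 R)
  weak : ∀ g : Eu N × ℝ → ℝ, ContDiff ℝ (⊤ : ℕ∞) g → HasCompactSupport g →
    tsupport g ⊆ univ ×ˢ Iio T →
    ∫ z in univ ×ˢ Ioo 0 T, ((w z - w₀ z.1) * ρ z.1 * ptder g z + a z * w z * lapX g z) = 0

section

variable {N : ℕ} {f g h : Eu N × ℝ → ℝ} {m : Measure (Eu N × ℝ)} {L T R : ℝ}

theorem cyl_measurable (N : ℕ) (R T : ℝ) : MeasurableSet (cyl N R T) :=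
  measurableSet_ball.prod measurableSet_Ioo

theorem cyl_mono {R' : ℝ} (h : R ≤ R') : cyl N R T ⊆ cyl N R' T :=
  prod_mono (ball_subset_ball h) Subset.rfl

theorem mem_cyl {z : Eu N × ℝ} : z ∈ cyl N R T ↔ ‖z.1‖ < R ∧ z.2 ∈ Ioo 0 T := by
  simp [cyl]

theorem BM_cyl (hf : Measurable f) {C : ℝ} (hC : ∀ z ∈ cyl N R T, |f z| ≤ C) :
    BM ((cyl N R T).indicator f) := by
  refine ⟨hf.indicator (cyl_measurable N R T), ⟨|C|, fun z => ?_⟩, ⟨max R |T|, fun z hz => ?_⟩⟩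
  · by_cases h : z ∈ cyl N R T
    · rw [indicator_of_mem h]; exact (hC z h).trans (le_abs_self C)
    · rw [indicator_of_notMem h]; simp
  · refine indicator_of_notMem (fun h => ?_) _
    rw [mem_cyl] at h
    refine absurd hz (not_lt.2 ?_)
    rw [Prod.norm_def]
    refine max_le_max h.1.le ?_
    rw [Real.norm_eq_abs, abs_of_pos h.2.1]
    exact h.2.2.le.trans (le_abs_self T)

theorem integrable_cyl {φ : Eu N → ℝ} (hφ : IntegrableOn φ (ball 0 R)) :
    Integrable ((cyl N R T).indicator (fun z => φ z.1)) := by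
  have h1 : Integrable ((ball 0 R).indicator φ) := hφ.integrable_indicator measurableSet_ball
  have h2 := h1.mul_prod (integrable_ind T 1)
  rw [← Measure.volume_eq_prod] at h2
  refine h2.congr (Eventually.of_forall fun z => ?_)
  unfold cyl
  by_cases h3 : z.1 ∈ ball 0 R <;> by_cases h4 : z.2 ∈ Ioo 0 T <;>
    simp only [indicator, mem_prod, h3, h4] <;> simp

theorem cv_time_supp (hm : ∀ᵐ q ∂m, q.2 = 0) (hf : ∀ z, z.2 ∉ Ioo 0 T → f z = 0)
    {z : Eu N × ℝ} (hz : z.2 ∉ Ioo 0 T) : cv m f z = 0 := by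
  unfold cv
  rw [integral_eq_zero_of_ae]
  filter_upwards [hm] with q hq
  exact hf _ (by simpa [hq] using hz)

theorem lineM_meas : Measurable (fun s : ℝ => ((0 : Eu N), -s)) := by fun_prop

theorem FB_lineM (N : ℕ) (L : ℝ) : FB (lineM N L) := by
  have : IsFiniteMeasure (volume.restrict (Ioo 0 L)) := ⟨by simp⟩
  refine ⟨by unfold lineM; infer_instance, |L|, ?_⟩
  unfold lineM
  rw [ae_map_iff lineM_meas.aemeasurable (measurableSet_le (by fun_prop) measurable_const)]
  refine (ae_restrict_iff' measurableSet_Ioo).2 (Eventually.of_forall fun s hs => ?_)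
  rw [Prod.norm_def, norm_zero, norm_neg, Real.norm_eq_abs, abs_of_pos hs.1]
  exact max_le (abs_nonneg _) (hs.2.le.trans (le_abs_self _))

theorem cv_lineM (hf : Measurable f) (z : Eu N × ℝ) :
    cv (lineM N L) f z = ∫ s in Ioo 0 L, f (z.1, z.2 + s) := by
  unfold cv lineM
  rw [integral_map lineM_meas.aemeasurable]
  · congr 1; ext s
    have : z - ((0 : Eu N), -s) = (z.1, z.2 + s) := by ext <;> simp
    rw [this]
  · exact (hf.comp (measurable_const.sub measurable_id)).aestronglyMeasurable

theorem cv_lineM_eq_timeOp (hf : Measurable f) (hfT : ∀ z, z.2 ∉ Ioo 0 T → f z = 0) (hL : T ≤ L)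
    {z : Eu N × ℝ} (hz : z.2 ∈ Ioo 0 T) : cv (lineM N L) f z = timeOp (kbwd T) f z := by
  rw [cv_lineM hf, ← integral_indicator measurableSet_Ioo, timeOp,
    ← integral_add_left_eq_self (μ := volume) (fun s => kbwd T z.2 s * f (z.1, s)) z.2]
  congr 1; ext s
  by_cases h1 : z.2 + s ∈ Ioo 0 T
  · by_cases h2 : 0 < s
    · rw [indicator_of_mem (show s ∈ Ioo 0 L from ⟨h2, by linarith [h1.2, hz.1]⟩), kbwd,
        if_pos ⟨hz.1, by linarith, h1.2⟩, one_mul]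
    · rw [indicator_of_notMem (show s ∉ Ioo 0 L from fun h => h2 h.1), kbwd, if_neg, zero_mul]
      exact fun h => h2 (by linarith [h.2.1])
  · have := hfT (z.1, z.2 + s) h1
    rw [this, mul_zero]
    exact indicator_apply_eq_zero.2 fun _ => this

theorem cv_lineM_ptder (hf : ContDiff ℝ (⊤ : ℕ∞) f) (hfT : ∀ z, z.2 ∉ Ioo 0 T → f z = 0)
    (hL : T ≤ L) (hL0 : 0 ≤ L) {z : Eu N × ℝ} (hz : 0 < z.2) :
    cv (lineM N L) (ptder f) z = - f z := by
  have hc : Continuous (ptder f) := (contDiff_fderiv_apply hf _).continuous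
  rw [cv_lineM hc.measurable, ← integral_Ioc_eq_integral_Ioo,
    ← intervalIntegral.integral_of_le hL0,
    intervalIntegral.integral_eq_sub_of_hasDerivAt (f := fun s => f (z.1, z.2 + s))]
  · rw [hfT (z.1, z.2 + L) (fun h => by have := h.2; simp only at this; linarith)]
    simp
  · intro s _
    have h1 : HasFDerivAt f (fderiv ℝ f (z.1, z.2 + s)) (z.1, z.2 + s) :=
      (hf.differentiable (by simp) _).hasFDerivAt
    have h2 : HasDerivAt (fun s : ℝ => (z.1, z.2 + s)) ((0 : Eu N), (1 : ℝ)) s :=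
      (hasDerivAt_const s z.1).prodMk ((hasDerivAt_id s).const_add z.2)
    exact h1.comp_hasDerivAt s h2
  · refine Continuous.intervalIntegrable ?_ _ _
    exact hc.comp (by fun_prop)

end

section

variable {N : ℕ} {ρ : Eu N → ℝ} {T : ℝ} {w a : Eu N × ℝ → ℝ} {w₀ : Eu N → ℝ}
  {ε lam R₁ R₂ : ℝ} {k μ : Measure (Eu N × ℝ)}

theorem CoreHyp.BM_flux (H : CoreHyp ρ T w a w₀) (R : ℝ) :
    BM ((cyl N R T).indicator (fun z => a z * w z)) := by
  obtain ⟨W, hW⟩ := H.wb R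
  obtain ⟨A, hA⟩ := H.ab R
  refine BM_cyl (H.am.mul H.wm) (C := A * W) fun z hz => ?_
  rw [abs_mul, abs_of_nonneg (H.a0 z)]
  exact mul_le_mul (hA z hz) (hW z hz) (abs_nonneg _) ((H.a0 z).trans (hA z hz))

theorem CoreHyp.integrable_ρ_mul (H : CoreHyp ρ T w a w₀) (R : ℝ) {φ : Eu N × ℝ → ℝ}
    (hφ : Measurable φ) {C : ℝ} (hC : ∀ z ∈ cyl N R T, |φ z| ≤ C) :
    Integrable ((cyl N R T).indicator (fun z => ρ z.1 * φ z)) := by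
  have h1 := (BM_cyl hφ hC).integrable_mul (integrable_cyl (T := T) (H.ρi R))
  refine h1.congr (Eventually.of_forall fun z => ?_)
  by_cases h : z ∈ cyl N R T <;> simp [h]

theorem CoreHyp.integrable_ρw (H : CoreHyp ρ T w a w₀) (R : ℝ) :
    Integrable ((cyl N R T).indicator (fun z => ρ z.1 * w z)) := by
  obtain ⟨W, hW⟩ := H.wb R
  exact H.integrable_ρ_mul R H.wm hW

theorem CoreHyp.integrable_ρw0 (H : CoreHyp ρ T w a w₀) (R : ℝ) :
    Integrable ((cyl N R T).indicator (fun z => ρ z.1 * w₀ z.1)) :=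
  integrable_cyl (H.w0i R)

theorem CoreHyp.cutoff_weak (H : CoreHyp ρ T w a w₀) {g : Eu N × ℝ → ℝ}
    (hg : ContDiff ℝ (⊤ : ℕ∞) g) (hgc : HasCompactSupport g)
    (hgs : tsupport g ⊆ ball 0 R₁ ×ˢ Iio T) :
    ∫ z, ((cyl N R₁ T).indicator (fun z => ρ z.1 * w z) z -
        (cyl N R₁ T).indicator (fun z => ρ z.1 * w₀ z.1) z) * ptder g z +
      (cyl N R₁ T).indicator (fun z => a z * w z) z * lapX g z = 0 := by
  have h := H.weak g hg hgc (hgs.trans (prod_mono (subset_univ _) Subset.rfl))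
  rw [← integral_indicator (MeasurableSet.univ.prod measurableSet_Ioo)] at h
  rw [← h]
  congr 1; ext z
  by_cases hz : z ∈ cyl N R₁ T
  · rw [indicator_of_mem hz, indicator_of_mem hz, indicator_of_mem hz,
      indicator_of_mem (show z ∈ univ ×ˢ Ioo 0 T from ⟨mem_univ _, hz.2⟩)]
    ring
  · rw [indicator_of_notMem hz, indicator_of_notMem hz, indicator_of_notMem hz]
    by_cases ht : z.2 ∈ Ioo 0 T
    · have hzs : z ∉ tsupport g := fun h => hz ⟨(hgs h).1, ht⟩
      have e1 : lapX g z = 0 := image_eq_zero_of_notMem_tsupport fun h => hzs (tsupport_lapX h)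
      have e2 : ptder g z = 0 :=
        image_eq_zero_of_notMem_tsupport fun h => hzs (tsupport_fderiv_apply (0, 1) h)
      rw [indicator_of_mem (show z ∈ univ ×ˢ Ioo 0 T from ⟨mem_univ _, ht⟩), e1, e2]; simp
    · rw [indicator_of_notMem (fun h => ht h.2)]; simp

/-- The mollified equation in integrated form. -/
theorem CoreHyp.mollified (H : CoreHyp ρ T w a w₀) (K : Ker ε lam k μ) (hR : R₂ + ε ≤ R₁) :
    ∀ᵐ z, z ∈ cyl N R₂ T →
      cv k (fun z => (cyl N R₁ T).indicator (fun z => ρ z.1 * w z) z -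
        (cyl N R₁ T).indicator (fun z => ρ z.1 * w₀ z.1) z) z -
      timeOp (fun t s => kbwd T s t)
        (Aop μ lam ((cyl N R₁ T).indicator (fun z => a z * w z))) z = 0 := by
  have hkp := K.prob
  have hμf := K.fin
  set D : Eu N × ℝ → ℝ := fun z => (cyl N R₁ T).indicator (fun z => ρ z.1 * w z) z -
        (cyl N R₁ T).indicator (fun z => ρ z.1 * w₀ z.1) z with hD
  set V := (cyl N R₁ T).indicator (fun z => a z * w z) with hV
  have hDi : Integrable D := (H.integrable_ρw R₁).sub (H.integrable_ρw0 R₁)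
  have hVB : BM V := H.BM_flux R₁
  have hAV := hVB.Aop K.FBm lam
  have hτ := (TK_kbwd T).swap
  have hD0 : ∀ z, z.2 ∉ Ioo 0 T → D z = 0 := fun z hz => by
    have : z ∉ cyl N R₁ T := fun h => hz h.2
    simp [hD, this]
  have hV0 : ∀ z, z.2 ∉ Ioo 0 T → V z = 0 := fun z hz => by
    have : z ∉ cyl N R₁ T := fun h => hz h.2
    simp [hV, this]
  refine IsOpen.ae_eq_zero_of_integral_contDiff_smul_eq_zero (μ := volume)
    (isOpen_ball.prod isOpen_Ioo) ?_ fun f hf hfc hfs => ?_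
  · exact ((integrable_cv hDi).sub (hAV.timeOp hτ).integrable).locallyIntegrable.locallyIntegrableOn _
  have hfB := BM.of_continuous hf.continuous hfc
  have hfT : ∀ z, z.2 ∉ Ioo 0 T → f z = 0 := fun z hz =>
    image_eq_zero_of_notMem_tsupport fun h => hz (hfs h).2
  set ℓ := lineM N T with hℓ
  have hFℓ := FB_lineM N T
  have hℓf := hFℓ.fin
  set φ := cv ℓ f with hφ
  have hφs : ContDiff ℝ (⊤ : ℕ∞) φ := cv_contDiff hf hfc
  have hφc : HasCompactSupport φ := cv_hasCompactSupport hFℓ hfB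
  have hφB := BM.of_continuous hφs.continuous hφc
  have hgs : ContDiff ℝ (⊤ : ℕ∞) (cv k φ) := cv_contDiff hφs hφc
  have hgc : HasCompactSupport (cv k φ) := cv_hasCompactSupport K.FBk hφB
  have hsupp : tsupport (cv k φ) ⊆ ball 0 R₁ ×ˢ Iio T := by
    by_cases hne : (tsupport f).Nonempty
    · obtain ⟨z₁, hz₁, hm₁⟩ := hfc.isCompact.exists_isMaxOn hne
        (f := fun z : Eu N × ℝ => ‖z.1‖) (by fun_prop)
      obtain ⟨z₂, hz₂, hm₂⟩ := hfc.isCompact.exists_isMaxOn hne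
        (f := fun z : Eu N × ℝ => z.2) (by fun_prop)
      have hc : IsClosed {z : Eu N × ℝ | ‖z.1‖ ≤ ‖z₁.1‖ + ε ∧ z.2 ≤ z₂.2} :=
        (isClosed_le continuous_fst.norm continuous_const).inter
          (isClosed_le continuous_snd continuous_const)
      refine (closure_minimal (fun z hz => ?_) hc).trans fun z hz => ?_
      · by_contra hcon
        refine hz ?_
        unfold cv
        rw [integral_eq_zero_of_ae]
        filter_upwards [K.ksupp] with q hq
        rw [hφ, cv_lineM hf.continuous.measurable, Pi.zero_apply]
        refine setIntegral_eq_zero_of_forall_eq_zero fun s hs => ?_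
        by_contra hne0
        have hmem : ((z - q).1, (z - q).2 + s) ∈ tsupport f := subset_tsupport _ hne0
        refine hcon ⟨?_, ?_⟩
        · have e1 : ‖((z - q).1, (z - q).2 + s).1‖ ≤ ‖z₁.1‖ := hm₁ hmem
          simp only at e1
          calc ‖z.1‖ = ‖(z - q).1 + q.1‖ := by simp
            _ ≤ ‖(z - q).1‖ + ‖q.1‖ := norm_add_le _ _
            _ ≤ _ := add_le_add e1 hq.1
        · have e2 : ((z - q).1, (z - q).2 + s).2 ≤ z₂.2 := hm₂ hmem
          simp only at e2
          have e3 : (z - q).2 = z.2 := by simp [hq.2]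
          rw [e3] at e2
          linarith [hs.1]
      · have e1 := (hfs hz₁).1
        have e2 := (hfs hz₂).2.2
        rw [mem_ball_zero_iff] at e1
        refine ⟨?_, lt_of_le_of_lt hz.2 e2⟩
        rw [mem_ball_zero_iff]
        linarith [hz.1]
    · have hf0 : f = 0 := by
        rw [not_nonempty_iff_eq_empty, tsupport_eq_empty_iff] at hne
        exact hne
      have : cv k φ = 0 := by
        ext z; simp [hφ, hf0, cv]
      rw [this, tsupport_eq_empty_iff.2 rfl]
      exact empty_subset _
  have hw := H.cutoff_weak hgs hgc hsupp
  have e1 : ∀ z, D z * ptder (cv k φ) z = -(D z * cv k f z) := by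
    intro z
    by_cases ht : z.2 ∈ Ioo 0 T
    · have : ptder (cv k φ) z = - cv k f z := by
        rw [ptder_cv hφs hφc]
        unfold cv
        rw [← integral_neg]
        refine integral_congr_ae ?_
        filter_upwards [K.ksupp] with q hq
        rw [hφ, ptder_cv hf hfc]
        refine cv_lineM_ptder hf hfT le_rfl H.hT.le ?_
        simpa [hq.2] using ht.1
      rw [this]; ring
    · rw [hD0 z ht]; simp
  have e2 : ∀ z, V z * lapX (cv k φ) z = V z * Aop μ lam φ z := by
    intro z
    rw [lapX_cv hφs hφc, K.Aop_smooth hφs]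
  have hkf := hfB.cv K.FBk
  have hAφ := hφB.Aop K.FBm lam
  have hw2 : -(∫ z, D z * cv k f z) + ∫ z, V z * Aop μ lam φ z = 0 := by
    have hi1 : Integrable (fun z => -(D z * cv k f z)) := (hkf.integrable_mul hDi).neg
    have hi2 : Integrable (fun z => V z * Aop μ lam φ z) := (hVB.mul hAφ).integrable
    rw [← hw, ← integral_neg, ← integral_add hi1 hi2]
    refine integral_congr_ae (Eventually.of_forall fun z => ?_)
    change -(D z * cv k f z) + V z * Aop μ lam φ z =
      D z * ptder (cv k φ) z + V z * lapX (cv k φ) z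
    rw [e1, e2]
  have e3 : ∫ z, D z * cv k f z = ∫ z, cv k D z * f z := by
    obtain ⟨C, hC⟩ := hfB.bdd
    rw [cv_symm hDi hfB.meas hC, K.ksymm]
  have e4 : ∫ z, V z * Aop μ lam φ z =
      ∫ z, timeOp (fun t s => kbwd T s t) (Aop μ lam V) z * f z := by
    rw [← Aop_symm K.FBm K.msymm lam hVB hφB, timeOp_adjoint hAV hfB hτ]
    congr 1; ext z
    by_cases ht : z.2 ∈ Ioo 0 T
    · rw [hφ, cv_lineM_eq_timeOp hfB.meas hfT le_rfl ht]
    · have : Aop μ lam V z = 0 := by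
        unfold Aop
        rw [cv_time_supp (K.msupp.mono fun _ h => h.2) hV0 ht, hV0 z ht]; simp
      rw [this]; simp
  have e5 : ∀ z, f z • (cv k D z - timeOp (fun t s => kbwd T s t) (Aop μ lam V) z) =
      cv k D z * f z - timeOp (fun t s => kbwd T s t) (Aop μ lam V) z * f z := fun z => by
    rw [smul_eq_mul]; ring
  simp only [e5]
  rw [integral_sub (hfB.integrable_mul (integrable_cv hDi))
    ((hAV.timeOp hτ).mul hfB).integrable, ← e3, ← e4]
  linarith

/-- Testing the mollified equation with a dual function. -/
theorem CoreHyp.dual_test (H : CoreHyp ρ T w a w₀) (K : Ker ε lam k μ) (hR : R₂ + ε ≤ R₁)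
    {p : Eu N × ℝ → ℝ} (hp : BM p) (hpR : ∀ z, z ∉ cyl N R₂ T → p z = 0)
    (hp0 : ∀ z, 0 ≤ timeOp (kall T) p z) :
    ∫ z, cv k ((cyl N R₁ T).indicator (fun z => ρ z.1 * w z)) z * p z ≤
      ∫ z, (cyl N R₁ T).indicator (fun z => a z * w z) z * Aop μ lam (timeOp (kbwd T) p) z := by
  have hkp := K.prob
  have hμf := K.fin
  have hi1 := H.integrable_ρw R₁
  have hi0 := H.integrable_ρw0 R₁
  have hVB : BM _ := H.BM_flux R₁
  have hAV := hVB.Aop K.FBm lam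
  have hτ := (TK_kbwd T)
  set D1 := (cyl N R₁ T).indicator (fun z => ρ z.1 * w z) with hD1
  set D0 := (cyl N R₁ T).indicator (fun z => ρ z.1 * w₀ z.1) with hD0
  set V := (cyl N R₁ T).indicator (fun z => a z * w z) with hV
  have h1 : ∫ z, cv k (fun z => D1 z - D0 z) z * p z =
      ∫ z, V z * Aop μ lam (timeOp (kbwd T) p) z := by
    rw [← Aop_symm K.FBm K.msymm lam hVB (hp.timeOp hτ)]
    have e := timeOp_adjoint hAV hp hτ.swap
    rw [← e]
    refine integral_congr_ae ?_
    filter_upwards [H.mollified K hR] with z hz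
    by_cases h : z ∈ cyl N R₂ T
    · rw [sub_eq_zero.1 (hz h)]
    · rw [hpR z h]; simp
  obtain ⟨C, hC⟩ := hp.bdd
  have hcp := hp.cv K.FBk
  have h2 : ∫ z, cv k (fun z => D1 z - D0 z) z * p z =
      (∫ z, cv k D1 z * p z) - ∫ z, D0 z * cv k p z := by
    have hi : Integrable (fun z => D1 z - D0 z) := hi1.sub hi0
    rw [cv_symm hi hp.meas hC, cv_symm hi1 hp.meas hC, K.ksymm, ← integral_sub
      (hcp.integrable_mul hi1) (hcp.integrable_mul hi0)]
    congr 1; ext z; ring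
  have h3 : ∫ z, D0 z * cv k p z ≤ 0 := by
    have hi := hcp.integrable_mul hi0
    rw [Measure.volume_eq_prod] at hi ⊢
    rw [integral_prod _ hi]
    refine integral_nonpos fun x => ?_
    simp only [Pi.zero_apply]
    have hmid : T / 2 ∈ Ioo 0 T := ⟨by linarith [H.hT], by linarith [H.hT]⟩
    have e1 : ∫ t, D0 (x, t) * cv k p (x, t) =
        (ball 0 R₁).indicator (fun x => ρ x * w₀ x) x * timeOp (kall T) (cv k p) (x, T / 2) := by
      rw [timeOp_kall, indicator_of_mem hmid, one_mul, ← integral_indicator measurableSet_Ioo,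
        ← integral_const_mul]
      congr 1; ext t
      rw [hD0]; unfold cyl
      by_cases h4 : x ∈ ball 0 R₁ <;> by_cases h5 : t ∈ Ioo 0 T <;>
        simp only [indicator, mem_prod, h4, h5] <;> simp
    rw [e1, ← cv_timeOp (K.ksupp.mono fun _ h => h.2) hp (TK_kall T)]
    refine mul_nonpos_of_nonpos_of_nonneg ?_ (cv_nonneg hp0 _)
    refine indicator_apply_nonpos fun hx => ?_
    obtain ⟨c, hc, hcx⟩ := H.ρpos R₁
    exact mul_nonpos_of_nonneg_of_nonpos (hc.le.trans (hcx x (by simpa using hx))) (H.w0neg x)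
  linarith

end

/-- The part of the weight above the level `M`, on a cylinder. -/
def highW {N : ℕ} (ρ : Eu N → ℝ) (R T M : ℝ) : Eu N × ℝ → ℝ :=
  (cyl N R T).indicator fun z => ρ z.1 * (if M < ρ z.1 then 1 else 0)

section

variable {N : ℕ} {ρ : Eu N → ℝ} {T : ℝ} {w a : Eu N × ℝ → ℝ} {w₀ : Eu N → ℝ}
  {ε lam R R₁ M : ℝ} {k μ : Measure (Eu N × ℝ)} {p ψ b f G : Eu N × ℝ → ℝ}

theorem timeOp_kall_nonneg (hT : 0 < T) (hp : BM p)
    (hψ : ∀ z, 0 ≤ timeOp (kbwd T) p z) (z : Eu N × ℝ) : 0 ≤ timeOp (kall T) p z := by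
  obtain ⟨C, hC⟩ := hp.bdd
  rw [timeOp_kall]
  refine mul_nonneg (indicator_nonneg (fun _ _ => zero_le_one) _) ?_
  have h1 : ∀ t ∈ Ioo 0 T, -(C * t) ≤ ∫ s in Ioo 0 T, p (z.1, s) := by
    intro t ht
    have h2 := timeOp_kbwd_add (T := T) hp (z.1, t)
    rw [timeOp_kall, indicator_of_mem ht, one_mul] at h2
    rw [← h2]
    have h3 : |timeOp (fun t s => kbwd T s t) p (z.1, t)| ≤ C * t := by
      unfold timeOp
      have : ∫ s, kbwd T s (z.1, t).2 * p ((z.1, t).1, s) =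
          ∫ s in Ioo 0 t, kbwd T s t * p (z.1, s) := by
        rw [← integral_indicator measurableSet_Ioo]
        congr 1; ext s
        by_cases hs : s ∈ Ioo 0 t
        · rw [indicator_of_mem hs]
        · rw [indicator_of_notMem hs, kbwd, if_neg, zero_mul]
          exact fun h => hs ⟨h.1, h.2.1⟩
      rw [this]
      have h4 := norm_setIntegral_le_of_norm_le_const (μ := volume) (s := Ioo 0 t) (C := C)
        (f := fun s => kbwd T s t * p (z.1, s)) (by simp) fun s hs => ?_
      · simpa [Measure.real, ht.1.le] using h4
      · rw [Real.norm_eq_abs, abs_mul]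
        calc _ ≤ 1 * C := mul_le_mul ((TK_kbwd T).bdd _ _) (hC _) (abs_nonneg _) zero_le_one
          _ = C := one_mul C
    linarith [neg_abs_le (timeOp (fun t s => kbwd T s t) p (z.1, t)), hψ (z.1, t)]
  have h5 : Tendsto (fun t : ℝ => -(C * t)) (𝓝[>] 0) (𝓝 0) := by
    have : Tendsto (fun t : ℝ => -(C * t)) (𝓝 0) (𝓝 (-(C * 0))) :=
      Continuous.tendsto (by fun_prop) 0
    simpa using this.mono_left nhdsWithin_le_nhds
  refine le_of_tendsto h5 ?_
  filter_upwards [Ioo_mem_nhdsGT hT] with t ht using h1 t ht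

theorem CoreHyp.ρ_pos_cyl (H : CoreHyp ρ T w a w₀) {z : Eu N × ℝ} (hz : z ∈ cyl N R T) :
    0 < ρ z.1 := by
  obtain ⟨c, hc, h⟩ := H.ρpos R
  exact hc.trans_le (h _ (mem_cyl.1 hz).1)

theorem CoreHyp.ite_meas (H : CoreHyp ρ T w a w₀) :
    Measurable fun z : Eu N × ℝ => if M < ρ z.1 then (1 : ℝ) else 0 :=
  Measurable.ite (measurableSet_lt measurable_const (H.ρm.comp measurable_fst))
    measurable_const measurable_const

theorem CoreHyp.highW_integrable (H : CoreHyp ρ T w a w₀) : Integrable (highW ρ R T M) :=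
  H.integrable_ρ_mul R H.ite_meas (C := 1) fun z _ => by split_ifs <;> simp

theorem CoreHyp.highW_measurable (H : CoreHyp ρ T w a w₀) : Measurable (highW ρ R T M) :=
  ((H.ρm.comp measurable_fst).mul H.ite_meas).indicator (cyl_measurable N R T)

theorem CoreHyp.highW_nonneg (H : CoreHyp ρ T w a w₀) (z : Eu N × ℝ) : 0 ≤ highW ρ R T M z := by
  refine indicator_nonneg (fun z hz => mul_nonneg (H.ρ_pos_cyl hz).le ?_) z
  split_ifs <;> simp

theorem CoreHyp.highW_le (H : CoreHyp ρ T w a w₀) (z : Eu N × ℝ) :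
    highW ρ R T M z ≤ (cyl N R T).indicator (fun z => ρ z.1) z := by
  refine indicator_le_indicator' fun hz => ?_
  have := (H.ρ_pos_cyl hz).le
  split_ifs <;> simp [this]

theorem CoreHyp.highW_tendsto (H : CoreHyp ρ T w a w₀) (R : ℝ) :
    Tendsto (fun M : ℝ => ∫ z, highW ρ R T M z) atTop (𝓝 0) := by
  rw [show (0 : ℝ) = ∫ z : Eu N × ℝ, (0 : ℝ) by simp]
  refine tendsto_integral_filter_of_dominated_convergence
    ((cyl N R T).indicator fun z => ρ z.1) ?_ ?_ (integrable_cyl (H.ρi R)) ?_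
  · exact Eventually.of_forall fun M => H.highW_measurable.aestronglyMeasurable
  · refine Eventually.of_forall fun M => Eventually.of_forall fun z => ?_
    rw [Real.norm_eq_abs, abs_of_nonneg (H.highW_nonneg z)]
    exact H.highW_le z
  · refine Eventually.of_forall fun z => ?_
    refine tendsto_const_nhds.congr' ?_
    filter_upwards [eventually_ge_atTop (ρ z.1)] with M hM
    refine (indicator_apply_eq_zero.2 fun _ => ?_).symm
    rw [if_neg (not_lt.2 hM), mul_zero]

/-- The flux term: inside the ball it is rewritten through the dual equation, the rest lives in
a thin shell. -/
theorem CoreHyp.flux_le (H : CoreHyp ρ T w a w₀) (K : Ker ε lam k μ) (hε : 0 < ε) (hR : R + ε ≤ R₁)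
    {σ : Eu N × ℝ → ℝ} {S : ℝ} (hσ : Integrable ((cyl N R T).indicator σ))
    (hp : BM p) (hψ : BM ψ) (hf : BM f) (hσb : ∀ z ∈ cyl N R T, σ z * b z = a z)
    (hpe : ∀ z, p z = b z * Aop μ lam ψ z + f z) (hψ0 : ∀ z, 0 ≤ ψ z)
    (hψR : ∀ z, R ≤ ‖z.1‖ → ψ z = 0) (hψS : ∀ z, R - ε ≤ ‖z.1‖ → ψ z ≤ S) (hS : 0 ≤ S)
    (hG : ∀ r, IntegrableOn G (cyl N r T)) (hG0 : ∀ z, 0 ≤ G z)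
    (hwG : ∀ z, z.2 ∈ Ioo 0 T → a z * w z ≤ G z) :
    ∫ z, (cyl N R₁ T).indicator (fun z => a z * w z) z * Aop μ lam ψ z ≤
      (∫ z, (cyl N R T).indicator σ z * (w z * (p z - f z))) +
        lam * S * ∫ z in cyl N (R + ε) T \ cyl N R T, G z := by
  have hμf := K.fin
  obtain ⟨W, hW⟩ := H.wb R
  have hwp : BM ((cyl N R T).indicator fun z => w z) := BM_cyl H.wm hW
  have hi1 : Integrable fun z => (cyl N R T).indicator σ z * (w z * (p z - f z)) := by
    refine ((hwp.mul (hp.sub hf)).integrable_mul hσ).congr (Eventually.of_forall fun z => ?_)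
    by_cases h : z ∈ cyl N R T <;> simp [h]
  have hms : MeasurableSet (cyl N (R + ε) T \ cyl N R T) :=
    (cyl_measurable _ _ _).diff (cyl_measurable _ _ _)
  have hi2 : Integrable ((cyl N (R + ε) T \ cyl N R T).indicator G) :=
    ((hG (R + ε)).mono_set sdiff_subset).integrable_indicator hms
  rw [← integral_indicator hms, ← integral_const_mul, ← integral_add hi1 (hi2.const_mul _)]
  refine integral_mono ((H.BM_flux R₁).mul (hψ.Aop K.FBm lam)).integrable
    (hi1.add (hi2.const_mul _)) fun z => ?_
  have hSG : 0 ≤ lam * S := mul_nonneg K.lam_nonneg hS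
  by_cases hz : z ∈ cyl N R T
  · by_cases hz1 : z ∈ cyl N R₁ T
    · have hn : z ∉ cyl N (R + ε) T \ cyl N R T := fun h => h.2 hz
      simp only [indicator_of_mem hz, indicator_of_mem hz1, indicator_of_notMem hn, mul_zero,
        add_zero, hpe z, ← hσb z hz]
      refine le_of_eq ?_; ring
    · have hRR : ‖z.1‖ < R := (mem_cyl.1 hz).1
      exact absurd (mem_cyl.2 ⟨hRR.trans_le (by linarith), hz.2⟩) hz1
  · simp only [indicator_of_notMem hz, zero_mul, zero_add]
    by_cases hz1 : z ∈ cyl N R₁ T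
    · have hzR : R ≤ ‖z.1‖ := not_lt.1 fun h => hz (mem_cyl.2 ⟨h, hz1.2⟩)
      rw [indicator_of_mem hz1, Aop, hψR z hzR, mul_zero, sub_zero]
      have hc0 : 0 ≤ cv μ ψ z := cv_nonneg hψ0 z
      refine (mul_le_mul_of_nonneg_right (hwG z hz1.2) hc0).trans ?_
      by_cases hz2 : ‖z.1‖ < R + ε
      · rw [indicator_of_mem (show z ∈ cyl N (R + ε) T \ cyl N R T from
          ⟨mem_cyl.2 ⟨hz2, hz1.2⟩, hz⟩), mul_comm]
        refine mul_le_mul_of_nonneg_right ?_ (hG0 z)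
        have h1 : cv μ ψ z ≤ ∫ q, S ∂μ := by
          refine integral_mono_ae (hψ.slice z) (integrable_const _) ?_
          filter_upwards [K.msupp] with q hq
          refine hψS _ ?_
          have : ‖z.1‖ ≤ ‖(z - q).1‖ + ‖q.1‖ := by
            have := norm_add_le (z - q).1 q.1
            simpa using this
          linarith [hq.1]
        rw [integral_const, K.mass, smul_eq_mul] at h1
        exact h1
      · rw [indicator_of_notMem (fun h => hz2 (mem_cyl.1 h.1).1), mul_zero]
        have : cv μ ψ z = 0 := by
          unfold cv
          rw [integral_eq_zero_of_ae]
          filter_upwards [K.msupp] with q hq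
          refine hψR _ ?_
          have : ‖z.1‖ ≤ ‖(z - q).1‖ + ‖q.1‖ := by
            have := norm_add_le (z - q).1 q.1
            simpa using this
          linarith [hq.1, not_lt.1 hz2]
        rw [this, mul_zero]
    · rw [indicator_of_notMem hz1, zero_mul]
      exact mul_nonneg hSG (indicator_nonneg (fun z _ => hG0 z) z)

end

/-- The mollified weight. -/
def molW {N : ℕ} (ρ : Eu N → ℝ) (R T M : ℝ) (k : Measure (Eu N × ℝ)) (z : Eu N × ℝ) : ℝ :=
  ρ z.1 + cv k (highW ρ R T M) z

/-- The bounded part of `ρ w`. -/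
def lowPart {N : ℕ} (ρ : Eu N → ℝ) (w : Eu N × ℝ → ℝ) (R T M : ℝ) : Eu N × ℝ → ℝ :=
  (cyl N R T).indicator fun z => ρ z.1 * (if M < ρ z.1 then 0 else 1) * w z

section

variable {N : ℕ} {ρ : Eu N → ℝ} {T : ℝ} {w a : Eu N × ℝ → ℝ} {w₀ : Eu N → ℝ}
  {ε lam R R₁ M W : ℝ} {k μ : Measure (Eu N × ℝ)} {p ψ b f G : Eu N × ℝ → ℝ}

theorem CoreHyp.lowPart_abs_le (H : CoreHyp ρ T w a w₀) (hM : 0 ≤ M) (hW0 : 0 ≤ W)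
    (hW : ∀ z ∈ cyl N R₁ T, |w z| ≤ W) (z : Eu N × ℝ) : |lowPart ρ w R₁ T M z| ≤ M * W := by
  unfold lowPart
  by_cases hz : z ∈ cyl N R₁ T
  · rw [indicator_of_mem hz]
    have h0 := (H.ρ_pos_cyl hz).le
    split_ifs with h
    · simp [mul_nonneg hM hW0]
    · rw [mul_one, abs_mul, abs_of_nonneg h0]
      exact mul_le_mul (not_lt.1 h) (hW z hz) (abs_nonneg _) hM
  · rw [indicator_of_notMem hz, abs_zero]; positivity

theorem CoreHyp.BM_lowPart (H : CoreHyp ρ T w a w₀) (hM : 0 ≤ M) (hW0 : 0 ≤ W)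
    (hW : ∀ z ∈ cyl N R₁ T, |w z| ≤ W) : BM (lowPart ρ w R₁ T M) := by
  have hm : Measurable fun z : Eu N × ℝ => ρ z.1 * (if M < ρ z.1 then (0 : ℝ) else 1) * w z := by
    refine ((H.ρm.comp measurable_fst).mul (Measurable.ite (measurableSet_lt measurable_const
      (H.ρm.comp measurable_fst)) measurable_const measurable_const)).mul H.wm
  refine BM_cyl hm (C := M * W) fun z hz => ?_
  have := H.lowPart_abs_le hM hW0 hW z
  rwa [lowPart, indicator_of_mem hz] at this

theorem CoreHyp.molW_integrable (H : CoreHyp ρ T w a w₀) (K : Ker ε lam k μ) :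
    Integrable ((cyl N R T).indicator (molW ρ R₁ T M k)) := by
  have := K.prob
  have h2 : Integrable (cv k (highW ρ R₁ T M)) := integrable_cv H.highW_integrable
  refine ((integrable_cyl (T := T) (H.ρi R)).add
    (h2.indicator (cyl_measurable N R T))).congr (Eventually.of_forall fun z => ?_)
  by_cases hz : z ∈ cyl N R T <;> simp [hz, molW]

theorem CoreHyp.commutator_le (H : CoreHyp ρ T w a w₀) (K : Ker ε lam k μ) (hR : R ≤ R₁)
    (hM : 0 ≤ M) (hW0 : 0 ≤ W) (hW : ∀ z ∈ cyl N R₁ T, |w z| ≤ W) (hp : BM p)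
    (hpR : ∀ z, z ∉ cyl N R T → p z = 0) :
    (∫ z, (cyl N R T).indicator (molW ρ R₁ T M k) z * (w z * p z)) -
        ∫ z, cv k ((cyl N R₁ T).indicator (fun z => ρ z.1 * w z)) z * p z ≤
      (∫ z, |lowPart ρ w R₁ T M z - cv k (lowPart ρ w R₁ T M) z| * |p z|) +
        2 * W * ∫ z, (highW ρ R₁ T M z + cv k (highW ρ R₁ T M) z) * |p z| := by
  have hkp := K.prob
  set h := highW ρ R₁ T M with hh
  set g := lowPart ρ w R₁ T M with hg
  set w' := (cyl N R₁ T).indicator w with hw'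
  have hhi : Integrable h := H.highW_integrable
  have hki : Integrable (cv k h) := integrable_cv hhi
  have hgB : BM g := H.BM_lowPart hM hW0 hW
  have hw'B : BM w' := BM_cyl H.wm hW
  have hw'W : ∀ z, |w' z| ≤ W := fun z => by
    by_cases hz : z ∈ cyl N R₁ T
    · rw [hw', indicator_of_mem hz]; exact hW z hz
    · rw [hw', indicator_of_notMem hz, abs_zero]; exact hW0
  have hkpB := hp.cv K.FBk
  have hD : ∀ z, (cyl N R₁ T).indicator (fun z => ρ z.1 * w z) z = g z + h z * w' z := by
    intro z
    rw [hg, hh, hw', lowPart, highW]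
    by_cases hz : z ∈ cyl N R₁ T
    · simp only [indicator_of_mem hz]; split_ifs <;> ring
    · simp [hz]
  obtain ⟨C, hC⟩ := hp.bdd
  have hwp := hw'B.mul hp
  have hwkp := hw'B.mul hkpB
  have i1 : Integrable fun z => g z * p z := (hgB.mul hp).integrable
  have i2 : Integrable fun z => h z * (w' z * p z) := hwp.integrable_mul hhi
  have i3 : Integrable fun z => cv k h z * (w' z * p z) := hwp.integrable_mul hki
  have i4 : Integrable fun z => g z * cv k p z := (hgB.mul hkpB).integrable
  have i5 : Integrable fun z => h z * (w' z * cv k p z) := hwkp.integrable_mul hhi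
  have i6 : Integrable fun z => cv k g z * p z := ((hgB.cv K.FBk).mul hp).integrable
  have e1 : ∫ z, (cyl N R T).indicator (molW ρ R₁ T M k) z * (w z * p z) =
      (∫ z, g z * p z) + (∫ z, h z * (w' z * p z)) + ∫ z, cv k h z * (w' z * p z) := by
    have i12 : Integrable fun z => g z * p z + h z * (w' z * p z) := i1.add i2
    rw [← integral_add i1 i2, ← integral_add i12 i3]
    refine integral_congr_ae (Eventually.of_forall fun z => ?_)
    simp only
    by_cases hz : z ∈ cyl N R T
    · have hz1 := cyl_mono (T := T) hR hz
      have := hD z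
      rw [indicator_of_mem hz1] at this
      rw [indicator_of_mem hz, molW, ← hh, ← mul_assoc (h z), ← add_mul, ← this, hw',
        indicator_of_mem hz1]
      ring
    · simp [hz, hpR z hz]
  have e2 : ∫ z, cv k ((cyl N R₁ T).indicator (fun z => ρ z.1 * w z)) z * p z =
      (∫ z, cv k g z * p z) + ∫ z, h z * (w' z * cv k p z) := by
    rw [cv_symm (H.integrable_ρw R₁) hp.meas hC, cv_symm hgB.integrable hp.meas hC, K.ksymm,
      ← integral_add i4 i5]
    refine integral_congr_ae (Eventually.of_forall fun z => ?_)
    simp only [hD]; ring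
  have hpa := hp.abs
  have hkpa := hpa.cv K.FBk
  have ia1 : Integrable fun z => h z * |p z| := hpa.integrable_mul hhi
  have ia2 : Integrable fun z => cv k h z * |p z| := hpa.integrable_mul hki
  have ia3 : Integrable fun z => h z * cv k (fun z => |p z|) z := hkpa.integrable_mul hhi
  have hk0 : ∀ z, 0 ≤ cv k h z := cv_nonneg H.highW_nonneg
  have e3 : ∫ z, h z * cv k (fun z => |p z|) z = ∫ z, cv k h z * |p z| := by
    rw [cv_symm hhi hpa.meas (C := C) (fun z => by rw [abs_abs]; exact hC z), K.ksymm]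
  have b1 : (∫ z, g z * p z) - ∫ z, cv k g z * p z ≤ ∫ z, |g z - cv k g z| * |p z| := by
    rw [← integral_sub i1 i6]
    refine integral_mono (i1.sub i6) ((hgB.sub (hgB.cv K.FBk)).abs.mul hpa).integrable
      fun z => ?_
    rw [← abs_mul, sub_mul]
    exact le_abs_self _
  have b2 : ∫ z, h z * (w' z * p z) ≤ W * ∫ z, h z * |p z| := by
    rw [← integral_const_mul]
    refine integral_mono i2 (ia1.const_mul W) fun z => ?_
    have h1 : w' z * p z ≤ W * |p z| := (le_abs_self _).trans (by
      rw [abs_mul]; exact mul_le_mul_of_nonneg_right (hw'W z) (abs_nonneg _))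
    have := mul_le_mul_of_nonneg_left h1 (H.highW_nonneg (R := R₁) (M := M) z)
    simp only [← hh] at this ⊢
    linarith
  have b3 : ∫ z, cv k h z * (w' z * p z) ≤ W * ∫ z, cv k h z * |p z| := by
    rw [← integral_const_mul]
    refine integral_mono i3 (ia2.const_mul W) fun z => ?_
    have h1 : w' z * p z ≤ W * |p z| := (le_abs_self _).trans (by
      rw [abs_mul]; exact mul_le_mul_of_nonneg_right (hw'W z) (abs_nonneg _))
    have := mul_le_mul_of_nonneg_left h1 (hk0 z)
    simp only
    linarith
  have b4 : -∫ z, h z * (w' z * cv k p z) ≤ W * ∫ z, cv k h z * |p z| := by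
    rw [← e3, ← integral_const_mul, ← integral_neg]
    refine integral_mono i5.neg (ia3.const_mul W) fun z => ?_
    have h0 : |cv k p z| ≤ cv k (fun z => |p z|) z := abs_integral_le_integral_abs
    have h1 : -(w' z * cv k p z) ≤ W * cv k (fun z => |p z|) z := (neg_le_abs _).trans (by
      rw [abs_mul]; exact mul_le_mul (hw'W z) h0 (abs_nonneg _) hW0)
    have := mul_le_mul_of_nonneg_left h1 (H.highW_nonneg (R := R₁) (M := M) z)
    simp only [← hh] at this ⊢
    linarith
  have e4 : ∫ z, (h z + cv k h z) * |p z| = (∫ z, h z * |p z|) + ∫ z, cv k h z * |p z| := by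
    rw [← integral_add ia1 ia2]
    congr 1; ext z; ring
  have p1 : 0 ≤ ∫ z, h z * |p z| :=
    integral_nonneg fun z => mul_nonneg (H.highW_nonneg z) (abs_nonneg _)
  rw [e1, e2, e4]
  have := mul_nonneg hW0 p1
  linarith

end

section

variable {N : ℕ} {ρ : Eu N → ℝ} {T : ℝ} {w a : Eu N × ℝ → ℝ} {w₀ : Eu N → ℝ}
  {ε lam R R₁ M W A F c CE δ S : ℝ} {k μ : Measure (Eu N × ℝ)} {p ψ b f G : Eu N × ℝ → ℝ}

theorem CoreHyp.molW_ge (H : CoreHyp ρ T w a w₀) (z : Eu N × ℝ) :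
    ρ z.1 ≤ molW ρ R₁ T M k z :=
  le_add_of_nonneg_right (cv_nonneg H.highW_nonneg z)

theorem CoreHyp.integral_molW_le (H : CoreHyp ρ T w a w₀) (K : Ker ε lam k μ) (hR : R ≤ R₁) :
    ∫ z, (cyl N R T).indicator (molW ρ R₁ T M k) z ≤
      2 * ∫ z, (cyl N R₁ T).indicator (fun z => ρ z.1) z := by
  have := K.prob
  have hρi := integrable_cyl (T := T) (H.ρi R₁)
  have hhi := H.highW_integrable (R := R₁) (M := M)
  have h1 : ∫ z, cv k (highW ρ R₁ T M) z ≤ ∫ z, (cyl N R₁ T).indicator (fun z => ρ z.1) z := by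
    rw [integral_cv hhi]
    simp only [probReal_univ, one_mul]
    exact integral_mono hhi hρi H.highW_le
  have h2 : ∫ z, (cyl N R T).indicator (molW ρ R₁ T M k) z ≤
      ∫ z, ((cyl N R₁ T).indicator (fun z => ρ z.1) z + cv k (highW ρ R₁ T M) z) := by
    refine integral_mono (H.molW_integrable K) (hρi.add (integrable_cv hhi)) fun z => ?_
    have h0 : 0 ≤ cv k (highW ρ R₁ T M) z := cv_nonneg H.highW_nonneg z
    by_cases hz : z ∈ cyl N R T
    · have hz1 := cyl_mono (T := T) hR hz
      simp only [indicator_of_mem hz, indicator_of_mem hz1]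
      exact le_rfl
    · simp only [indicator_of_notMem hz]
      exact add_nonneg (indicator_nonneg (fun z hz => (H.ρ_pos_cyl hz).le) z) h0
  rw [integral_add hρi (integrable_cv hhi)] at h2
  linarith

theorem CoreHyp.dual_L2 (H : CoreHyp ρ T w a w₀) (K : Ker ε lam k μ) (hR : R ≤ R₁)
    (hA : ∀ z ∈ cyl N R₁ T, a z ≤ A) (hf0 : ∀ z, 0 ≤ f z) (hfF : ∀ z, f z ≤ F) (hp : BM p) (hψ : BM ψ) (hbm : Measurable b) {B : ℝ} (hb0 : ∀ z, 0 ≤ b z) (hbB : ∀ z, b z ≤ B)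
    (hσb : ∀ z ∈ cyl N R T, molW ρ R₁ T M k z * b z = a z)
    (hpe : ∀ z, p z = b z * Aop μ lam ψ z + f z) (hE : ∫ z, b z * Aop μ lam ψ z ^ 2 ≤ CE)
    (hA0 : 0 ≤ A) :
    ∫ z, (cyl N R T).indicator (molW ρ R₁ T M k) z * p z ^ 2 ≤
      2 * A * CE + 4 * F ^ 2 * ∫ z, (cyl N R₁ T).indicator (fun z => ρ z.1) z := by
  have hkp := K.prob
  have hσi := H.molW_integrable (R := R) (R₁ := R₁) (M := M) K
  have hAψ := hψ.Aop K.FBm lam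
  have hp2 : BM fun z => p z ^ 2 := by simpa only [pow_two] using hp.mul hp
  have hA2 : BM fun z => Aop μ lam ψ z ^ 2 := by simpa only [pow_two] using hAψ.mul hAψ
  have hbA : BM fun z => b z * Aop μ lam ψ z ^ 2 :=
    hA2.bmul hbm (C := B) fun z => by rw [abs_of_nonneg (hb0 z)]; exact hbB z
  have hF2 : ∀ z, f z ^ 2 ≤ F ^ 2 := fun z => pow_le_pow_left₀ (hf0 z) (hfF z) 2
  have key : ∫ z, (cyl N R T).indicator (molW ρ R₁ T M k) z * p z ^ 2 ≤
      ∫ z, (2 * A * (b z * Aop μ lam ψ z ^ 2) +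
        2 * F ^ 2 * (cyl N R T).indicator (molW ρ R₁ T M k) z) := by
    refine integral_mono (hp2.integrable_mul hσi)
      ((hbA.integrable.const_mul _).add (hσi.const_mul _)) fun z => ?_
    by_cases hz : z ∈ cyl N R T
    · have hz1 := cyl_mono (T := T) hR hz
      simp only [indicator_of_mem hz, hpe z]
      set X := Aop μ lam ψ z
      have hσ0 : 0 ≤ molW ρ R₁ T M k z := (H.ρ_pos_cyl hz).le.trans (H.molW_ge z)
      have e1 := hσb z hz
      set σ := molW ρ R₁ T M k z
      have e2 : σ * (b z * X) ^ 2 = a z * (b z * X ^ 2) := by rw [← e1]; ring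
      have e3 : a z * (b z * X ^ 2) ≤ A * (b z * X ^ 2) :=
        mul_le_mul_of_nonneg_right (hA z hz1) (mul_nonneg (hb0 z) (sq_nonneg _))
      have e4 : σ * f z ^ 2 ≤ σ * F ^ 2 := mul_le_mul_of_nonneg_left (hF2 z) hσ0
      have e5 : σ * (b z * X + f z) ^ 2 ≤ σ * (2 * (b z * X) ^ 2 + 2 * f z ^ 2) :=
        mul_le_mul_of_nonneg_left (by nlinarith [sq_nonneg (b z * X - f z)]) hσ0
      nlinarith
    · simp only [indicator_of_notMem hz, zero_mul, mul_zero, add_zero]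
      have := mul_nonneg (hb0 z) (sq_nonneg (Aop μ lam ψ z))
      positivity
  rw [integral_add (hbA.integrable.const_mul _) (hσi.const_mul _), integral_const_mul,
    integral_const_mul] at key
  have h1 := mul_le_mul_of_nonneg_left hE (show 0 ≤ 2 * A by positivity)
  have h2 := mul_le_mul_of_nonneg_left (H.integral_molW_le (M := M) K hR)
    (show 0 ≤ 2 * F ^ 2 by positivity)
  linarith

/-- The duality estimate for fixed parameters. -/
theorem CoreHyp.duality_estimate (H : CoreHyp ρ T w a w₀) (K : Ker ε lam k μ) (hε : 0 < ε)
    (hR : R + ε ≤ R₁) (hM : 0 ≤ M) (hW0 : 0 ≤ W) (hW : ∀ z ∈ cyl N R₁ T, |w z| ≤ W)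
    (hA : ∀ z ∈ cyl N R₁ T, a z ≤ A) (hA0 : 0 ≤ A) (hc : 0 < c) (hcρ : ∀ x, ‖x‖ < R₁ → c ≤ ρ x)
    (hf : BM f) (hf0 : ∀ z, 0 ≤ f z) (hfF : ∀ z, f z ≤ F) (hfR : ∀ z, z ∉ cyl N R T → f z = 0)
    (hp : BM p) (hψ : BM ψ) (hbm : Measurable b) {B : ℝ} (hb0 : ∀ z, 0 ≤ b z) (hbB : ∀ z, b z ≤ B)
    (hbR : ∀ z, z ∉ cyl N R T → b z = 0)
    (hσb : ∀ z ∈ cyl N R T, molW ρ R₁ T M k z * b z = a z)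
    (hψp : ∀ z, ψ z = timeOp (kbwd T) p z)
    (hpe : ∀ z, p z = b z * Aop μ lam ψ z + f z) (hE : ∫ z, b z * Aop μ lam ψ z ^ 2 ≤ CE)
    (hψ0 : ∀ z, 0 ≤ ψ z) (hψR : ∀ z, R ≤ ‖z.1‖ → ψ z = 0)
    (hψS : ∀ z, R - ε ≤ ‖z.1‖ → ψ z ≤ S) (hS : 0 ≤ S)
    (hG : ∀ r, IntegrableOn G (cyl N r T)) (hG0 : ∀ z, 0 ≤ G z)
    (hwG : ∀ z, z.2 ∈ Ioo 0 T → a z * w z ≤ G z) (hδ : 0 < δ) {Cp : ℝ}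
    (hCp : 2 * A * CE + 4 * F ^ 2 * ∫ z, (cyl N R₁ T).indicator (fun z => ρ z.1) z ≤ Cp) :
    ∫ z, (cyl N R₁ T).indicator (fun z => ρ z.1 * w z) z * f z ≤
      lam * S * (∫ z in cyl N (R + ε) T \ cyl N R T, G z) +
      W * F * (∫ z, highW ρ R₁ T M z) +
      (M * W / δ * (∫ z, |lowPart ρ w R₁ T M z - cv k (lowPart ρ w R₁ T M) z|) +
        δ / 2 * (Cp / c)) +
      2 * W * ((∫ z, highW ρ R₁ T M z) / δ + δ / 2 * Cp) := by
  have hkp := K.prob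
  have hR1 : R ≤ R₁ := by linarith
  have hpR : ∀ z, z ∉ cyl N R T → p z = 0 := fun z hz => by
    rw [hpe, hbR z hz, hfR z hz]; simp
  have hψp' : ψ = timeOp (kbwd T) p := funext hψp
  have hp0 := timeOp_kall_nonneg H.hT hp (fun z => by rw [← hψp]; exact hψ0 z)
  have t1 := H.dual_test K hR hp hpR hp0
  rw [← hψp'] at t1
  have hσi := H.molW_integrable (R := R) (R₁ := R₁) (M := M) K
  have t2 := H.flux_le K hε hR hσi hp hψ hf hσb hpe hψ0 hψR hψS hS hG hG0 hwG
  have t3 := H.commutator_le K hR1 hM hW0 hW hp hpR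
  have t4 := H.dual_L2 K hR1 hA hf0 hfF hp hψ hbm hb0 hbB hσb hpe hE hA0
  replace t4 := t4.trans hCp
  set σ := (cyl N R T).indicator (molW ρ R₁ T M k) with hσdef
  set h := highW ρ R₁ T M with hh
  set g := lowPart ρ w R₁ T M with hg
  have hhi : Integrable h := H.highW_integrable
  have hki : Integrable (cv k h) := integrable_cv hhi
  have hh0 : ∀ z, 0 ≤ h z := H.highW_nonneg
  have hk0 : ∀ z, 0 ≤ cv k h z := cv_nonneg hh0
  have hik : ∫ z, cv k h z = ∫ z, h z := by
    rw [integral_cv hhi]; simp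
  have hgB : BM g := H.BM_lowPart hM hW0 hW
  have hgM : ∀ z, |g z| ≤ M * W := H.lowPart_abs_le hM hW0 hW
  have hwB : BM ((cyl N R₁ T).indicator w) := BM_cyl H.wm hW
  have hp2 : BM fun z => p z ^ 2 := by simpa only [pow_two] using hp.mul hp
  have hσp2 : Integrable fun z => σ z * p z ^ 2 := hp2.integrable_mul hσi
  -- splitting `w (p - f)`
  have j1 : Integrable fun z => σ z * (w z * p z) := by
    refine ((hwB.mul hp).integrable_mul hσi).congr (Eventually.of_forall fun z => ?_)
    by_cases hz : z ∈ cyl N R T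
    · simp only [indicator_of_mem (cyl_mono (T := T) hR1 hz)]
    · simp [hσdef, hz]
  have j2 : Integrable fun z => σ z * (w z * f z) := by
    refine ((hwB.mul hf).integrable_mul hσi).congr (Eventually.of_forall fun z => ?_)
    by_cases hz : z ∈ cyl N R T
    · simp only [indicator_of_mem (cyl_mono (T := T) hR1 hz)]
    · simp [hσdef, hz]
  have s1 : ∫ z, σ z * (w z * (p z - f z)) =
      (∫ z, σ z * (w z * p z)) - ∫ z, σ z * (w z * f z) := by
    rw [← integral_sub j1 j2]; congr 1; ext z; ring
  -- removing the mollified part of the weight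
  have hF0 : 0 ≤ F := (hf0 0).trans (hfF 0)
  have s2 : (∫ z, (cyl N R₁ T).indicator (fun z => ρ z.1 * w z) z * f z) - W * F * ∫ z, h z ≤
      ∫ z, σ z * (w z * f z) := by
    have i1 : Integrable fun z => (cyl N R₁ T).indicator (fun z => ρ z.1 * w z) z * f z :=
      hf.integrable_mul (H.integrable_ρw R₁)
    rw [← hik, ← integral_const_mul, ← integral_sub i1 (hki.const_mul _)]
    refine integral_mono (i1.sub (hki.const_mul _)) j2 fun z => ?_
    by_cases hz : z ∈ cyl N R T
    · have hz1 := cyl_mono (T := T) hR1 hz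
      simp only [hσdef, indicator_of_mem hz, indicator_of_mem hz1, molW, ← hh]
      have h1 : -(w z * f z) ≤ W * F := (neg_le_abs _).trans (by
        rw [abs_mul, abs_of_nonneg (hf0 z)]; exact mul_le_mul (hW z hz1) (hfF z) (hf0 z) hW0)
      have := mul_le_mul_of_nonneg_right h1 (hk0 z)
      linarith
    · simp only [hfR z hz, mul_zero, zero_sub, hσdef, indicator_of_notMem hz]
      have := mul_nonneg (mul_nonneg hW0 hF0) (hk0 z)
      linarith
  -- Young's inequality
  have hp2c : ∫ z, p z ^ 2 ≤ Cp / c := by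
    rw [le_div_iff₀ hc]
    refine le_trans ?_ t4
    rw [← integral_mul_const]
    refine integral_mono (hp2.integrable.mul_const c) hσp2 fun z => ?_
    by_cases hz : z ∈ cyl N R T
    · simp only [hσdef, indicator_of_mem hz]
      have : c ≤ molW ρ R₁ T M k z :=
        (hcρ _ ((mem_cyl.1 hz).1.trans_le hR1)).trans (H.molW_ge z)
      have := mul_le_mul_of_nonneg_right this (sq_nonneg (p z))
      linarith
    · simp [hpR z hz]
  have young : ∀ s : ℝ, 0 ≤ s → s ≤ 1 / (2 * δ) + δ / 2 * s ^ 2 := fun s _ => by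
    have : 1 / (2 * δ) + δ / 2 * s ^ 2 - s = (1 - δ * s) ^ 2 / (2 * δ) := by field_simp; ring
    have h2 : 0 ≤ (1 - δ * s) ^ 2 / (2 * δ) := by positivity
    linarith
  have hdB := (hgB.sub (hgB.cv K.FBk)).abs
  have s3 : ∫ z, |g z - cv k g z| * |p z| ≤
      M * W / δ * (∫ z, |g z - cv k g z|) + δ / 2 * (Cp / c) := by
    have i2 : Integrable fun z => M * W / δ * |g z - cv k g z| := hdB.integrable.const_mul _
    have i3 : Integrable fun z => δ / 2 * p z ^ 2 := hp2.integrable.const_mul _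
    have : ∫ z, |g z - cv k g z| * |p z| ≤
        ∫ z, (M * W / δ * |g z - cv k g z| + δ / 2 * p z ^ 2) := by
      refine integral_mono (hdB.mul hp.abs).integrable (i2.add i3) fun z => ?_
      have h1 : |cv k g z| ≤ M * W := by simpa using cv_abs_le (m := k) hgM z
      have h2 : |g z - cv k g z| ≤ 2 * (M * W) := by
        have := abs_sub (g z) (cv k g z)
        linarith [hgM z]
      simp only
      rw [← sq_abs (p z)]
      set d := |g z - cv k g z|
      set s := |p z|
      have hd0 : 0 ≤ d := abs_nonneg _
      have h3 : d * s ≤ d ^ 2 / (2 * δ) + δ / 2 * s ^ 2 := by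
        have : d ^ 2 / (2 * δ) + δ / 2 * s ^ 2 - d * s = (d - δ * s) ^ 2 / (2 * δ) := by
          field_simp; ring
        have h2 : 0 ≤ (d - δ * s) ^ 2 / (2 * δ) := by positivity
        linarith
      have h4 : d ^ 2 / (2 * δ) ≤ M * W / δ * d := by
        rw [div_le_iff₀ (by positivity)]
        have : M * W / δ * d * (2 * δ) = 2 * (M * W) * d := by field_simp
        rw [this, pow_two]
        exact mul_le_mul_of_nonneg_right h2 hd0
      linarith
    rw [integral_add i2 i3, integral_const_mul, integral_const_mul] at this
    have := mul_le_mul_of_nonneg_left hp2c (show 0 ≤ δ / 2 by positivity)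
    linarith
  have s4 : ∫ z, (h z + cv k h z) * |p z| ≤ (∫ z, h z) / δ + δ / 2 * Cp := by
    have i2 : Integrable fun z => 1 / (2 * δ) * (h z + cv k h z) := (hhi.add hki).const_mul _
    have i3 : Integrable fun z => δ / 2 * (σ z * p z ^ 2) := hσp2.const_mul _
    have : ∫ z, (h z + cv k h z) * |p z| ≤
        ∫ z, (1 / (2 * δ) * (h z + cv k h z) + δ / 2 * (σ z * p z ^ 2)) := by
      refine integral_mono (hp.abs.integrable_mul (hhi.add hki)) (i2.add i3) fun z => ?_
      have hθ : 0 ≤ h z + cv k h z := add_nonneg (hh0 z) (hk0 z)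
      simp only
      by_cases hz : z ∈ cyl N R T
      · have h1 : h z + cv k h z ≤ σ z := by
          simp only [hσdef, indicator_of_mem hz, molW, ← hh]
          have := H.highW_le (R := R₁) (M := M) z
          rw [indicator_of_mem (cyl_mono (T := T) hR1 hz)] at this
          linarith
        have h2 := mul_le_mul_of_nonneg_left (young |p z| (abs_nonneg _)) hθ
        rw [sq_abs] at h2
        have h3 := mul_le_mul_of_nonneg_right h1 (sq_nonneg (p z))
        have h4 := mul_le_mul_of_nonneg_left h3 (show 0 ≤ δ / 2 by positivity)
        linarith
      · rw [hpR z hz]; simp only [abs_zero, mul_zero, ne_eq, OfNat.ofNat_ne_zero,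
          not_false_iff, zero_pow, add_zero]
        exact mul_nonneg (by positivity) hθ
    rw [integral_add i2 i3, integral_const_mul, integral_const_mul, integral_add hhi hki, hik]
      at this
    have h5 := mul_le_mul_of_nonneg_left t4 (show 0 ≤ δ / 2 by positivity)
    have h6 : 1 / (2 * δ) * ((∫ z, h z) + ∫ z, h z) = (∫ z, h z) / δ := by field_simp; ring
    linarith
  have s5 := mul_le_mul_of_nonneg_left s4 (show 0 ≤ 2 * W by positivity)
  linarith

end

section

variable {N : ℕ} {ρ : Eu N → ℝ} {T : ℝ} {w a : Eu N × ℝ → ℝ} {w₀ : Eu N → ℝ}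
  {f G : Eu N × ℝ → ℝ}

theorem mul_div_add_one_le {x e : ℝ} (hx : 0 ≤ x) (he : 0 ≤ e) : x * (e / (x + 1)) ≤ e := by
  rw [mul_div_assoc', div_le_iff₀ (by positivity)]
  nlinarith

/-- One of `n` consecutive shells carries at most the average mass. -/
theorem exists_thin_shell (hG : ∀ r, IntegrableOn G (cyl N r T)) (hG0 : ∀ z, 0 ≤ G z)
    {R₀ : ℝ} (hR₀ : 0 < R₀) {n : ℕ} (hn : 0 < n) :
    ∃ R, R₀ ≤ R ∧ R + R₀ / n ≤ 2 * R₀ ∧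
      ∫ z in cyl N (R + R₀ / n) T \ cyl N R T, G z ≤ (∫ z in cyl N (2 * R₀) T, G z) / n := by
  have hn' : (0 : ℝ) < n := by exact_mod_cast hn
  have hε : 0 < R₀ / n := by positivity
  set r : ℕ → ℝ := fun j => R₀ + j * (R₀ / n) with hr
  set Φ : ℕ → ℝ := fun j => ∫ z in cyl N (r j) T, G z with hΦ
  have hstep : ∀ j, r (j + 1) = r j + R₀ / n := fun j => by simp only [hr]; push_cast; ring
  have hshell : ∀ j, ∫ z in cyl N (r j + R₀ / n) T \ cyl N (r j) T, G z = Φ (j + 1) - Φ j := by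
    intro j
    rw [setIntegral_sdiff (cyl_measurable _ _ _) (hG _) (cyl_mono (by linarith)), hΦ]
    simp only [hstep]
  have hlast : r n = 2 * R₀ := by simp only [hr]; field_simp; ring
  have hsum : ∑ j ∈ Finset.range n, (Φ (j + 1) - Φ j) ≤
      ∑ _j ∈ Finset.range n, (∫ z in cyl N (2 * R₀) T, G z) / n := by
    rw [Finset.sum_range_sub, Finset.sum_const, Finset.card_range, nsmul_eq_mul,
      mul_div_cancel₀ _ hn'.ne']
    simp only [hΦ, hlast]
    have : 0 ≤ ∫ z in cyl N (r 0) T, G z := integral_nonneg hG0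
    linarith
  obtain ⟨j, hj, hle⟩ := Finset.exists_le_of_sum_le (Finset.nonempty_range_iff.2 hn.ne') hsum
  refine ⟨r j, ?_, ?_, ?_⟩
  · simp only [hr]
    have : (0 : ℝ) ≤ j * (R₀ / n) := by positivity
    linarith
  · rw [← hstep, ← hlast]
    have : ((j + 1 : ℕ) : ℝ) ≤ n := by exact_mod_cast Finset.mem_range.1 hj
    have := mul_le_mul_of_nonneg_right this hε.le
    simp only [hr]
    linarith
  · rw [hshell]; exact hle

theorem CoreHyp.radius_estimate (hN : 3 ≤ N) (H : CoreHyp ρ T w a w₀)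
    (hf : ContDiff ℝ (⊤ : ℕ∞) f) (hfc : HasCompactSupport f) (hf0 : ∀ z, 0 ≤ f z)
    (hfT : ∀ z, z.2 ∉ Ioo 0 T → f z = 0)
    (hG : ∀ r, IntegrableOn G (cyl N r T)) (hG0 : ∀ z, 0 ≤ G z)
    (hwG : ∀ z, z.2 ∈ Ioo 0 T → a z * w z ≤ G z) :
    ∃ C R : ℝ, 0 < R ∧ ∀ R₀, R ≤ R₀ →
      ∫ z, ρ z.1 * w z * f z ≤ C * ((∫ z in cyl N (2 * R₀) T, G z) / R₀ ^ N) := by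
  obtain ⟨C, Rm, CE, hC, hRm, hCE, hfR, hdual⟩ := dual_solution hN H.hT hf hfc hf0
  obtain ⟨L, hL, hker⟩ := exists_ker N
  refine ⟨L * C, Rm, hRm, fun R₀ hR₀ => le_of_forall_pos_le_add fun e' he' => ?_⟩
  set e := e' / 3 with he
  have he0 : 0 < e := by positivity
  have hR₀p : 0 < R₀ := hRm.trans_le hR₀
  have hfB := BM.of_continuous hf.continuous hfc
  obtain ⟨F, hF⟩ := hfB.bdd
  have hfF : ∀ z, f z ≤ F := fun z => (le_abs_self _).trans (hF z)
  have hF0 : 0 ≤ F := (hf0 0).trans (hfF 0)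
  set R₁ := 3 * R₀ with hR₁
  obtain ⟨W', hW'⟩ := H.wb R₁
  obtain ⟨A', hA'⟩ := H.ab R₁
  obtain ⟨c, hc, hcρ⟩ := H.ρpos R₁
  set W := |W'| with hWdef
  set A := |A'| with hAdef
  have hW : ∀ z ∈ cyl N R₁ T, |w z| ≤ W := fun z hz => (hW' z hz).trans (le_abs_self _)
  have hA : ∀ z ∈ cyl N R₁ T, a z ≤ A := fun z hz => (hA' z hz).trans (le_abs_self _)
  have hW0 : 0 ≤ W := abs_nonneg _
  have hA0 : 0 ≤ A := abs_nonneg _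
  set Iρ := ∫ z, (cyl N R₁ T).indicator (fun z => ρ z.1) z with hIρ
  have hIρ0 : 0 ≤ Iρ :=
    integral_nonneg fun z => indicator_nonneg (fun z hz => (H.ρ_pos_cyl hz).le) z
  set Cp := 2 * A * CE + 4 * F ^ 2 * Iρ with hCp
  have hCp0 : 0 ≤ Cp := by positivity
  set D := Cp / (2 * c) + W * Cp with hD
  have hD0 : 0 ≤ D := by positivity
  set δ := e / (D + 1) with hδdef
  have hδ : 0 < δ := by positivity
  have hδe : δ * D ≤ e := by
    rw [mul_comm]
    exact mul_div_add_one_le hD0 he0.le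
  set Q := W * F + 2 * W / δ with hQ
  have hQ0 : 0 ≤ Q := by positivity
  obtain ⟨M, hM, hHM⟩ := ((eventually_ge_atTop (0 : ℝ)).and ((H.highW_tendsto R₁).eventually
    (eventually_le_nhds (show 0 < e / (Q + 1) by positivity)))).exists
  have hHe : Q * ∫ z, highW ρ R₁ T M z ≤ e := by
    exact (mul_le_mul_of_nonneg_left hHM hQ0).trans (mul_div_add_one_le hQ0 he0.le)
  obtain ⟨ε₀, hε₀, happ⟩ := cv_approx (H.BM_lowPart hM hW0 hW).integrable
    (show 0 < e / (M * W / δ + 1) by positivity)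
  set n := ⌈R₀ / ε₀⌉₊ + 2 with hn
  have hn0 : 0 < n := by omega
  have hn' : (0 : ℝ) < n := by exact_mod_cast hn0
  set ε := R₀ / n with hε
  have hεp : 0 < ε := by positivity
  have hn2 : (2 : ℝ) ≤ n := by rw [hn]; push_cast; linarith [Nat.cast_nonneg (α := ℝ) ⌈R₀ / ε₀⌉₊]
  have hεR : ε ≤ R₀ / 2 := div_le_div_of_nonneg_left hR₀p.le (by norm_num) hn2
  have hεε₀ : ε ≤ ε₀ := by
    rw [hε, div_le_iff₀ hn']
    have h1 : R₀ / ε₀ ≤ n := (Nat.le_ceil _).trans (by rw [hn]; push_cast; linarith)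
    rw [div_le_iff₀ hε₀] at h1
    linarith
  obtain ⟨R, hR₀R, hRε, hshell⟩ := exists_thin_shell (N := N) (T := T) hG hG0 hR₀p hn0
  rw [← hε] at hRε hshell
  obtain ⟨k, μ, K⟩ := hker ε hεp
  have hkp := K.prob
  have hRR₁ : R + ε ≤ R₁ := by linarith
  have hηk := happ k hkp (by
    filter_upwards [K.ksupp] with q hq
    rw [Prod.norm_def, hq.2, norm_zero]
    exact max_le (hq.1.trans hεε₀) hε₀.le)
  have hηe : M * W / δ * ∫ z, |lowPart ρ w R₁ T M z - cv k (lowPart ρ w R₁ T M) z| ≤ e := by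
    have h0 : 0 ≤ M * W / δ := by positivity
    exact (mul_le_mul_of_nonneg_left hηk h0).trans (mul_div_add_one_le h0 he0.le)
  have hσc : ∀ z ∈ cyl N R T, c ≤ molW ρ R₁ T M k z := fun z hz =>
    (hcρ _ ((mem_cyl.1 hz).1.trans (by linarith))).trans (H.molW_ge z)
  set b := (cyl N R T).indicator fun z => a z / molW ρ R₁ T M k z with hb
  have hbm : Measurable b :=
    (H.am.div ((H.ρm.comp measurable_fst).add (cv_measurable H.highW_measurable))).indicator
      (cyl_measurable N R T)
  have hb0 : ∀ z, 0 ≤ b z :=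
    indicator_nonneg fun z hz => div_nonneg (H.a0 z) (hc.le.trans (hσc z hz))
  have hbB : ∀ z, b z ≤ A / c := by
    intro z
    refine indicator_apply_le' (fun hz => ?_) fun _ => by positivity
    exact div_le_div₀ hA0 (hA z (cyl_mono (by linarith) hz)) hc (hσc z hz)
  have hbR : ∀ z, z ∉ cyl N R T → b z = 0 := fun z hz => indicator_of_notMem hz _
  obtain ⟨p, ψ, hp, hψ, hψp, hpe, hψ0, hψR, -, hψS, hE⟩ :=
    hdual R₀ R ε (L / ε ^ 2) k μ hR₀ hR₀R (by linarith) hεp hεR K b (A / c) hbm hb0 hbB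
      fun z hz => hbR z fun h => absurd (mem_cyl.1 h).1 (not_lt.2 hz)
  have hfcyl : ∀ z, z ∉ cyl N R T → f z = 0 := by
    intro z hz
    by_cases ht : z.2 ∈ Ioo 0 T
    · exact hfR z (by
        by_contra hcon
        exact hz (mem_cyl.2 ⟨(not_le.1 hcon).trans_le (hR₀.trans hR₀R), ht⟩))
    · exact hfT z ht
  have main := H.duality_estimate K hεp hRR₁ hM hW0 hW hA hA0 hc hcρ hfB hf0 hfF hfcyl hp hψ hbm
    hb0 hbB hbR (fun z hz => by
      rw [hb, indicator_of_mem hz]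
      exact mul_div_cancel₀ _ (hc.trans_le (hσc z hz)).ne') hψp hpe hE hψ0 hψR hψS
    (by positivity) hG hG0 hwG hδ hCp.ge
  have hlhs : ∫ z, (cyl N R₁ T).indicator (fun z => ρ z.1 * w z) z * f z =
      ∫ z, ρ z.1 * w z * f z := by
    congr 1; ext z
    by_cases hz : z ∈ cyl N R₁ T
    · rw [indicator_of_mem hz]
    · rw [hfcyl z fun h => hz (cyl_mono (by linarith) h)]; simp
  rw [hlhs] at main
  have hflux : L / ε ^ 2 * (C * ε * R₀ / R₀ ^ N) *
      (∫ z in cyl N (R + ε) T \ cyl N R T, G z) ≤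
      L * C * ((∫ z in cyl N (2 * R₀) T, G z) / R₀ ^ N) := by
    refine (mul_le_mul_of_nonneg_left hshell (by positivity)).trans (le_of_eq ?_)
    rw [hε]; field_simp
  have e1 : δ / 2 * (Cp / c) + W * δ * Cp = δ * D := by rw [hD]; field_simp
  have e2 : W * F * (∫ z, highW ρ R₁ T M z) + 2 * W * ((∫ z, highW ρ R₁ T M z) / δ) =
      Q * ∫ z, highW ρ R₁ T M z := by rw [hQ]; ring
  have e3 : e' = e + e + e := by rw [he]; ring
  linarith

theorem CoreHyp.integral_nonpos (hN : 3 ≤ N) (H : CoreHyp ρ T w a w₀)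
    (hf : ContDiff ℝ (⊤ : ℕ∞) f) (hfc : HasCompactSupport f) (hf0 : ∀ z, 0 ≤ f z)
    (hfT : ∀ z, z.2 ∉ Ioo 0 T → f z = 0)
    (hG : ∀ r, IntegrableOn G (cyl N r T)) (hG0 : ∀ z, 0 ≤ G z)
    (hwG : ∀ z, z.2 ∈ Ioo 0 T → a z * w z ≤ G z)
    (hGlim : Tendsto (fun R : ℝ => (∫ z in cyl N R T, G z) / R ^ N) atTop (𝓝 0)) :
    ∫ z, ρ z.1 * w z * f z ≤ 0 := by
  obtain ⟨C, R, hR, h⟩ := H.radius_estimate hN hf hfc hf0 hfT hG hG0 hwG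
  have h1 : Tendsto (fun R : ℝ => C * 2 ^ N * ((∫ z in cyl N (2 * R) T, G z) / (2 * R) ^ N)) atTop
      (𝓝 (C * 2 ^ N * 0)) :=
    (hGlim.comp (tendsto_id.const_mul_atTop (by norm_num : (0 : ℝ) < 2))).const_mul _
  rw [mul_zero] at h1
  refine ge_of_tendsto h1 ?_
  filter_upwards [eventually_ge_atTop R] with R₀ hR₀
  refine (h R₀ hR₀).trans (le_of_eq ?_)
  have : 0 < R₀ := hR.trans_le hR₀
  rw [mul_pow]; field_simp

/-- Comparison for the linear problem. -/
theorem CoreHyp.nonpos (hN : 3 ≤ N) (H : CoreHyp ρ T w a w₀)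
    (hG : ∀ r, IntegrableOn G (cyl N r T)) (hG0 : ∀ z, 0 ≤ G z)
    (hwG : ∀ z, z.2 ∈ Ioo 0 T → a z * w z ≤ G z)
    (hGlim : Tendsto (fun R : ℝ => (∫ z in cyl N R T, G z) / R ^ N) atTop (𝓝 0)) :
    ∀ᵐ z, z ∈ (univ : Set (Eu N)) ×ˢ Ioo 0 T → w z ≤ 0 := by
  let φ : ℕ → ContDiffBump (0 : Eu N × ℝ) := fun n =>
    ⟨1 / ((n : ℝ) + 1), 2 * (1 / ((n : ℝ) + 1)), by positivity, by
      have : 0 < 1 / ((n : ℝ) + 1) := by positivity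
      linarith⟩
  have hφ : Tendsto (fun n => (φ n).rOut) atTop (𝓝 0) := by
    have h := (tendsto_one_div_add_atTop_nhds_zero_nat (𝕜 := ℝ)).const_mul 2
    rwa [mul_zero] at h
  have key : ∀ n : ℕ, ∀ᵐ z, z ∈ cyl N n T → w z ≤ 0 := by
    intro n
    have hi := (H.integrable_ρw (n : ℝ)).locallyIntegrable
    filter_upwards [ContDiffBump.ae_convolution_tendsto_right_of_locallyIntegrable hφ (K := 2)
      (Eventually.of_forall fun i => le_rfl) hi] with z hz hzc
    have ho : IsOpen (cyl N n T) := isOpen_ball.prod isOpen_Ioo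
    obtain ⟨r, hr, hrs⟩ := Metric.isOpen_iff.1 ho z hzc
    have hle : (cyl N n T).indicator (fun z => ρ z.1 * w z) z ≤ 0 := by
      refine le_of_tendsto hz ?_
      filter_upwards [hφ.eventually (gt_mem_nhds (half_pos hr))] with i hi'
      have hsupp : ∀ t, t ∉ closedBall z (φ i).rOut → (φ i).normed volume (z - t) = 0 := by
        intro t ht
        have : z - t ∉ Function.support ((φ i).normed volume) := by
          rw [(φ i).support_normed_eq]
          simp only [mem_ball, dist_zero_right, mem_closedBall, not_le, not_lt] at ht ⊢
          rw [dist_comm, dist_eq_norm] at ht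
          exact ht.le
        exact Function.notMem_support.1 this
      have hcs : closedBall z (φ i).rOut ⊆ cyl N n T :=
        (closedBall_subset_ball (by linarith)).trans hrs
      have h_int := H.integral_nonpos hN (f := fun t => (φ i).normed volume (z - t))
        ((φ i).contDiff_normed.comp (contDiff_const.sub contDiff_id))
        (HasCompactSupport.intro (isCompact_closedBall z (φ i).rOut) hsupp)
        (fun t => (φ i).nonneg_normed _)
        (fun t ht => hsupp t fun h => ht (mem_cyl.1 (hcs h)).2) hG hG0 hwG hGlim
      rw [convolution_eq_swap]
      refine le_trans (le_of_eq ?_) h_int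
      congr 1; ext t
      by_cases ht : t ∈ cyl N n T
      · simp [indicator_of_mem ht, mul_comm]
      · simp [hsupp t fun h => ht (hcs h)]
    rw [indicator_of_mem hzc] at hle
    have hρp : 0 < ρ z.1 := by
      obtain ⟨c, hc, h⟩ := H.ρpos n
      exact hc.trans_le (h _ (mem_cyl.1 hzc).1)
    by_contra hcon
    exact absurd (mul_pos hρp (not_le.1 hcon)) (not_lt.2 hle)
  filter_upwards [ae_all_iff.2 key] with z hz hzT
  obtain ⟨n, hn⟩ := exists_nat_gt ‖z.1‖
  exact hz n (mem_cyl.2 ⟨hn, hzT.2⟩)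

end

/-- A locally bounded distributional solution of `ρ y_t = ΔY` on `ℝ^N × (0,T)` with initial
trace `y₀`. -/
structure TraceSol {N : ℕ} (ρ : Eu N → ℝ) (T : ℝ) (y Y : Eu N × ℝ → ℝ) (y₀ : Eu N → ℝ) :
    Prop where
  ym : Measurable y
  Ym : Measurable Y
  y0m : Measurable y₀
  yb : ∀ R, ∃ W, ∀ z ∈ cyl N R T, |y z| ≤ W
  Yb : ∀ R, ∃ W, ∀ z ∈ cyl N R T, |Y z| ≤ W
  y0i : ∀ R, IntegrableOn (fun x => ρ x * y₀ x) (ball 0 R)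
  trace : ∀ R : ℝ, Tendsto
    (fun ε : ℝ => ε⁻¹ * ∫ z in (ball (0 : Eu N) R) ×ˢ Ioo 0 ε, |y z - y₀ z.1| * ρ z.1)
    (𝓝[>] 0) (𝓝 0)
  weak0 : ∀ g : Eu N × ℝ → ℝ, ContDiff ℝ (⊤ : ℕ∞) g → HasCompactSupport g →
    tsupport g ⊆ univ ×ˢ Ioo 0 T →
    ∫ z in univ ×ˢ Ioo 0 T, (y z * ρ z.1 * ptder g z + Y z * lapX g z) = 0

section

variable {N : ℕ} {ρ : Eu N → ℝ} {T : ℝ} {y Y g : Eu N × ℝ → ℝ} {y₀ : Eu N → ℝ} {η : ℝ → ℝ}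

theorem fderiv_mul_time {z : Eu N × ℝ} (hg : DifferentiableAt ℝ g z)
    (hη : DifferentiableAt ℝ η z.2) (v : Eu N × ℝ) :
    fderiv ℝ (fun z => g z * η z.2) z v = fderiv ℝ g z v * η z.2 + g z * (deriv η z.2 * v.2) := by
  have h1 : HasFDerivAt (fun z : Eu N × ℝ => η z.2)
      ((deriv η z.2) • ContinuousLinearMap.snd ℝ (Eu N) ℝ) z :=
    hη.hasDerivAt.comp_hasFDerivAt z hasFDerivAt_snd
  have h2 : HasFDerivAt (fun z => g z * η z.2) _ z := hg.hasFDerivAt.mul h1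
  rw [h2.fderiv]
  simp
  ring

theorem ptder_mul_time (hg : ContDiff ℝ (⊤ : ℕ∞) g) (hη : ContDiff ℝ (⊤ : ℕ∞) η)
    (z : Eu N × ℝ) :
    ptder (fun z => g z * η z.2) z = ptder g z * η z.2 + g z * deriv η z.2 := by
  rw [ptder, fderiv_mul_time (hg.differentiable (by simp) _) (hη.differentiable (by simp) _)]
  simp [ptder]

theorem lapX_mul_time (hg : ContDiff ℝ (⊤ : ℕ∞) g) (hη : ContDiff ℝ (⊤ : ℕ∞) η)
    (z : Eu N × ℝ) :
    lapX (fun z => g z * η z.2) z = lapX g z * η z.2 := by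
  unfold lapX
  rw [Finset.sum_mul]
  refine Finset.sum_congr rfl fun i _ => ?_
  have h1 : (fun q => fderiv ℝ (fun z => g z * η z.2) q (EuclideanSpace.single i 1, 0)) =
      fun q => fderiv ℝ g q (EuclideanSpace.single i 1, 0) * η q.2 := by
    ext q
    rw [fderiv_mul_time (hg.differentiable (by simp) _) (hη.differentiable (by simp) _)]
    simp
  rw [h1]
  have h2 : ContDiff ℝ (⊤ : ℕ∞) (fun q => fderiv ℝ g q (EuclideanSpace.single i 1, 0)) :=
    hg.fderiv_right (m := (⊤ : ℕ∞)) (by simp) |>.clm_apply contDiff_const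
  rw [fderiv_mul_time (h2.differentiable (by simp) _) (hη.differentiable (by simp) _)]
  simp

theorem exists_time_cutoff : ∃ (η : ℝ → ℝ) (C : ℝ), ContDiff ℝ (⊤ : ℕ∞) η ∧ 0 ≤ C ∧
    (∀ t, 0 ≤ η t ∧ η t ≤ 1) ∧ (∀ t ≤ 0, η t = 0) ∧ (∀ t, 1 ≤ t → η t = 1) ∧
    (∀ t, |deriv η t| ≤ C) ∧ ∀ t, 1 < t → deriv η t = 0 := by
  have hs : ContDiff ℝ (⊤ : ℕ∞) Real.smoothTransition := Real.smoothTransition.contDiff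
  have hd1 : ∀ t : ℝ, 1 < t → deriv Real.smoothTransition t = 0 := by
    intro t ht
    have : Real.smoothTransition =ᶠ[𝓝 t] fun _ => 1 := by
      filter_upwards [lt_mem_nhds ht] with s hs
      exact Real.smoothTransition.one_of_one_le hs.le
    rw [this.deriv_eq, deriv_const]
  have hd0 : ∀ t : ℝ, t < 0 → deriv Real.smoothTransition t = 0 := by
    intro t ht
    have : Real.smoothTransition =ᶠ[𝓝 t] fun _ => 0 := by
      filter_upwards [gt_mem_nhds ht] with s hs
      exact Real.smoothTransition.zero_of_nonpos hs.le
    rw [this.deriv_eq, deriv_const]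
  obtain ⟨C, hC⟩ := (isCompact_Icc (a := (0 : ℝ)) (b := 1)).exists_bound_of_continuousOn
    (hs.continuous_deriv (by simp)).continuousOn
  refine ⟨Real.smoothTransition, |C|, hs, abs_nonneg _, fun t =>
    ⟨Real.smoothTransition.nonneg t, Real.smoothTransition.le_one t⟩,
    fun t => Real.smoothTransition.zero_of_nonpos, fun t => Real.smoothTransition.one_of_one_le,
    fun t => ?_, hd1⟩
  by_cases h0 : t < 0
  · rw [hd0 t h0]; simp
  by_cases h1 : 1 < t
  · rw [hd1 t h1]; simp
  · exact (hC t ⟨not_lt.1 h0, not_lt.1 h1⟩).trans (le_abs_self C)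

/-- A time derivative integrates to zero against functions of space. -/
theorem integral_mul_ptder_eq_zero {φ : Eu N → ℝ} (hφ : ∀ R, IntegrableOn φ (ball 0 R))
    (hg : ContDiff ℝ (⊤ : ℕ∞) g) (hgc : HasCompactSupport g) :
    ∫ z, φ z.1 * ptder g z = 0 := by
  have hpt : ContDiff ℝ (⊤ : ℕ∞) (ptder g) :=
    hg.fderiv_right (m := (⊤ : ℕ∞)) (by simp) |>.clm_apply contDiff_const
  obtain ⟨R, hR⟩ := hgc.isCompact.isBounded.subset_ball (0 : Eu N × ℝ)
  have hsupp : ∀ z, z ∉ ball (0 : Eu N × ℝ) R → ptder g z = 0 := by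
    intro z hz
    have : fderiv ℝ g z = 0 := by
      by_contra h
      exact hz (hR (support_fderiv_subset ℝ h))
    simp [ptder, this]
  have hptc : HasCompactSupport (ptder g) := by
    refine HasCompactSupport.intro (isCompact_closedBall (0 : Eu N × ℝ) R) fun z hz => ?_
    exact hsupp z fun h => hz (ball_subset_closedBall h)
  obtain ⟨C, hC⟩ := hptc.exists_bound_of_continuous hpt.continuous
  have hi : Integrable (fun z : Eu N × ℝ => φ z.1 * ptder g z) := by
    have h1 : Integrable (fun z : Eu N × ℝ => (ball (0 : Eu N) R).indicator φ z.1 *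
        (Ioo (-R) R).indicator (fun _ => (1 : ℝ)) z.2) :=
      Integrable.mul_prod ((integrable_indicator_iff measurableSet_ball).2 (hφ R))
        ((integrable_indicator_iff measurableSet_Ioo).2 (by simp))
    have h2 := h1.mul_bdd (c := C) hpt.continuous.aestronglyMeasurable
      (Eventually.of_forall hC)
    refine h2.congr (Eventually.of_forall fun z => ?_)
    by_cases hz : z ∈ ball (0 : Eu N × ℝ) R
    · rw [mem_ball_zero_iff, Prod.norm_def, max_lt_iff] at hz
      have h1 : z.1 ∈ ball (0 : Eu N) R := by simpa using hz.1
      have h2 : z.2 ∈ Ioo (-R) R := by simpa [abs_lt] using hz.2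
      simp [h1, h2]
    · simp [hsupp z hz]
  rw [Measure.volume_eq_prod] at hi ⊢
  rw [integral_prod _ hi]
  refine integral_eq_zero_of_ae (Eventually.of_forall fun x => ?_)
  simp only [integral_const_mul, Pi.zero_apply]
  have hcomp : ∀ f : Eu N × ℝ → ℝ, Continuous f → HasCompactSupport f →
      Integrable (fun t : ℝ => f (x, t)) := by
    intro f hf hfc
    refine Continuous.integrable_of_hasCompactSupport (by fun_prop) ?_
    refine HasCompactSupport.intro (hfc.isCompact.image continuous_snd) fun t ht => ?_
    by_contra h
    exact ht ⟨(x, t), subset_tsupport _ h, rfl⟩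
  rw [integral_eq_zero_of_hasDerivAt_of_integrable (f := fun t => g (x, t)) (fun t => ?_)
    (hcomp _ hpt.continuous hptc) (hcomp _ hg.continuous hgc), mul_zero]
  have h1 : HasFDerivAt g (fderiv ℝ g (x, t)) (x, t) :=
    (hg.differentiable (by simp) _).hasFDerivAt
  have h2 : HasDerivAt (fun s : ℝ => (x, s)) ((0 : Eu N), (1 : ℝ)) t :=
    (hasDerivAt_const t x).prodMk (hasDerivAt_id t)
  exact h1.comp_hasDerivAt t h2

theorem setIntegral_slab_eq_cyl {R : ℝ} {F : Eu N × ℝ → ℝ} (hF : ∀ z, R ≤ ‖z.1‖ → F z = 0) :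
    ∫ z in univ ×ˢ Ioo 0 T, F z = ∫ z in cyl N R T, F z := by
  refine setIntegral_eq_of_subset_of_forall_sdiff_eq_zero
    (MeasurableSet.univ.prod measurableSet_Ioo)
    (show cyl N R T ⊆ _ from prod_mono (subset_univ _) Subset.rfl) fun z hz => hF z ?_
  by_contra h
  exact hz.2 (mem_cyl.2 ⟨not_le.1 h, hz.1.2⟩)

variable {R : ℝ}

theorem integrableOn_cyl_of_bounded (hρi : ∀ R, IntegrableOn ρ (ball 0 R)) (hY : Measurable Y)
    {W : ℝ} (hW : ∀ z ∈ cyl N R T, |Y z| ≤ W) :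
    IntegrableOn (fun z => Y z * ρ z.1) (cyl N R T) := by
  rw [← integrable_indicator_iff (cyl_measurable N R T)]
  have h1 := (BM_cyl hY hW).integrable_mul (integrable_cyl (T := T) (hρi R))
  refine h1.congr (Eventually.of_forall fun z => ?_)
  by_cases h : z ∈ cyl N R T <;> simp [h, mul_comm]

theorem TraceSol.integrableOn_y (H : TraceSol ρ T y Y y₀) (hρi : ∀ R, IntegrableOn ρ (ball 0 R))
    (R : ℝ) : IntegrableOn (fun z => (y z - y₀ z.1) * ρ z.1) (cyl N R T) := by
  obtain ⟨W, hW⟩ := H.yb R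
  have h2 : IntegrableOn (fun z => ρ z.1 * y₀ z.1) (cyl N R T) := by
    rw [← integrable_indicator_iff (cyl_measurable N R T)]
    exact integrable_cyl (H.y0i R)
  refine ((integrableOn_cyl_of_bounded hρi H.ym hW).sub h2).congr
    (Eventually.of_forall fun z => ?_)
  simp only [Pi.sub_apply]; ring

theorem TraceSol.integrableOn_Y (H : TraceSol ρ T y Y y₀) (R : ℝ) :
    IntegrableOn Y (cyl N R T) := by
  obtain ⟨W, hW⟩ := H.Yb R
  rw [← integrable_indicator_iff (cyl_measurable N R T)]
  exact (BM_cyl H.Ym hW).integrable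

theorem TraceSol.weak_cutoff (H : TraceSol ρ T y Y y₀) (hρi : ∀ R, IntegrableOn ρ (ball 0 R))
    (hg : ContDiff ℝ (⊤ : ℕ∞) g) (hgc : HasCompactSupport g)
    (hgs : tsupport g ⊆ ball 0 R ×ˢ Ioo 0 T) :
    ∫ z in cyl N R T, ((y z - y₀ z.1) * ρ z.1 * ptder g z + Y z * lapX g z) = 0 := by
  have hpc : Continuous (ptder g) := (contDiff_fderiv_apply hg (0, 1)).continuous
  have hz : ∀ z, z ∉ ball (0 : Eu N) R ×ˢ Ioo 0 T → ptder g z = 0 ∧ lapX g z = 0 := by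
    intro z hz
    exact ⟨image_eq_zero_of_notMem_tsupport fun h => hz (hgs (tsupport_fderiv_apply (0, 1) h)),
      image_eq_zero_of_notMem_tsupport fun h => hz (hgs (tsupport_lapX h))⟩
  have h0 := H.weak0 g hg hgc (hgs.trans (prod_mono (subset_univ _) Subset.rfl))
  rw [setIntegral_slab_eq_cyl (R := R) fun z h => by
    obtain ⟨e1, e2⟩ := hz z fun h' => absurd (mem_ball_zero_iff.1 h'.1) (not_lt.2 h)
    rw [e1, e2]; simp] at h0
  have h1 := integral_mul_ptder_eq_zero H.y0i hg hgc
  rw [← setIntegral_eq_integral_of_forall_compl_eq_zero (s := cyl N R T) fun z h => by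
    rw [(hz z h).1, mul_zero]] at h1
  obtain ⟨Cp, hCp⟩ := (fderiv_apply_hasCompactSupport hgc (0, 1)).exists_bound_of_continuous hpc
  obtain ⟨Cl, hCl⟩ := (lapX_hasCompactSupport hgc).exists_bound_of_continuous
    (lapX_contDiff hg).continuous
  have i1 := (H.integrableOn_y hρi R).mul_bdd (c := Cp) hpc.aestronglyMeasurable
    (Eventually.of_forall hCp)
  have i2 := (H.integrableOn_Y R).mul_bdd (c := Cl)
    (lapX_contDiff hg).continuous.aestronglyMeasurable (Eventually.of_forall hCl)
  have i3 : IntegrableOn (fun z => ρ z.1 * y₀ z.1 * ptder g z) (cyl N R T) := by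
    refine Integrable.mul_bdd (c := Cp) ?_ hpc.aestronglyMeasurable (Eventually.of_forall hCp)
    have : IntegrableOn (fun z : Eu N × ℝ => ρ z.1 * y₀ z.1) (cyl N R T) := by
      rw [← integrable_indicator_iff (cyl_measurable N R T)]
      exact integrable_cyl (H.y0i R)
    exact this
  have h2 : ∫ z in cyl N R T, (((y z - y₀ z.1) * ρ z.1 * ptder g z + Y z * lapX g z) +
      ρ z.1 * y₀ z.1 * ptder g z) = 0 := by
    rw [← h0]
    congr 1; ext z; ring
  have h3 := integral_add (i1.add i2) i3
  simp only [Pi.add_apply] at h3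
  rw [h3, h1, add_zero] at h2
  exact h2

theorem TraceSol.weak (H : TraceSol ρ T y Y y₀) (hT : 0 < T)
    (hρi : ∀ R, IntegrableOn ρ (ball 0 R)) (hρ0 : ∀ x, 0 ≤ ρ x)
    (hg : ContDiff ℝ (⊤ : ℕ∞) g) (hgc : HasCompactSupport g) (hgs : tsupport g ⊆ univ ×ˢ Iio T) :
    ∫ z in univ ×ˢ Ioo 0 T, ((y z - y₀ z.1) * ρ z.1 * ptder g z + Y z * lapX g z) = 0 := by
  obtain ⟨σ, C, hσ, hC0, hσ1, hσ0, hσ2, hσC, hσd⟩ := exists_time_cutoff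
  obtain ⟨R, hR⟩ := hgc.isCompact.isBounded.subset_ball (0 : Eu N × ℝ)
  have hRx : ∀ z ∈ tsupport g, z.1 ∈ ball (0 : Eu N) R := by
    intro z hz
    have := hR hz
    rw [mem_ball_zero_iff, Prod.norm_def, max_lt_iff] at this
    simpa using this.1
  have hpc : Continuous (ptder g) := (contDiff_fderiv_apply hg (0, 1)).continuous
  rw [setIntegral_slab_eq_cyl (R := R) fun z h => by
    have hz : z ∉ tsupport g := fun h' => absurd (mem_ball_zero_iff.1 (hRx z h')) (not_lt.2 h)
    have e1 : lapX g z = 0 := image_eq_zero_of_notMem_tsupport fun h => hz (tsupport_lapX h)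
    have e2 : ptder g z = 0 :=
      image_eq_zero_of_notMem_tsupport fun h => hz (tsupport_fderiv_apply (0, 1) h)
    rw [e1, e2]; simp]
  obtain ⟨Cg, hCg⟩ := hgc.exists_bound_of_continuous hg.continuous
  obtain ⟨Cp, hCp⟩ := (fderiv_apply_hasCompactSupport hgc (0, 1)).exists_bound_of_continuous hpc
  obtain ⟨Cl, hCl⟩ := (lapX_hasCompactSupport hgc).exists_bound_of_continuous
    (lapX_contDiff hg).continuous
  have iy := H.integrableOn_y hρi R
  have i1 := iy.mul_bdd (c := Cp) hpc.aestronglyMeasurable (Eventually.of_forall hCp)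
  have i2 := (H.integrableOn_Y R).mul_bdd (c := Cl)
    (lapX_contDiff hg).continuous.aestronglyMeasurable (Eventually.of_forall hCl)
  have iE := i1.add i2
  set E : Eu N × ℝ → ℝ := fun z => (y z - y₀ z.1) * ρ z.1 * ptder g z + Y z * lapX g z with hE
  let η : ℕ → ℝ → ℝ := fun n t => σ (n * t - 1)
  have hη : ∀ n, ContDiff ℝ (⊤ : ℕ∞) (η n) := fun n => hσ.comp (by fun_prop)
  have hηd : ∀ n t, deriv (η n) t = deriv σ (n * t - 1) * n := by
    intro n t
    have h1 : HasDerivAt (fun t : ℝ => (n : ℝ) * t - 1) ((n : ℝ) * 1) t :=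
      ((hasDerivAt_id t).const_mul (n : ℝ)).sub_const 1
    have h2 : HasDerivAt (η n) _ t :=
      ((hσ.differentiable (by simp) _).hasDerivAt).comp t h1
    rw [h2.deriv, mul_one]
  let J : ℕ → ℝ := fun n => ∫ z in cyl N R T, (y z - y₀ z.1) * ρ z.1 * (g z * deriv (η n) z.2)
  have hsplit : ∀ n : ℕ, 0 < n → (∫ z in cyl N R T, E z * η n z.2) = - J n := by
    intro n hn
    have hn' : (0 : ℝ) < n := by exact_mod_cast hn
    have hts : tsupport (fun z : Eu N × ℝ => g z * η n z.2) ⊆ ball 0 R ×ˢ Ioo 0 T := by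
      have h1 : tsupport (fun z : Eu N × ℝ => g z * η n z.2) ⊆
          tsupport g ∩ {z | 1 / (n : ℝ) ≤ z.2} := by
        refine closure_minimal (fun z hz => ⟨subset_tsupport _ fun h => hz ?_, ?_⟩)
          ((isClosed_tsupport g).inter (isClosed_le continuous_const continuous_snd))
        · simp [h]
        · by_contra h
          refine hz ?_
          have : η n z.2 = 0 := hσ0 _ (by
            have h3 : z.2 < 1 / (n : ℝ) := not_le.1 h
            rw [lt_div_iff₀ hn'] at h3
            linarith)
          simp [this]
      intro z hz
      obtain ⟨h2, h3⟩ := h1 hz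
      exact ⟨hRx z h2, lt_of_lt_of_le (by positivity) h3, (hgs h2).2⟩
    have hηc : Continuous fun z : Eu N × ℝ => η n z.2 := (hη n).continuous.comp continuous_snd
    have h0 := H.weak_cutoff (g := fun z => g z * η n z.2) hρi
      (hg.mul ((hη n).comp contDiff_snd)) hgc.mul_right hts
    have hc' : Continuous fun z : Eu N × ℝ => g z * deriv (η n) z.2 :=
      hg.continuous.mul (((hη n).continuous_deriv (by simp)).comp continuous_snd)
    obtain ⟨C', hC'⟩ := (hgc.mul_right (f' := fun z : Eu N × ℝ =>
      deriv (η n) z.2)).exists_bound_of_continuous hc'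
    have j1 : IntegrableOn (fun z => E z * η n z.2) (cyl N R T) := by
      refine iE.mul_bdd (c := 1) hηc.aestronglyMeasurable (Eventually.of_forall fun z => ?_)
      rw [Real.norm_eq_abs, abs_of_nonneg (hσ1 _).1]
      exact (hσ1 _).2
    have j2 := iy.mul_bdd (c := C') hc'.aestronglyMeasurable (Eventually.of_forall hC')
    rw [eq_neg_iff_add_eq_zero, ← integral_add j1 j2, ← h0]
    congr 1; ext z
    rw [ptder_mul_time hg (hη n), lapX_mul_time hg (hη n), hE]
    ring
  have hlim1 : Tendsto (fun n => ∫ z in cyl N R T, E z * η n z.2) atTop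
      (𝓝 (∫ z in cyl N R T, E z)) := by
    refine tendsto_integral_of_dominated_convergence (fun z => ‖E z‖) (fun n => ?_) iE.norm
      (fun n => Eventually.of_forall fun z => ?_) ?_
    · exact iE.aestronglyMeasurable.mul
        ((hη n).continuous.comp continuous_snd).aestronglyMeasurable
    · rw [norm_mul, Real.norm_eq_abs (η n z.2), abs_of_nonneg (hσ1 _).1]
      exact mul_le_of_le_one_right (norm_nonneg _) (hσ1 _).2
    · filter_upwards [ae_restrict_mem (cyl_measurable N R T)] with z hz
      refine tendsto_const_nhds.congr' ?_
      have hz2 : 0 < z.2 := (mem_cyl.1 hz).2.1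
      filter_upwards [tendsto_natCast_atTop_atTop.eventually_ge_atTop (2 / z.2)] with n hn
      rw [div_le_iff₀ hz2] at hn
      have : η n z.2 = 1 := hσ2 _ (by linarith)
      rw [this, mul_one]
  have h3n : Tendsto (fun n : ℕ => 3 / (n : ℝ)) atTop (𝓝 0) :=
    tendsto_const_div_atTop_nhds_zero_nat 3
  have h3n' : Tendsto (fun n : ℕ => 3 / (n : ℝ)) atTop (𝓝[>] 0) := by
    refine tendsto_nhdsWithin_iff.2 ⟨h3n, ?_⟩
    filter_upwards [eventually_gt_atTop 0] with n hn
    have : (0 : ℝ) < n := by exact_mod_cast hn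
    exact div_pos (by norm_num) this
  have hlim2 : Tendsto J atTop (𝓝 0) := by
    have ht := ((H.trace R).comp h3n').const_mul (3 * C * Cg)
    rw [mul_zero] at ht
    refine squeeze_zero_norm' ?_ ht
    filter_upwards [eventually_gt_atTop 0, h3n.eventually (gt_mem_nhds hT)] with n hn hnT
    have hn' : (0 : ℝ) < n := by exact_mod_cast hn
    have hsub : (ball (0 : Eu N) R) ×ˢ Ioo 0 (3 / (n : ℝ)) ⊆ cyl N R T :=
      prod_mono Subset.rfl (Ioo_subset_Ioo le_rfl hnT.le)
    have e1 : J n = ∫ z in (ball (0 : Eu N) R) ×ˢ Ioo 0 (3 / (n : ℝ)),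
        (y z - y₀ z.1) * ρ z.1 * (g z * deriv (η n) z.2) := by
      refine setIntegral_eq_of_subset_of_forall_sdiff_eq_zero (cyl_measurable N R T) hsub
        fun z hz => ?_
      have h1 : 3 / (n : ℝ) ≤ z.2 := by
        by_contra h
        exact hz.2 ⟨hz.1.1, hz.1.2.1, not_le.1 h⟩
      rw [div_le_iff₀ hn'] at h1
      rw [hηd, hσd _ (by linarith)]
      simp
    rw [e1]
    have hi' : IntegrableOn (fun z : Eu N × ℝ => |y z - y₀ z.1| * ρ z.1)
        ((ball (0 : Eu N) R) ×ˢ Ioo 0 (3 / (n : ℝ))) := by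
      refine (iy.mono_set hsub).norm.congr (Eventually.of_forall fun z => ?_)
      simp [abs_of_nonneg (hρ0 z.1)]
    refine (norm_integral_le_of_norm_le (hi'.const_mul (Cg * (C * n)))
      (Eventually.of_forall fun z => ?_)).trans (le_of_eq ?_)
    · rw [norm_mul, norm_mul, norm_mul, Real.norm_eq_abs (ρ z.1), abs_of_nonneg (hρ0 _), hηd,
        norm_mul, Real.norm_natCast, mul_comm]
      have hh := hσC (n * z.2 - 1)
      refine mul_le_mul_of_nonneg_right (mul_le_mul (hCg z)
        (mul_le_mul_of_nonneg_right hh hn'.le) (by positivity) ((norm_nonneg _).trans (hCg z)))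
        (mul_nonneg (abs_nonneg _) (hρ0 _))
    · rw [integral_const_mul]
      simp only [Function.comp]
      field_simp
  have hfin : Tendsto (fun n => ∫ z in cyl N R T, E z * η n z.2) atTop (𝓝 (-0)) :=
    hlim2.neg.congr' (by
      filter_upwards [eventually_gt_atTop 0] with n hn
      rw [hsplit n hn])
  rw [neg_zero] at hfin
  exact tendsto_nhds_unique hlim1 hfin

end

section

variable {m : ℝ}

theorem spow_measurable (m : ℝ) : Measurable (fun x : ℝ => spow x m) := by
  unfold spow
  exact (measurable_norm.pow_const _).mul measurable_id

theorem abs_spow (hm : 1 < m) (x : ℝ) : |spow x m| = |x| ^ m := by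
  unfold spow
  rw [abs_mul, abs_of_nonneg (Real.rpow_nonneg (abs_nonneg x) _)]
  rcases eq_or_ne x 0 with rfl | hx
  · simp [Real.zero_rpow (by linarith : m ≠ 0)]
  · rw [← Real.rpow_add_one (abs_ne_zero.2 hx), sub_add_cancel]

theorem spow_of_nonneg (hm : 1 < m) {x : ℝ} (hx : 0 ≤ x) : spow x m = x ^ m := by
  have h : 0 ≤ spow x m := mul_nonneg (Real.rpow_nonneg (abs_nonneg x) _) hx
  rw [← abs_of_nonneg h, abs_spow hm, abs_of_nonneg hx]

theorem spow_of_nonpos (hm : 1 < m) {x : ℝ} (hx : x ≤ 0) : spow x m = -(|x| ^ m) := by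
  have h : spow x m ≤ 0 :=
    mul_nonpos_of_nonneg_of_nonpos (Real.rpow_nonneg (abs_nonneg x) _) hx
  rw [← abs_spow hm, abs_of_nonpos h, neg_neg]

/-- The signed power is increasing and locally Lipschitz. -/
theorem spow_slope (hm : 1 < m) {u v M : ℝ} (hu : 0 ≤ u) (huM : u ≤ M) (hvM : |v| ≤ M) :
    0 ≤ (spow v m - spow u m) / (v - u) ∧
      (spow v m - spow u m) / (v - u) ≤ m * M ^ (m - 1) := by
  have hM : 0 ≤ M := hu.trans huM
  have hM1 : 0 ≤ M ^ (m - 1) := Real.rpow_nonneg hM _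
  have key : ∀ a b : ℝ, 0 ≤ a → a < b → b ≤ M →
      0 ≤ (b ^ m - a ^ m) / (b - a) ∧ (b ^ m - a ^ m) / (b - a) ≤ m * M ^ (m - 1) := by
    intro a b ha hab hb
    obtain ⟨c, hc, h⟩ := exists_hasDerivAt_eq_slope (fun x : ℝ => x ^ m)
      (fun x => m * x ^ (m - 1)) hab
      (Real.continuous_rpow_const (by linarith)).continuousOn
      (fun x _ => Real.hasDerivAt_rpow_const (Or.inr hm.le))
    rw [← h]
    have hc0 : 0 ≤ c := ha.trans hc.1.le
    exact ⟨by positivity, mul_le_mul_of_nonneg_left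
      (Real.rpow_le_rpow hc0 (hc.2.le.trans hb) (by linarith)) (by linarith)⟩
  rcases lt_trichotomy v u with h | h | h
  · rcases le_total 0 v with hv | hv
    · rw [spow_of_nonneg hm hv, spow_of_nonneg hm hu, ← neg_div_neg_eq, neg_sub, neg_sub]
      exact key v u hv h huM
    · rw [spow_of_nonpos hm hv, spow_of_nonneg hm hu, ← neg_div_neg_eq, neg_sub, neg_sub,
        sub_neg_eq_add]
      have hd : 0 < u - v := sub_pos.2 h
      have h1 : ∀ x : ℝ, 0 ≤ x → x ≤ M → x ^ m ≤ M ^ (m - 1) * x := by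
        intro x hx hxM
        rw [← spow_of_nonneg hm hx]
        unfold spow
        rw [abs_of_nonneg hx]
        exact mul_le_mul_of_nonneg_right (Real.rpow_le_rpow hx hxM (by linarith)) hx
      refine ⟨div_nonneg (add_nonneg (Real.rpow_nonneg hu _)
        (Real.rpow_nonneg (abs_nonneg v) _)) hd.le, ?_⟩
      rw [div_le_iff₀ hd]
      have h2 := h1 u hu huM
      have h3 := h1 |v| (abs_nonneg v) hvM
      rw [abs_of_nonpos hv] at h3 ⊢
      have h4 : 0 ≤ (m - 1) * (M ^ (m - 1) * (u - v)) :=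
        mul_nonneg (by linarith) (mul_nonneg hM1 hd.le)
      nlinarith
  · subst h
    simp only [sub_self, div_zero, le_refl, true_and]
    positivity
  · have hv : 0 ≤ v := hu.trans h.le
    rw [spow_of_nonneg hm hv, spow_of_nonneg hm hu]
    exact key u v hu h ((le_abs_self v).trans hvM)

end

section

variable {N : ℕ} {ρ : Eu N → ℝ} {T m : ℝ} {y Y g U V : Eu N × ℝ → ℝ} {y₀ u₀ v₀ : Eu N → ℝ}

theorem TraceSol.integrableOn_weak (H : TraceSol ρ T y Y y₀)
    (hρi : ∀ R, IntegrableOn ρ (ball 0 R)) (hg : ContDiff ℝ (⊤ : ℕ∞) g)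
    (hgc : HasCompactSupport g) :
    IntegrableOn (fun z => (y z - y₀ z.1) * ρ z.1 * ptder g z + Y z * lapX g z)
      (univ ×ˢ Ioo 0 T) := by
  obtain ⟨R, hR⟩ := hgc.isCompact.isBounded.subset_ball (0 : Eu N × ℝ)
  have hpc : Continuous (ptder g) := (contDiff_fderiv_apply hg (0, 1)).continuous
  obtain ⟨Cp, hCp⟩ := (fderiv_apply_hasCompactSupport hgc (0, 1)).exists_bound_of_continuous hpc
  obtain ⟨Cl, hCl⟩ := (lapX_hasCompactSupport hgc).exists_bound_of_continuous
    (lapX_contDiff hg).continuous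
  have i1 := (H.integrableOn_y hρi R).mul_bdd (c := Cp) hpc.aestronglyMeasurable
    (Eventually.of_forall hCp)
  have i2 := (H.integrableOn_Y R).mul_bdd (c := Cl)
    (lapX_contDiff hg).continuous.aestronglyMeasurable (Eventually.of_forall hCl)
  have i3 : IntegrableOn (fun z => (y z - y₀ z.1) * ρ z.1 * ptder g z + Y z * lapX g z)
      (cyl N R T) := i1.add i2
  refine i3.of_forall_sdiff_eq_zero (MeasurableSet.univ.prod measurableSet_Ioo) fun z hz => ?_
  have hz : z ∉ tsupport g := by
    intro h
    have := hR h
    rw [mem_ball_zero_iff, Prod.norm_def, max_lt_iff] at this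
    exact hz.2 (mem_cyl.2 ⟨this.1, hz.1.2⟩)
  have e1 : lapX g z = 0 := image_eq_zero_of_notMem_tsupport fun h => hz (tsupport_lapX h)
  have e2 : ptder g z = 0 :=
    image_eq_zero_of_notMem_tsupport fun h => hz (tsupport_fderiv_apply (0, 1) h)
  rw [e1, e2]; simp

/-- Comparison of two locally bounded distributional solutions with ordered traces. -/
theorem TraceSol.le (hN : 3 ≤ N) (hm : 1 < m) (hT : 0 < T) (hρm : Measurable ρ)
    (hρi : ∀ R, IntegrableOn ρ (ball 0 R))
    (hρpos : ∀ R, ∃ c > 0, ∀ x : Eu N, ‖x‖ < R → c ≤ ρ x)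
    (HV : TraceSol ρ T V (fun z => spow (V z) m) v₀)
    (HU : TraceSol ρ T U (fun z => spow (U z) m) u₀) (hU : ∀ z, 0 ≤ U z)
    (h0 : ∀ x, v₀ x ≤ u₀ x)
    (hlim : Tendsto (fun R : ℝ => (∫ z in cyl N R T, |V z| ^ m) / R ^ N) atTop (𝓝 0)) :
    ∀ᵐ z, z ∈ (univ : Set (Eu N)) ×ˢ Ioo 0 T → V z ≤ U z := by
  have hρ0 : ∀ x, 0 ≤ ρ x := fun x => by
    obtain ⟨c, hc, h⟩ := hρpos (‖x‖ + 1)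
    exact hc.le.trans (h x (lt_add_one _))
  set a : Eu N × ℝ → ℝ := fun z => (spow (V z) m - spow (U z) m) / (V z - U z) with ha
  have haw : ∀ z, a z * (V z - U z) = spow (V z) m - spow (U z) m := by
    intro z
    by_cases h : V z - U z = 0
    · rw [h, sub_eq_zero.1 h]; simp
    · rw [ha]; exact div_mul_cancel₀ _ h
  have hbd : ∀ R, ∃ M, ∀ z ∈ cyl N R T, |V z| ≤ M ∧ U z ≤ M := by
    intro R
    obtain ⟨A, hA⟩ := HV.yb R
    obtain ⟨B, hB⟩ := HU.yb R
    exact ⟨max A B, fun z hz => ⟨(hA z hz).trans (le_max_left _ _),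
      (le_abs_self _).trans ((hB z hz).trans (le_max_right _ _))⟩⟩
  have Hc : CoreHyp ρ T (fun z => V z - U z) a (fun x => v₀ x - u₀ x) := by
    refine ⟨hT, hρm, hρi, hρpos, HV.ym.sub HU.ym,
      (HV.Ym.sub HU.Ym).div (HV.ym.sub HU.ym), fun z => ?_, fun R => ?_, fun R => ?_,
      HV.y0m.sub HU.y0m, fun x => sub_nonpos.2 (h0 x), fun R => ?_, fun g hg hgc hgs => ?_⟩
    · exact (spow_slope hm (hU z) (le_max_right |V z| (U z)) (le_max_left _ _)).1
    · obtain ⟨M, hM⟩ := hbd R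
      refine ⟨M + M, fun z hz => (abs_sub _ _).trans (add_le_add (hM z hz).1 ?_)⟩
      rw [abs_of_nonneg (hU z)]
      exact (hM z hz).2
    · obtain ⟨M, hM⟩ := hbd R
      exact ⟨m * M ^ (m - 1), fun z hz =>
        (spow_slope hm (hU z) (hM z hz).2 (hM z hz).1).2⟩
    · refine ((HV.y0i R).sub (HU.y0i R)).congr (Eventually.of_forall fun x => ?_)
      simp only [Pi.sub_apply]; ring
    · have e := integral_sub (HV.integrableOn_weak hρi hg hgc)
        (HU.integrableOn_weak hρi hg hgc)
      rw [HV.weak hT hρi hρ0 hg hgc hgs, HU.weak hT hρi hρ0 hg hgc hgs, sub_zero] at e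
      refine Eq.trans ?_ e
      congr 1; ext z
      rw [haw]; ring
  have hGm : Measurable fun z => |V z| ^ m := HV.ym.norm.pow_const m
  have := Hc.nonpos hN (G := fun z => |V z| ^ m) (fun r => ?_)
    (fun z => Real.rpow_nonneg (abs_nonneg _) _) (fun z _ => ?_) hlim
  · filter_upwards [this] with z hz hzT
    linarith [hz hzT]
  · obtain ⟨W, hW⟩ := HV.Yb r
    rw [← integrable_indicator_iff (cyl_measurable N r T)]
    refine (BM_cyl hGm (C := W) fun z hz => ?_).integrable
    rw [abs_of_nonneg (Real.rpow_nonneg (abs_nonneg _) _), ← abs_spow hm]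
    exact hW z hz
  · rw [haw, ← abs_spow hm]
    have h1 : 0 ≤ spow (U z) m := by
      rw [spow_of_nonneg hm (hU z)]; exact Real.rpow_nonneg (hU z) _
    linarith [le_abs_self (spow (V z) m)]

end

section

variable {N : ℕ} {g : Eu N × ℝ → ℝ}

theorem ae_ae_slice {P : Eu N × ℝ → Prop} (h : ∀ᵐ z, P z) : ∀ᵐ t : ℝ, ∀ᵐ x : Eu N, P (x, t) := by
  have h1 : ∀ᵐ w : ℝ × Eu N, P w.swap :=
    (Measure.measurePreserving_swap (μ := (volume : Measure ℝ))
      (ν := (volume : Measure (Eu N)))).quasiMeasurePreserving.ae h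
  exact Measure.ae_ae_of_ae_prod h1

theorem ae_of_ae_ae_slice {P : Eu N × ℝ → Prop} (hP : MeasurableSet {z | P z})
    (h : ∀ᵐ t : ℝ, ∀ᵐ x : Eu N, P (x, t)) : ∀ᵐ z, P z := by
  have h1 : ∀ᵐ w : ℝ × Eu N, P w.swap :=
    (Measure.ae_prod_iff_ae_ae (p := fun w : ℝ × Eu N => P w.swap)
      (hP.preimage measurable_swap)).2 h
  exact (Measure.measurePreserving_swap (μ := (volume : Measure (Eu N)))
      (ν := (volume : Measure ℝ))).quasiMeasurePreserving.ae h1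

theorem ae_fst {P : Eu N → Prop} (h : ∀ᵐ x, P x) : ∀ᵐ z : Eu N × ℝ, P z.1 :=
  Measure.quasiMeasurePreserving_fst.ae h

theorem setIntegral_prod_slice {F : Eu N × ℝ → ℝ} {A : Set (Eu N)} {I : Set ℝ}
    (hF : IntegrableOn F (A ×ˢ I)) :
    ∫ z in A ×ˢ I, F z = ∫ t in I, ∫ x in A, F (x, t) := by
  rw [Measure.volume_eq_prod, ← Measure.prod_restrict]
  refine integral_prod_symm _ ?_
  rw [Measure.prod_restrict]
  exact hF

theorem integrableOn_prod_fst {φ : Eu N → ℝ} {A : Set (Eu N)} {I : Set ℝ}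
    (hφ : IntegrableOn φ A) (hI : volume I ≠ ∞) :
    IntegrableOn (fun z : Eu N × ℝ => φ z.1) (A ×ˢ I) := by
  have : IsFiniteMeasure (volume.restrict I) := ⟨by simpa using hI.lt_top⟩
  rw [IntegrableOn, Measure.volume_eq_prod, ← Measure.prod_restrict]
  exact Integrable.comp_fst hφ _

theorem ptder_comp_add (g : Eu N × ℝ → ℝ) (c z : Eu N × ℝ) :
    ptder (fun z => g (z + c)) z = ptder g (z + c) := by
  rw [ptder, fderiv_comp_add_right, ptder]

theorem lapX_comp_add (g : Eu N × ℝ → ℝ) (c z : Eu N × ℝ) :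
    lapX (fun z => g (z + c)) z = lapX g (z + c) := by
  unfold lapX
  refine Finset.sum_congr rfl fun i _ => ?_
  simp only [fderiv_comp_add_right]
  rw [fderiv_comp_add_right (f := fun q => fderiv ℝ g q (EuclideanSpace.single i 1, 0))]

/-- A weight satisfying the growth condition agrees almost everywhere with one that is
locally integrable and locally bounded below. -/
theorem WeightCond.exists_regular {γ Cl Cu : ℝ} {ρ : Eu N → ℝ} (hN : 3 ≤ N)
    (hρ : WeightCond N γ Cl Cu ρ) :
    ∃ ρ' : Eu N → ℝ, Measurable ρ' ∧ ρ' =ᵐ[volume] ρ ∧ (∀ R, IntegrableOn ρ' (ball 0 R)) ∧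
      ∀ x, Cl * (1 + ‖x‖) ^ (-γ) ≤ ρ' x := by
  obtain ⟨hm, hγ0, hγ2, hCl, hClu, hb⟩ := hρ
  have hme : Measurable fun x : Eu N => Cl * (1 + ‖x‖) ^ (-γ) :=
    ((measurable_norm.const_add 1).pow_const _).const_mul _
  have hmax : Measurable fun x => max (ρ x) (Cl * (1 + ‖x‖) ^ (-γ)) := hm.max hme
  refine ⟨fun x => max (ρ x) (Cl * (1 + ‖x‖) ^ (-γ)), hmax, ?_, fun R => ?_,
    fun x => le_max_right _ _⟩
  · filter_upwards [hb] with x hx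
    exact max_eq_left hx.1
  · rcases le_or_gt R 0 with hR | hR
    · rw [ball_eq_empty.2 hR]; exact integrableOn_empty
    have hne : Nonempty (Fin N) := ⟨⟨0, by omega⟩⟩
    have h_int : IntegrableOn (fun x : Eu N => Cu * ‖x‖ ^ (-γ)) (ball 0 R) := by
      refine Integrable.const_mul ?_ Cu
      refine (integrableOn_fun_norm_addHaar volume (f := fun s : ℝ => s ^ (-γ))).2 ?_
      have h1 := (intervalIntegral.integrableOn_Ioo_rpow_iff (s := ((N : ℝ) - 1) - γ) hR).2 (by
        have : (3 : ℝ) ≤ N := by exact_mod_cast hN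
        linarith)
      refine h1.congr_fun (fun s hs => ?_) measurableSet_Ioo
      simp only [finrank_euclideanSpace, Fintype.card_fin, smul_eq_mul]
      rw [sub_eq_add_neg, Real.rpow_add hs.1, ← Real.rpow_natCast,
        Nat.cast_sub (by omega), Nat.cast_one]
    refine h_int.mono' hmax.aestronglyMeasurable (ae_restrict_of_ae ?_)
    filter_upwards [hb] with x hx
    have h0 : 0 ≤ Cl * (1 + ‖x‖) ^ (-γ) :=
      mul_nonneg hCl.le (Real.rpow_nonneg (by positivity) _)
    rw [max_eq_left hx.1, Real.norm_eq_abs, abs_of_nonneg (h0.trans hx.1)]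
    exact hx.2

end

section

variable {N : ℕ} {ρ ρ' u₀ : Eu N → ℝ} {m T T' τ₁ : ℝ} {u : Eu N → ℝ → ℝ}

/-- A non-negative locally bounded solution has a measurable, locally bounded version on
compact time intervals. -/
theorem VWS.exists_version (hu : VWS ρ m univ 0 T u)
    (hupos : ∀ᵐ p ∂(volume.restrict ((univ : Set (Eu N)) ×ˢ Ioo 0 T) : Measure (Eu N × ℝ)),
      0 ≤ u p.1 p.2)
    (hubdd : LinftyLoc univ 0 T u) {a b : ℝ} (ha : 0 < a) (hb : b < T) :
    ∃ U : Eu N × ℝ → ℝ, Measurable U ∧ (∀ z, 0 ≤ U z) ∧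
      (∀ R, ∃ W, ∀ z : Eu N × ℝ, ‖z.1‖ < R → U z ≤ W) ∧
      ∀ᵐ z : Eu N × ℝ, z.2 ∈ Icc a b → U z = u z.1 z.2 := by
  obtain ⟨U1, hU1, hU1e⟩ := hu.aemeas
  have hK : ∀ n : ℕ, ∃ M : ℝ, ∀ᵐ p ∂(volume.restrict (closedBall (0 : Eu N) n ×ˢ Icc a b)),
      |u p.1 p.2| ≤ M := fun n =>
    hubdd _ ((isCompact_closedBall _ _).prod isCompact_Icc)
      (prod_mono (subset_univ _) fun t ht => ⟨ha.trans_le ht.1, ht.2.trans_lt hb⟩)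
  choose B hB using hK
  have hS : MeasurableSet ((univ : Set (Eu N)) ×ˢ Ioo 0 T) := MeasurableSet.univ.prod measurableSet_Ioo
  have hBm : Measurable fun z : Eu N × ℝ => B ⌈‖z.1‖⌉₊ :=
    (measurable_from_nat (f := B)).comp (Nat.measurable_ceil.comp measurable_fst.norm)
  have hset : MeasurableSet {z : Eu N × ℝ | 0 ≤ U1 z ∧ U1 z ≤ B ⌈‖z.1‖⌉₊} :=
    (measurableSet_le measurable_const hU1).inter (measurableSet_le hU1 hBm)
  classical
  refine ⟨fun z => if 0 ≤ U1 z ∧ U1 z ≤ B ⌈‖z.1‖⌉₊ then U1 z else 0,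
    Measurable.ite hset hU1 measurable_const, fun z => ?_, fun R => ?_, ?_⟩
  · dsimp only
    split_ifs with h
    exacts [h.1, le_rfl]
  · refine ⟨∑ n ∈ Finset.range (⌈R⌉₊ + 1), |B n|, fun z hz => ?_⟩
    dsimp only
    split_ifs with h
    · refine h.2.trans ((le_abs_self _).trans ?_)
      exact Finset.single_le_sum (f := fun n => |B n|) (fun n _ => abs_nonneg _)
        (Finset.mem_range.2 (Nat.lt_succ_of_le (Nat.ceil_mono hz.le)))
    · exact Finset.sum_nonneg fun n _ => abs_nonneg _
  · have h1 := (ae_restrict_iff' hS).1 hU1e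
    have h2 := (ae_restrict_iff' hS).1 hupos
    have h3 := ae_all_iff.2 fun n =>
      (ae_restrict_iff' (isClosed_closedBall.prod isClosed_Icc).measurableSet).1 (hB n)
    filter_upwards [h1, h2, h3] with z h1 h2 h3 hz
    have hzS : z ∈ (univ : Set (Eu N)) ×ˢ Ioo 0 T :=
      ⟨mem_univ _, ha.trans_le hz.1, hz.2.trans_lt hb⟩
    have hzK := h3 ⌈‖z.1‖⌉₊ ⟨by simpa using Nat.le_ceil ‖z.1‖, hz⟩
    rw [if_pos]
    · exact (h1 hzS).symm
    · rw [← h1 hzS]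
      exact ⟨h2 hzS, (le_abs_self _).trans hzK⟩

/-- A very weak solution, restarted at a Lebesgue time. -/
theorem VWS.exists_traceSol (hu : VWS ρ m univ 0 T u)
    (hupos : ∀ᵐ p ∂(volume.restrict ((univ : Set (Eu N)) ×ˢ Ioo 0 T) : Measure (Eu N × ℝ)),
      0 ≤ u p.1 p.2)
    (hubdd : LinftyLoc univ 0 T u) (hm : 1 < m) (hτ₁ : 0 < τ₁) (hT' : 0 < T') (hTT : τ₁ + T' < T)
    (hLeb : ∀ K : Set (Eu N), IsCompact K →
      IntegrableOn (fun x => |u x τ₁| * ρ x) K ∧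
      Tendsto (fun ε : ℝ => ε⁻¹ * ∫ t in Ioo (τ₁ - ε) (τ₁ + ε), ∫ x in K,
          |u x t - u x τ₁| * ρ x)
        (𝓝[>] (0 : ℝ)) (𝓝 0))
    (hρm : Measurable ρ') (hρe : ρ' =ᵐ[volume] ρ) (hρi : ∀ R, IntegrableOn ρ' (ball 0 R))
    (hρ0 : ∀ x, 0 ≤ ρ' x) (hu0m : Measurable u₀) (hu0 : ∀ᵐ x, u₀ x = u x τ₁) :
    ∃ U : Eu N × ℝ → ℝ, (∀ z, 0 ≤ U z) ∧
      (∀ᵐ z : Eu N × ℝ, z.2 ∈ Ioo 0 T' → U z = u z.1 (z.2 + τ₁)) ∧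
      TraceSol ρ' T' U (fun z => spow (U z) m) u₀ := by
  obtain ⟨U, hUm, hU0, hUb, hUe⟩ := hu.exists_version hupos hubdd (half_pos hτ₁) hTT
  set c : Eu N × ℝ := (0, τ₁) with hc
  have hmp : MeasurePreserving (fun z : Eu N × ℝ => z + c) := measurePreserving_add_right _ _
  have hUe' : ∀ᵐ z : Eu N × ℝ, z.2 ∈ Ioo 0 T' → U (z + c) = u z.1 (z.2 + τ₁) := by
    filter_upwards [hmp.quasiMeasurePreserving.ae hUe] with z hz hzT
    have := hz ⟨by simp only [hc, Prod.snd_add]; linarith [hzT.1],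
      by simp only [hc, Prod.snd_add]; linarith [hzT.2]⟩
    simpa [hc] using this
  have hu0i : ∀ R, IntegrableOn (fun x => ρ' x * u₀ x) (ball 0 R) := by
    intro R
    have h1 := (hLeb _ (isCompact_closedBall (0 : Eu N) R)).1.mono_set ball_subset_closedBall
    refine h1.mono' (hρm.mul hu0m).aestronglyMeasurable (ae_restrict_of_ae ?_)
    filter_upwards [hρe, hu0] with x h1 h2
    rw [norm_mul, Real.norm_eq_abs, Real.norm_eq_abs, abs_of_nonneg (hρ0 x), h1, h2, mul_comm]
  refine ⟨fun z => U (z + c), fun z => hU0 _, hUe', ?_⟩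
  have hbd : ∀ R, ∃ W, ∀ z ∈ cyl N R T', |U (z + c)| ≤ W := by
    intro R
    obtain ⟨W, hW⟩ := hUb R
    refine ⟨W, fun z hz => ?_⟩
    rw [abs_of_nonneg (hU0 _)]
    exact hW _ (by simpa [hc] using (mem_cyl.1 hz).1)
  have hUcm : Measurable fun z => U (z + c) := hUm.comp hmp.measurable
  refine ⟨hUcm, (spow_measurable m).comp hUcm, hu0m, hbd, fun R => ?_, hu0i, fun R => ?_,
    fun g hg hgc hgs => ?_⟩
  · obtain ⟨W, hW⟩ := hbd R
    refine ⟨W ^ m, fun z hz => ?_⟩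
    rw [abs_spow hm]
    exact Real.rpow_le_rpow (abs_nonneg _) (hW z hz) (by linarith)
  · refine squeeze_zero' ?_ ?_ (hLeb _ (isCompact_closedBall (0 : Eu N) R)).2
    · filter_upwards [self_mem_nhdsWithin] with ε hε
      exact mul_nonneg (inv_nonneg.2 (le_of_lt hε))
        (integral_nonneg fun z => mul_nonneg (abs_nonneg _) (hρ0 _))
    · have hε0 : ∀ᶠ ε in 𝓝[>] (0 : ℝ), ε < min (τ₁ / 2) T' :=
        nhdsWithin_le_nhds (gt_mem_nhds (lt_min (half_pos hτ₁) hT'))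
      filter_upwards [self_mem_nhdsWithin, hε0] with ε hε hεlt
      have hε : 0 < ε := hε
      rw [lt_min_iff] at hεlt
      refine mul_le_mul_of_nonneg_left ?_ (inv_nonneg.2 hε.le)
      let F : Eu N × ℝ → ℝ := fun z => |U z - u₀ z.1| * ρ' z.1
      have hFi : IntegrableOn F (closedBall (0 : Eu N) R ×ˢ Ioo (τ₁ - ε) (τ₁ + ε)) := by
        obtain ⟨W, hW⟩ := hUb (R + 1)
        have hsub : closedBall (0 : Eu N) R ⊆ ball 0 (R + 1) :=
          closedBall_subset_ball (by linarith)
        have h1 : IntegrableOn (fun x => W * ρ' x + |ρ' x * u₀ x|) (closedBall (0 : Eu N) R) :=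
          (((hρi (R + 1)).mono_set hsub).const_mul W).add ((hu0i (R + 1)).mono_set hsub).abs
        have h2 := integrableOn_prod_fst (I := Ioo (τ₁ - ε) (τ₁ + ε)) h1 (by simp)
        refine h2.mono' ?_ ?_
        · exact (((hUm.sub (hu0m.comp measurable_fst)).norm).mul
            (hρm.comp measurable_fst)).aestronglyMeasurable
        · filter_upwards [ae_restrict_mem
            ((isClosed_closedBall.measurableSet).prod measurableSet_Ioo)] with z hz
          have hz1 : ‖z.1‖ < R + 1 := by simpa using hsub hz.1
          have hUW : |U z| ≤ W := by rw [abs_of_nonneg (hU0 z)]; exact hW z hz1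
          rw [Real.norm_eq_abs, abs_mul, abs_abs, abs_of_nonneg (hρ0 _), abs_mul,
            abs_of_nonneg (hρ0 z.1)]
          nlinarith [hρ0 z.1, abs_sub (U z) (u₀ z.1)]
      have e1 : ∫ z in ball (0 : Eu N) R ×ˢ Ioo 0 ε, |U (z + c) - u₀ z.1| * ρ' z.1 =
          ∫ z in ball (0 : Eu N) R ×ˢ Ioo τ₁ (τ₁ + ε), F z := by
        rw [← hmp.setIntegral_preimage_emb (measurableEmbedding_addRight c) F]
        have hpre : (fun z : Eu N × ℝ => z + c) ⁻¹' (ball (0 : Eu N) R ×ˢ Ioo τ₁ (τ₁ + ε)) =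
            ball (0 : Eu N) R ×ˢ Ioo 0 ε := by
          ext z
          simp only [hc, mem_preimage, mem_prod, Prod.fst_add, add_zero, Prod.snd_add, mem_Ioo]
          refine and_congr Iff.rfl ⟨fun h => ⟨by linarith [h.1], by linarith [h.2]⟩,
            fun h => ⟨by linarith [h.1], by linarith [h.2]⟩⟩
        rw [hpre]
        simp [F, hc]
      have e2 : ∫ z in ball (0 : Eu N) R ×ˢ Ioo τ₁ (τ₁ + ε), F z ≤
          ∫ z in closedBall (0 : Eu N) R ×ˢ Ioo (τ₁ - ε) (τ₁ + ε), F z := by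
        refine setIntegral_mono_set hFi
          (Eventually.of_forall fun z => mul_nonneg (abs_nonneg _) (hρ0 _)) ?_
        exact LE.le.eventuallyLE
          (prod_mono ball_subset_closedBall (Ioo_subset_Ioo (by linarith) le_rfl))
      refine (e1.trans_le e2).trans (le_of_eq ?_)
      rw [setIntegral_prod_slice hFi]
      refine setIntegral_congr_ae measurableSet_Ioo ?_
      filter_upwards [ae_ae_slice hUe] with t ht htI
      refine integral_congr_ae (ae_restrict_of_ae ?_)
      filter_upwards [ht, hρe, hu0] with x h1 h2 h3
      simp only [F]
      rw [h1 ⟨by linarith [htI.1], by linarith [htI.2]⟩, h2, h3]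
  · set g' : Eu N × ℝ → ℝ := fun z => g (z + -c) with hg'
    have hts : tsupport g' ⊆ univ ×ˢ Ioo 0 T := by
      intro z hz
      have h1 : z + -c ∈ tsupport g := by
        have : tsupport g' ⊆ (fun z => z + -c) ⁻¹' tsupport g :=
          closure_minimal (fun z hz => subset_tsupport _ hz)
            ((isClosed_tsupport g).preimage (by fun_prop))
        exact this hz
      have h2 := (hgs h1).2
      simp only [hc, Prod.snd_add, Prod.snd_neg, mem_Ioo] at h2
      exact ⟨mem_univ _, by linarith [h2.1], by linarith [h2.2]⟩
    have h0 := hu.weak g' (hg.comp (by fun_prop))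
      (hgc.comp_homeomorph (Homeomorph.addRight (-c))) hts
    rw [setIntegral_eq_integral_of_forall_compl_eq_zero fun z hz => by
      have hz : z ∉ tsupport g' := fun h => hz (hts h)
      have e1 : lapX g' z = 0 := image_eq_zero_of_notMem_tsupport fun h => hz (tsupport_lapX h)
      have e2 : ptder g' z = 0 :=
        image_eq_zero_of_notMem_tsupport fun h => hz (tsupport_fderiv_apply (0, 1) h)
      rw [e1, e2]; simp] at h0
    rw [← integral_add_right_eq_self _ c] at h0
    rw [setIntegral_eq_integral_of_forall_compl_eq_zero fun z hz => by
      have hz : z ∉ tsupport g := fun h => hz (hgs h)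
      have e1 : lapX g z = 0 := image_eq_zero_of_notMem_tsupport fun h => hz (tsupport_lapX h)
      have e2 : ptder g z = 0 :=
        image_eq_zero_of_notMem_tsupport fun h => hz (tsupport_fderiv_apply (0, 1) h)
      rw [e1, e2]; simp]
    refine Eq.trans (integral_congr_ae ?_) h0
    filter_upwards [hUe', ae_fst hρe] with z hz hzρ
    have e1 : lapX g' (z + c) = lapX g z := by
      rw [hg', lapX_comp_add, add_neg_cancel_right]
    have e2 : ptder g' (z + c) = ptder g z := by
      rw [hg', ptder_comp_add, add_neg_cancel_right]
    have e3 : (z + c).1 = z.1 := by simp [hc]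
    have e4 : (z + c).2 = z.2 + τ₁ := by simp [hc]
    rw [e1, e2, e3, e4, hzρ]
    by_cases hzT : z.2 ∈ Ioo 0 T'
    · rw [hz hzT]; ring
    · have hz : z ∉ tsupport g := fun h => hzT (hgs h).2
      have e1 : lapX g z = 0 := image_eq_zero_of_notMem_tsupport fun h => hz (tsupport_lapX h)
      have e2 : ptder g z = 0 :=
        image_eq_zero_of_notMem_tsupport fun h => hz (tsupport_fderiv_apply (0, 1) h)
      rw [e1, e2]; simp

end

/-- Smooth test functions compactly supported in positive times. -/
structure Test {N : ℕ} (φ : Eu N × ℝ → ℝ) : Prop where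
  smooth : ContDiff ℝ (⊤ : ℕ∞) φ
  cpt : HasCompactSupport φ
  supp : tsupport φ ⊆ univ ×ˢ Ioi 0

section

variable {N : ℕ} {φ φ' P : Eu N × ℝ → ℝ} {C : ℝ}

theorem Test.add (h : Test φ) (h' : Test φ') : Test (φ + φ') :=
  ⟨h.smooth.add h'.smooth, h.cpt.add h'.cpt,
    (tsupport_add φ φ').trans (union_subset h.supp h'.supp)⟩

theorem Test.fderiv_apply (h : Test φ) (d : Eu N × ℝ) : Test (fun p => fderiv ℝ φ p d) :=
  ⟨contDiff_fderiv_apply h.smooth d, fderiv_apply_hasCompactSupport h.cpt d,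
    (tsupport_fderiv_apply d).trans h.supp⟩

theorem Test.shift (h : Test φ) (e : Eu N) : Test (fun p => φ (p + (e, 0))) := by
  refine ⟨h.smooth.comp (by fun_prop),
    h.cpt.comp_homeomorph (Homeomorph.addRight ((e, 0) : Eu N × ℝ)), ?_⟩
  have h1 : tsupport (fun p => φ (p + (e, 0))) ⊆ (fun p => p + (e, 0)) ⁻¹' tsupport φ :=
    closure_minimal (fun z hz => subset_tsupport φ hz)
      ((isClosed_tsupport φ).preimage (by fun_prop))
  intro z hz
  have := (h.supp (h1 hz)).2
  exact ⟨mem_univ _, by simpa using this⟩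

theorem Test.bm (h : Test φ) : BM φ := BM.of_continuous h.smooth.continuous h.cpt

theorem Test.exists_box (h : Test φ) : ∃ L, 0 < L ∧ ∀ z, φ z ≠ 0 → ‖z‖ < L ∧ z.2 ∈ Ioo 0 L := by
  obtain ⟨r, hr⟩ := h.bm.supp
  refine ⟨|r| + 1, by positivity, fun z hz => ?_⟩
  have h1 : ‖z‖ < |r| + 1 := (not_lt.1 fun h' => hz (hr z h')).trans_lt (by
    linarith [le_abs_self r])
  exact ⟨h1, (h.supp (subset_tsupport _ hz)).2,
    (le_abs_self _).trans_lt ((norm_snd_le z).trans_lt h1)⟩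

theorem BM.integrable_bounded_mul (h : BM φ) (hP : Measurable P) (hC : ∀ z, |P z| ≤ C) :
    Integrable (fun z => P z * φ z) :=
  h.integrable.bdd_mul (c := C) hP.aestronglyMeasurable
    (Eventually.of_forall fun z => by simpa using hC z)

/-- A bounded function with vanishing weak derivative in a spatial direction is weakly
invariant under translations in that direction. -/
theorem integral_mul_shift_eq (hP : Measurable P) (hC : ∀ z, |P z| ≤ C) {e : Eu N}
    (h0 : ∀ φ, Test φ → ∫ z, P z * fderiv ℝ φ z (e, 0) = 0) (h : Test φ) :
    ∫ z, P z * φ (z + (e, 0)) = ∫ z, P z * φ z := by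
  set d : Eu N × ℝ := (e, 0) with hd
  have hφd := h.fderiv_apply d
  obtain ⟨A, hA⟩ := hφd.bm.bdd
  obtain ⟨R, hR⟩ := hφd.bm.supp
  have hC0 : 0 ≤ C := (abs_nonneg _).trans (hC 0)
  have hA0 : 0 ≤ A := (abs_nonneg _).trans (hA 0)
  have hder : ∀ s₀ : ℝ, HasDerivAt (fun s : ℝ => ∫ z, P z * φ (z + s • d))
      (∫ z, P z * fderiv ℝ φ (z + s₀ • d) d) s₀ := by
    intro s₀
    have hmt : ∀ s : ℝ, Continuous fun z : Eu N × ℝ => z + s • d := fun s => by fun_prop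
    have hshift : ∀ s : ℝ, s • d = (s • e, 0) := fun s => by simp [hd]
    set B : Set (Eu N × ℝ) := closedBall 0 (R + (|s₀| + 1) * ‖d‖) with hB
    refine (hasDerivAt_integral_of_dominated_loc_of_deriv_le (μ := volume)
      (F := fun s z => P z * φ (z + s • d))
      (F' := fun s z => P z * fderiv ℝ φ (z + s • d) d)
      (bound := B.indicator fun _ => C * A) (s := ball s₀ 1) (ball_mem_nhds _ one_pos)
      ?_ ?_ ?_ ?_ ?_ ?_).2
    · exact Eventually.of_forall fun s =>
        (hP.mul (h.smooth.continuous.comp (hmt s)).measurable).aestronglyMeasurable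
    · have := (h.shift (s₀ • e)).bm.integrable_bounded_mul hP hC
      simpa only [hshift] using this
    · exact (hP.mul (hφd.smooth.continuous.comp (hmt s₀)).measurable).aestronglyMeasurable
    · refine Eventually.of_forall fun z s hs => ?_
      have hs1 : |s| < |s₀| + 1 := by
        have := abs_sub_abs_le_abs_sub s s₀
        rw [mem_ball, Real.dist_eq] at hs
        linarith
      by_cases hz : z ∈ B
      · rw [indicator_of_mem hz, norm_mul, Real.norm_eq_abs, Real.norm_eq_abs]
        exact mul_le_mul (hC z) (hA _) (abs_nonneg _) hC0
      · have : fderiv ℝ φ (z + s • d) d = 0 := by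
          by_contra hne
          refine hz ?_
          rw [hB, mem_closedBall_zero_iff]
          have h1 : ‖z + s • d‖ ≤ R := not_lt.1 fun h => hne (hR _ h)
          have h2 : ‖z‖ ≤ ‖z + s • d‖ + ‖s • d‖ := by
            simpa using norm_sub_le (z + s • d) (s • d)
          rw [norm_smul, Real.norm_eq_abs] at h2
          nlinarith [norm_nonneg d]
        simp [this, hz]
    · exact (integrable_indicator_iff isClosed_closedBall.measurableSet).2
        (integrableOn_const (measure_closedBall_lt_top.ne))
    · refine Eventually.of_forall fun z s _ => ?_
      have h1 : HasDerivAt (fun s : ℝ => z + s • d) d s := by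
        simpa using ((hasDerivAt_id s).smul_const d).const_add z
      have h2 := (h.smooth.differentiable (by simp) (z + s • d)).hasFDerivAt.comp_hasDerivAt s h1
      exact h2.const_mul _
  have hz : ∀ s₀ : ℝ, ∫ z, P z * fderiv ℝ φ (z + s₀ • d) d = 0 := by
    intro s₀
    have h1 := h0 _ (h.shift (s₀ • e))
    have hshift : s₀ • d = (s₀ • e, 0) := by simp [hd]
    simpa only [fderiv_comp_add_right, hshift] using h1
  have := is_const_of_deriv_eq_zero (f := fun s : ℝ => ∫ z, P z * φ (z + s • d))
    (fun s => (hder s).differentiableAt) (fun s => by rw [(hder s).deriv, hz]) 1 0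
  simpa using this

/-- A bounded function which is weakly invariant under spatial translations and has vanishing
spatial means vanishes weakly. -/
theorem integral_mul_eq_zero_of_shift (hP : Measurable P) (hC : ∀ z, |P z| ≤ C)
    (hinv : ∀ e φ, Test φ → ∫ z, P z * φ (z + (e, 0)) = ∫ z, P z * φ z)
    (hlim : ∀ L, Tendsto (fun R : ℝ => (∫ z in cyl N R L, |P z|) / R ^ N) atTop (𝓝 0))
    (h : Test φ) : ∫ z, P z * φ z = 0 := by
  obtain ⟨A, hA⟩ := h.bm.bdd
  obtain ⟨L, hL0, hL⟩ := h.exists_box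
  have hA0 : 0 ≤ A := (abs_nonneg _).trans (hA 0)
  set κ := volume.real (ball (0 : Eu N) 1) with hκ
  have hκ0 : 0 < κ := ENNReal.toReal_pos (measure_ball_pos _ _ one_pos).ne' measure_ball_lt_top.ne
  have hvol : ∀ (x : Eu N) {R : ℝ}, 0 < R → volume.real (ball x R) = R ^ N * κ := by
    intro x R hR
    rw [hκ, measureReal_def, measureReal_def, Measure.addHaar_ball_of_pos _ _ hR]
    simp [hR.le]
  set D := A * (L ^ N * κ) with hD
  have hsupp : ∀ z, φ z ≠ 0 → ‖z.1‖ < L ∧ z.2 ∈ Ioo 0 L := fun z hz =>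
    ⟨(norm_fst_le z).trans_lt (hL z hz).1, (hL z hz).2⟩
  have hmain : ∀ n : ℝ, L ≤ n → |∫ z, P z * φ z| ≤
      D * 2 ^ N / κ * ((∫ z in cyl N (2 * n) L, |P z|) / (2 * n) ^ N) := by
    intro n hn
    have hn0 : 0 < n := hL0.trans_le hn
    have hPi : IntegrableOn P (cyl N (2 * n) L) := by
      refine Measure.integrableOn_of_bounded (M := C) ?_ hP.aestronglyMeasurable
        (Eventually.of_forall hC)
      rw [cyl, Measure.volume_eq_prod, Measure.prod_prod]
      exact (ENNReal.mul_lt_top measure_ball_lt_top (by simp)).ne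
    set G : Eu N × (Eu N × ℝ) → ℝ := fun q => P q.2 * φ (q.2 + (q.1, 0)) with hG
    have hGm : Measurable G :=
      (hP.comp measurable_snd).mul (h.smooth.continuous.comp (by fun_prop)).measurable
    have hzero : ∀ y ∈ ball (0 : Eu N) n, ∀ z ∉ cyl N (2 * n) L, φ (z + (y, 0)) = 0 := by
      intro y hy z hz
      by_contra hne
      have h1 := hsupp _ hne
      rw [mem_ball_zero_iff] at hy
      simp only [Prod.fst_add, Prod.snd_add, add_zero] at h1
      refine hz (mem_cyl.2 ⟨?_, h1.2⟩)
      have h2 : ‖z.1‖ ≤ ‖z.1 + y‖ + ‖y‖ := by simpa using norm_sub_le (z.1 + y) y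
      linarith [h1.1]
    have hGi : Integrable G ((volume.restrict (ball 0 n)).prod volume) := by
      have : IsFiniteMeasure (volume.restrict (ball (0 : Eu N) n)) :=
        ⟨by simpa using measure_ball_lt_top⟩
      have h1 : Integrable (fun q : Eu N × (Eu N × ℝ) =>
          (1 : ℝ) * (cyl N (2 * n) L).indicator (fun z => A * |P z|) q.2)
          ((volume.restrict (ball 0 n)).prod volume) :=
        (integrable_const (1 : ℝ)).mul_prod
          ((integrable_indicator_iff (cyl_measurable _ _ _)).2 (hPi.abs.const_mul A))
      refine h1.mono' hGm.aestronglyMeasurable ?_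
      rw [← Measure.restrict_univ (μ := (volume : Measure (Eu N × ℝ))), Measure.prod_restrict]
      filter_upwards [ae_restrict_mem (measurableSet_ball.prod MeasurableSet.univ)] with q hq
      by_cases hz : q.2 ∈ cyl N (2 * n) L
      · rw [indicator_of_mem hz, one_mul, norm_mul, Real.norm_eq_abs, Real.norm_eq_abs, mul_comm]
        exact mul_le_mul_of_nonneg_right (hA _) (abs_nonneg _)
      · simp [hG, hzero _ hq.1 _ hz, hz]
    have e1 : n ^ N * κ * ∫ z, P z * φ z = ∫ z, P z * ∫ y in ball (0 : Eu N) n, φ (z + (y, 0)) := by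
      have h1 : ∫ y in ball (0 : Eu N) n, ∫ z, G (y, z) = n ^ N * κ * ∫ z, P z * φ z := by
        have : ∀ y, ∫ z, G (y, z) = ∫ z, P z * φ z := fun y => hinv y φ h
        simp only [this]
        rw [setIntegral_const, hvol _ hn0, smul_eq_mul]
      rw [← h1, integral_integral_swap hGi]
      simp only [hG, integral_const_mul]
    have e2 : |∫ z, P z * ∫ y in ball (0 : Eu N) n, φ (z + (y, 0))| ≤
        D * ∫ z in cyl N (2 * n) L, |P z| := by
      rw [← integral_const_mul, ← integral_indicator (cyl_measurable _ _ _), ← Real.norm_eq_abs]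
      refine norm_integral_le_of_norm_le
        ((integrable_indicator_iff (cyl_measurable _ _ _)).2 (hPi.abs.const_mul D))
        (Eventually.of_forall fun z => ?_)
      by_cases hz : z ∈ cyl N (2 * n) L
      · rw [indicator_of_mem hz, norm_mul, Real.norm_eq_abs, mul_comm]
        refine mul_le_mul_of_nonneg_right ?_ (abs_nonneg _)
        have hi : Integrable ((ball (-z.1) L).indicator fun _ : Eu N => A) :=
          (integrable_indicator_iff measurableSet_ball).2
            (integrableOn_const measure_ball_lt_top.ne)
        calc ‖∫ y in ball (0 : Eu N) n, φ (z + (y, 0))‖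
            ≤ ∫ y in ball (0 : Eu N) n, (ball (-z.1) L).indicator (fun _ => A) y := by
              refine norm_integral_le_of_norm_le hi.integrableOn
                (Eventually.of_forall fun y => ?_)
              by_cases hy : y ∈ ball (-z.1) L
              · rw [indicator_of_mem hy]; exact hA _
              · have : φ (z + (y, 0)) = 0 := by
                  by_contra hne
                  refine hy ?_
                  rw [mem_ball, dist_eq_norm]
                  simpa [add_comm] using (hsupp _ hne).1
                simp [this, hy]
          _ ≤ ∫ y, (ball (-z.1) L).indicator (fun _ => A) y :=
              setIntegral_le_integral hi
                (Eventually.of_forall fun y => indicator_nonneg (fun _ _ => hA0) y)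
          _ = D := by
              rw [integral_indicator measurableSet_ball, setIntegral_const, hvol _ hL0, hD,
                smul_eq_mul, mul_comm]
      · have : ∫ y in ball (0 : Eu N) n, φ (z + (y, 0)) = 0 :=
          setIntegral_eq_zero_of_forall_eq_zero fun y hy => hzero y hy z hz
        simp [hz, this]
    rw [← e1, abs_mul, abs_of_pos (by positivity)] at e2
    rw [mul_pow]
    have : 0 < n ^ N * κ := by positivity
    rw [show D * 2 ^ N / κ * ((∫ z in cyl N (2 * n) L, |P z|) / (2 ^ N * n ^ N)) =
      (D * ∫ z in cyl N (2 * n) L, |P z|) / (n ^ N * κ) by field_simp, le_div_iff₀ this]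
    linarith
  have hl : Tendsto (fun n : ℝ => D * 2 ^ N / κ * ((∫ z in cyl N (2 * n) L, |P z|) / (2 * n) ^ N))
      atTop (𝓝 0) := by
    have := ((hlim L).comp (tendsto_id.const_mul_atTop (two_pos : (0 : ℝ) < 2))).const_mul
      (D * 2 ^ N / κ)
    simpa using this
  have := ge_of_tendsto hl (eventually_ge_atTop L |>.mono hmain)
  exact abs_eq_zero.1 (le_antisymm this (abs_nonneg _))

end

section

variable {N : ℕ} {φ P : Eu N × ℝ → ℝ} {C : ℝ} {G : Eu N × ℝ → Eu N}

/-- If a bounded function with square integrable weak gradient is weakly invariant in one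
coordinate direction, then its weak gradient vanishes. -/
theorem integral_mul_fderiv_eq_zero_of_direction (hP : Measurable P) (hC : ∀ z, |P z| ≤ C)
    (hG : ∀ S, 0 < S → IntegrableOn (fun z => ‖G z‖ ^ 2) (univ ×ˢ Ioo 0 S))
    (hgrad : ∀ φ, Test φ → ∀ i, ∫ z, P z * fderiv ℝ φ z (EuclideanSpace.single i 1, 0) =
      -∫ z, G z i * φ z) {i : Fin N}
    (hi : ∀ φ, Test φ → ∫ z, P z * fderiv ℝ φ z (EuclideanSpace.single i 1, 0) = 0)
    (h : Test φ) (j : Fin N) :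
    ∫ z, P z * fderiv ℝ φ z (EuclideanSpace.single j 1, 0) = 0 := by
  set c := ∫ z, P z * fderiv ℝ φ z (EuclideanSpace.single j 1, 0) with hc
  set d : ℕ → Eu N × ℝ := fun n => ((n : ℝ) • EuclideanSpace.single i 1, 0) with hd
  obtain ⟨L, hL0, hL⟩ := h.exists_box
  have hdn : ∀ n : ℕ, ‖d n‖ = n := fun n => by simp [hd, norm_smul]
  have hcn : ∀ n : ℕ, c = -∫ z, G z j * φ (z + d n) := by
    intro n
    have h1 := hgrad _ (h.shift ((n : ℝ) • EuclideanSpace.single i 1)) j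
    have h2 := integral_mul_shift_eq hP hC (e := (n : ℝ) • EuclideanSpace.single i 1)
      (fun φ hφ => ?_) (h.fderiv_apply (EuclideanSpace.single j 1, 0))
    · simp only [fderiv_comp_add_right] at h1
      rw [hc, ← h2, h1]
    · rw [show (((n : ℝ) • EuclideanSpace.single i (1 : ℝ), (0 : ℝ)) : Eu N × ℝ) =
        (n : ℝ) • (EuclideanSpace.single i (1 : ℝ), (0 : ℝ)) by simp]
      simp only [map_smul, smul_eq_mul]
      simp_rw [mul_left_comm (P _)]
      rw [integral_const_mul, hi φ hφ, mul_zero]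
  set K : ℕ → Set (Eu N × ℝ) := fun n => {z | φ (z + d n) ≠ 0} with hK
  have hKm : ∀ n, MeasurableSet (K n) := fun n =>
    ((h.smooth.continuous.comp (continuous_add_const (d n))).measurable
      (measurableSet_singleton 0)).compl
  have hslab : MeasurableSet ((univ : Set (Eu N)) ×ˢ Ioo 0 L) :=
    MeasurableSet.univ.prod measurableSet_Ioo
  have hKs : ∀ n, K n ⊆ univ ×ˢ Ioo 0 L := fun n z hz =>
    ⟨mem_univ _, by simpa [hd] using (hL _ hz).2⟩
  have hGL := (integrable_indicator_iff hslab).2 (hG L hL0)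
  have hKi : ∀ n, Integrable ((K n).indicator fun z => ‖G z‖ ^ 2) := fun n =>
    (integrable_indicator_iff (hKm n)).2 ((hG L hL0).mono_set (hKs n))
  have hlim : Tendsto (fun n => ∫ z, (K n).indicator (fun z => ‖G z‖ ^ 2) z) atTop (𝓝 0) := by
    rw [← integral_zero (Eu N × ℝ) ℝ]
    refine tendsto_integral_of_dominated_convergence _
      (fun n => (hKi n).aestronglyMeasurable) hGL
      (fun n => Eventually.of_forall fun z => ?_) (Eventually.of_forall fun z => ?_)
    · rw [Real.norm_eq_abs, abs_of_nonneg (indicator_nonneg (fun _ _ => sq_nonneg _) _)]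
      exact indicator_le_indicator_of_subset (hKs n) (fun _ => sq_nonneg _) z
    · refine tendsto_const_nhds.congr' ?_
      filter_upwards [eventually_ge_atTop ⌈L + ‖z‖⌉₊] with n hn
      rw [indicator_of_notMem]
      intro hz
      have h1 := (hL _ hz).1
      have h2 : ‖d n‖ ≤ ‖z + d n‖ + ‖z‖ := by simpa [add_comm] using norm_sub_le (z + d n) z
      rw [hdn] at h2
      linarith [Nat.ceil_le.1 hn]
  have hsq : Integrable fun z => φ z ^ 2 := by
    refine Continuous.integrable_of_hasCompactSupport (by have := h.smooth.continuous; fun_prop) ?_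
    simp_rw [pow_two]
    exact h.cpt.mul_left
  have hbound : ∀ δ : ℝ, 0 < δ → |c| ≤ δ * ∫ z, φ z ^ 2 := by
    intro δ hδ
    have h1 : ∀ n, |c| ≤ δ * (∫ z, φ z ^ 2) +
        (4 * δ)⁻¹ * ∫ z, (K n).indicator (fun z => ‖G z‖ ^ 2) z := by
      intro n
      have hsqn : Integrable fun z => φ (z + d n) ^ 2 :=
        hsq.comp_add_right (d n)
      have h3 : ∫ z, φ (z + d n) ^ 2 = ∫ z, φ z ^ 2 :=
        integral_add_right_eq_self (fun z => φ z ^ 2) (d n)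
      rw [hcn n, abs_neg, ← Real.norm_eq_abs, ← h3, ← integral_const_mul, ← integral_const_mul,
        ← integral_add (hsqn.const_mul _) ((hKi n).const_mul _)]
      refine norm_integral_le_of_norm_le ((hsqn.const_mul _).add ((hKi n).const_mul _))
        (Eventually.of_forall fun z => ?_)
      by_cases hz : z ∈ K n
      · simp only [indicator_of_mem hz, norm_mul]
        have h4 : ‖G z j‖ ≤ ‖G z‖ := PiLp.norm_apply_le (G z) j
        have h5 : φ (z + d n) ^ 2 = ‖φ (z + d n)‖ ^ 2 := by simp
        rw [h5]
        have h6 : ‖G z j‖ * ‖φ (z + d n)‖ ≤ ‖G z‖ * ‖φ (z + d n)‖ := by gcongr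
        refine h6.trans ?_
        have h7 := sq_nonneg (2 * δ * ‖φ (z + d n)‖ - ‖G z‖)
        rw [← sub_nonneg]
        have : δ * ‖φ (z + d n)‖ ^ 2 + (4 * δ)⁻¹ * ‖G z‖ ^ 2 - ‖G z‖ * ‖φ (z + d n)‖ =
          (2 * δ * ‖φ (z + d n)‖ - ‖G z‖) ^ 2 / (4 * δ) := by field_simp; ring
        rw [this]; positivity
      · have : φ (z + d n) = 0 := by simpa [hK] using hz
        simp [this, hz]
    have h2 := (hlim.const_mul (4 * δ)⁻¹).const_add (δ * ∫ z, φ z ^ 2)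
    rw [mul_zero, add_zero] at h2
    exact ge_of_tendsto' h2 h1
  have hl : Tendsto (fun δ : ℝ => δ * ∫ z, φ z ^ 2) (𝓝[>] 0) (𝓝 0) := by
    have : Tendsto (fun δ : ℝ => δ * ∫ z, φ z ^ 2) (𝓝 0) (𝓝 (0 * ∫ z, φ z ^ 2)) :=
      tendsto_id.mul_const _
    rw [zero_mul] at this
    exact this.mono_left nhdsWithin_le_nhds
  have := ge_of_tendsto hl (eventually_mem_nhdsWithin.mono hbound)
  exact abs_eq_zero.1 (le_antisymm this (abs_nonneg _))

/-- A bounded function with vanishing spatial means whose weak gradient is square integrable,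
but not a locally integrable function, vanishes. -/
theorem ae_eq_zero_of_not_integrable_grad (hP : Measurable P) (hC : ∀ z, |P z| ≤ C)
    (hG : ∀ S, 0 < S → IntegrableOn (fun z => ‖G z‖ ^ 2) (univ ×ˢ Ioo 0 S))
    (hgrad : ∀ φ, Test φ → ∀ i, ∫ z, P z * fderiv ℝ φ z (EuclideanSpace.single i 1, 0) =
      -∫ z, G z i * φ z)
    (hlim : ∀ L, Tendsto (fun R : ℝ => (∫ z in cyl N R L, |P z|) / R ^ N) atTop (𝓝 0))
    {φ₀ : Eu N × ℝ → ℝ} (h₀ : Test φ₀) {i : Fin N} (hbad : ¬Integrable fun z => G z i * φ₀ z) :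
    ∀ᵐ z : Eu N × ℝ, 0 < z.2 → P z = 0 := by
  have h_int : ∀ {φ}, Test φ → ∀ d, Integrable fun z => P z * fderiv ℝ φ z d := fun hφ d =>
    (hφ.fderiv_apply d).bm.integrable_bounded_mul hP hC
  have hi : ∀ φ, Test φ → ∫ z, P z * fderiv ℝ φ z (EuclideanSpace.single i 1, 0) = 0 := by
    intro φ hφ
    by_cases hn : Integrable fun z => G z i * φ z
    · have h1 : ¬Integrable fun z => G z i * (φ + φ₀) z := by
        intro h2
        refine hbad ((h2.sub hn).congr (Eventually.of_forall fun z => ?_))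
        simp only [Pi.add_apply, Pi.sub_apply]; ring
      have h2 := hgrad _ (hφ.add h₀) i
      have h3 := hgrad _ h₀ i
      rw [integral_undef h1, neg_zero] at h2
      rw [integral_undef hbad, neg_zero] at h3
      have h4 : ∀ z, fderiv ℝ (φ + φ₀) z = fderiv ℝ φ z + fderiv ℝ φ₀ z := fun z =>
        fderiv_add (hφ.smooth.differentiable (by simp) z) (h₀.smooth.differentiable (by simp) z)
      simp only [h4, add_apply, mul_add] at h2
      rw [integral_add (h_int hφ _) (h_int h₀ _), h3, add_zero] at h2
      exact h2
    · rw [hgrad φ hφ, integral_undef hn, neg_zero]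
  have hall : ∀ e φ, Test φ → ∫ z, P z * fderiv ℝ φ z (e, 0) = 0 := by
    intro e φ hφ
    have he : ((e, 0) : Eu N × ℝ) = ∑ j, e j • (EuclideanSpace.single j (1 : ℝ), (0 : ℝ)) := by
      have := (EuclideanSpace.basisFun (Fin N) ℝ).sum_repr e
      ext1
      · rw [Prod.fst_sum]
        simpa using this.symm
      · rw [Prod.snd_sum]; simp
    rw [he]
    simp only [map_sum, map_smul, smul_eq_mul, Finset.mul_sum]
    simp_rw [mul_left_comm (P _)]
    rw [integral_finsetSum _ fun j _ => (h_int hφ _).const_mul _]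
    refine Finset.sum_eq_zero fun j _ => ?_
    rw [integral_const_mul, integral_mul_fderiv_eq_zero_of_direction hP hC hG hgrad hi hφ j,
      mul_zero]
  have hz : ∀ φ, Test φ → ∫ z, P z * φ z = 0 := fun φ hφ =>
    integral_mul_eq_zero_of_shift hP hC
      (fun e φ hφ => integral_mul_shift_eq hP hC (hall e) hφ) hlim hφ
  have hopen : IsOpen {z : Eu N × ℝ | 0 < z.2} := isOpen_lt continuous_const continuous_snd
  have hloc : LocallyIntegrable P := by
    refine (locallyIntegrable_const C).mono hP.aestronglyMeasurable
      (Eventually.of_forall fun z => (hC z).trans (le_abs_self C))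
  refine hopen.ae_eq_zero_of_integral_contDiff_smul_eq_zero (hloc.locallyIntegrableOn _)
    fun φ h1 h2 h3 => ?_
  have := hz φ ⟨h1, h2, fun z hz => ⟨mem_univ _, h3 hz⟩⟩
  simpa only [smul_eq_mul, mul_comm] using this

end

section

variable {N : ℕ} {ρ v₀ : Eu N → ℝ} {m γ Cl M : ℝ} {v : Eu N → ℝ → ℝ} {g : Eu N → ℝ → Eu N}
  {V : Eu N × ℝ → ℝ}

/-- A weak energy solution has a measurable version which is bounded everywhere. -/
theorem WES.exists_version (hv : WES ρ m v v₀ g) :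
    ∃ (V : Eu N × ℝ → ℝ) (M : ℝ), Measurable V ∧ (∀ z, |V z| ≤ M) ∧
      ∀ᵐ z : Eu N × ℝ, 0 < z.2 → V z = v z.1 z.2 := by
  obtain ⟨V1, hV1, hV1e⟩ := hv.meas
  obtain ⟨M, hM⟩ := hv.bdd
  have hS : MeasurableSet ((univ : Set (Eu N)) ×ˢ Ioi (0 : ℝ)) :=
    MeasurableSet.univ.prod measurableSet_Ioi
  have h1 : ∀ᵐ z : Eu N × ℝ, 0 < z.2 → v z.1 z.2 = V1 z :=
    ((ae_restrict_iff' hS).1 hV1e).mono fun z hz h => hz ⟨mem_univ _, h⟩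
  have hset : MeasurableSet {z : Eu N × ℝ | 0 < z.2 ∧ |V1 z| ≤ |M|} :=
    (measurableSet_lt measurable_const measurable_snd).inter
      (measurableSet_le hV1.norm measurable_const)
  have h2 : ∀ᵐ z : Eu N × ℝ, 0 < z.2 → |V1 z| ≤ |M| := by
    refine ae_of_ae_ae_slice ?_ ?_
    · exact (measurableSet_lt measurable_const measurable_snd).himp
        (measurableSet_le hV1.norm measurable_const)
    · filter_upwards [ae_ae_slice h1] with t ht
      by_cases h0 : 0 < t
      · filter_upwards [ht, hM t h0] with x hx hxM _
        rw [← hx h0]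
        exact hxM.trans (le_abs_self M)
      · exact Eventually.of_forall fun x h => absurd h h0
  classical
  refine ⟨fun z => if 0 < z.2 ∧ |V1 z| ≤ |M| then V1 z else 0, |M|,
    Measurable.ite hset hV1 measurable_const, fun z => ?_, ?_⟩
  · dsimp only
    split_ifs with h
    · exact h.2
    · simp
  · filter_upwards [h1, h2] with z h1 h2 hz
    rw [if_pos ⟨hz, h2 hz⟩, h1 hz]

theorem WES.ae_integrable_version (hv : WES ρ m v v₀ g)
    (hVe : ∀ᵐ z : Eu N × ℝ, 0 < z.2 → V z = v z.1 z.2) :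
    ∀ᵐ t : ℝ, 0 < t → Integrable (fun x => |V (x, t)| * ρ x) := by
  filter_upwards [ae_ae_slice hVe] with t ht h0
  refine (hv.int t h0.le).congr ?_
  filter_upwards [ht] with x hx
  rw [hx h0]

theorem tendsto_slice_mean_zero (hN : 3 ≤ N) (hm : 1 < m) (hγ : γ < 2) (hCl : 0 < Cl)
    (hlow : ∀ᵐ x : Eu N, Cl * (1 + ‖x‖) ^ (-γ) ≤ ρ x) {f : Eu N → ℝ} (hfM : ∀ x, |f x| ≤ M)
    (hf : Integrable (fun x => |f x| * ρ x)) :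
    Tendsto (fun R : ℝ => (∫ x in ball (0 : Eu N) R, |f x| ^ m) / R ^ N) atTop (𝓝 0) := by
  have hM0 : 0 ≤ M := (abs_nonneg _).trans (hfM 0)
  set D := M ^ (m - 1) * (4 * Cl⁻¹) * ∫ x, |f x| * ρ x with hD
  have hl : Tendsto (fun R : ℝ => D * R⁻¹) atTop (𝓝 0) := by
    simpa using tendsto_inv_atTop_zero.const_mul D
  have hρ0 : ∀ᵐ x, 0 ≤ |f x| * ρ x := by
    filter_upwards [hlow] with x hx
    exact mul_nonneg (abs_nonneg _) (le_trans (by positivity) hx)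
  refine squeeze_zero' ?_ ?_ hl
  · filter_upwards [eventually_ge_atTop 0] with R hR
    exact div_nonneg (integral_nonneg fun x => by positivity) (by positivity)
  · filter_upwards [eventually_ge_atTop 1] with R hR
    have hR0 : 0 < R := by linarith
    have h1 : ∫ x in ball (0 : Eu N) R, |f x| ^ m ≤
        ∫ x in ball (0 : Eu N) R, M ^ (m - 1) * (4 * R ^ 2 * Cl⁻¹) * (|f x| * ρ x) := by
      refine integral_mono_of_nonneg (Eventually.of_forall fun x => by positivity)
        (hf.integrableOn.const_mul _) ?_
      filter_upwards [ae_restrict_mem measurableSet_ball, ae_restrict_of_ae hlow] with x hx hρx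
      rw [mem_ball_zero_iff] at hx
      have e1 : |f x| ^ m ≤ M ^ (m - 1) * |f x| := by
        rcases (abs_nonneg (f x)).eq_or_lt with h0 | h0
        · rw [← h0, Real.zero_rpow (by linarith), mul_zero]
        · rw [show m = (m - 1) + 1 by ring, Real.rpow_add h0, Real.rpow_one, add_sub_cancel_right]
          exact mul_le_mul_of_nonneg_right
            (Real.rpow_le_rpow h0.le (hfM x) (by linarith)) h0.le
      have e2 : (1 : ℝ) ≤ 4 * R ^ 2 * Cl⁻¹ * ρ x := by
        have a1 : (1 + ‖x‖) ^ γ ≤ 4 * R ^ 2 := by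
          have b1 : 1 ≤ 1 + ‖x‖ := by linarith [norm_nonneg x]
          calc (1 + ‖x‖) ^ γ ≤ (1 + ‖x‖) ^ (2 : ℝ) := Real.rpow_le_rpow_of_exponent_le b1 hγ.le
            _ = (1 + ‖x‖) ^ 2 := by norm_cast
            _ ≤ (2 * R) ^ 2 := by gcongr; linarith
            _ = 4 * R ^ 2 := by ring
        have a2 : (1 + ‖x‖) ^ γ * (1 + ‖x‖) ^ (-γ) = 1 := by
          rw [← Real.rpow_add (by positivity)]; simp
        have a3 : (1 + ‖x‖) ^ (-γ) ≤ Cl⁻¹ * ρ x := by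
          rw [← div_eq_inv_mul, le_div_iff₀ hCl, mul_comm]; exact hρx
        calc (1 : ℝ) = (1 + ‖x‖) ^ γ * (1 + ‖x‖) ^ (-γ) := a2.symm
          _ ≤ 4 * R ^ 2 * (Cl⁻¹ * ρ x) := by gcongr
          _ = _ := by ring
      calc |f x| ^ m ≤ M ^ (m - 1) * |f x| := e1
        _ ≤ M ^ (m - 1) * |f x| * (4 * R ^ 2 * Cl⁻¹ * ρ x) := le_mul_of_one_le_right (by positivity) e2
        _ = _ := by ring
    have h2 : ∫ x in ball (0 : Eu N) R, |f x| * ρ x ≤ ∫ x, |f x| * ρ x :=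
      setIntegral_le_integral hf hρ0
    have hI : 0 ≤ ∫ x, |f x| * ρ x := integral_nonneg_of_ae hρ0
    rw [integral_const_mul] at h1
    have h3 : R ^ 3 ≤ R ^ N := pow_le_pow_right₀ hR hN
    rw [div_le_iff₀ (by positivity)]
    calc ∫ x in ball (0 : Eu N) R, |f x| ^ m
        ≤ M ^ (m - 1) * (4 * R ^ 2 * Cl⁻¹) * ∫ x, |f x| * ρ x := h1.trans (by gcongr)
      _ = D * R⁻¹ * R ^ 3 := by rw [hD]; field_simp
      _ ≤ D * R⁻¹ * R ^ N := by gcongr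

theorem WES.tendsto_mean_zero (hv : WES ρ m v v₀ g) (hN : 3 ≤ N) (hm : 1 < m)
    (hγ : γ < 2) (hCl : 0 < Cl) (hlow : ∀ᵐ x : Eu N, Cl * (1 + ‖x‖) ^ (-γ) ≤ ρ x)
    (hV : Measurable V) (hVM : ∀ z, |V z| ≤ M)
    (hVe : ∀ᵐ z : Eu N × ℝ, 0 < z.2 → V z = v z.1 z.2) (T : ℝ) :
    Tendsto (fun R : ℝ => (∫ z in cyl N R T, |V z| ^ m) / R ^ N) atTop (𝓝 0) := by
  have hM0 : 0 ≤ M := (abs_nonneg _).trans (hVM 0)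
  have hFm : Measurable fun z => |V z| ^ m := hV.norm.pow_const m
  have hFb : ∀ z, ‖|V z| ^ m‖ ≤ M ^ m := fun z => by
    rw [Real.norm_eq_abs, abs_of_nonneg (by positivity)]
    exact Real.rpow_le_rpow (abs_nonneg _) (hVM z) (by linarith)
  set κ := volume.real (ball (0 : Eu N) 1) with hκ
  have hvol : ∀ {R : ℝ}, 0 < R → volume.real (ball (0 : Eu N) R) = R ^ N * κ := by
    intro R hR
    rw [hκ, measureReal_def, measureReal_def, Measure.addHaar_ball_of_pos _ _ hR]
    simp [hR.le]
  have heq : ∀ R, (∫ z in cyl N R T, |V z| ^ m) / R ^ N =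
      ∫ t in Ioo 0 T, (∫ x in ball (0 : Eu N) R, |V (x, t)| ^ m) / R ^ N := by
    intro R
    rw [integral_div, cyl, setIntegral_prod_slice]
    refine Measure.integrableOn_of_bounded (M := M ^ m) ?_ hFm.aestronglyMeasurable
      (Eventually.of_forall hFb)
    rw [Measure.volume_eq_prod, Measure.prod_prod]
    exact (ENNReal.mul_lt_top measure_ball_lt_top (by simp)).ne
  simp_rw [heq]
  have h0 : ∫ _ in Ioo 0 T, (0 : ℝ) = 0 := integral_zero _ _
  suffices h : Tendsto (fun R : ℝ => ∫ t in Ioo 0 T,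
      (∫ x in ball (0 : Eu N) R, |V (x, t)| ^ m) / R ^ N) atTop (𝓝 (∫ _ in Ioo 0 T, (0 : ℝ))) by
    rwa [h0] at h
  refine tendsto_integral_filter_of_dominated_convergence (fun _ => M ^ m * κ)
    (Eventually.of_forall fun R => ?_) ?_ ?_ ?_
  · have : StronglyMeasurable fun t : ℝ => ∫ x in ball (0 : Eu N) R, |V (x, t)| ^ m :=
      StronglyMeasurable.integral_prod_right (f := fun t x => |V (x, t)| ^ m)
        (hFm.comp measurable_swap).stronglyMeasurable
    exact (this.measurable.div_const _).aestronglyMeasurable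
  · filter_upwards [eventually_gt_atTop 0] with R hR
    refine Eventually.of_forall fun t => ?_
    rw [norm_div, Real.norm_of_nonneg (r := R ^ N) (by positivity), div_le_iff₀ (by positivity)]
    refine (norm_setIntegral_le_of_norm_le_const measure_ball_lt_top fun x _ => hFb _).trans ?_
    rw [hvol hR]
    exact le_of_eq (by ring)
  · exact integrable_const _
  · filter_upwards [ae_restrict_mem measurableSet_Ioo,
      ae_restrict_of_ae (hv.ae_integrable_version hVe)] with t ht hti
    exact tendsto_slice_mean_zero hN hm hγ hCl hlow (fun x => hVM (x, t)) (hti ht.1)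

end

section

variable {N : ℕ} {ρ ρ' v₀ w₀ : Eu N → ℝ} {m γ Cl M T : ℝ} {v : Eu N → ℝ → ℝ}
  {g : Eu N → ℝ → Eu N} {V φ F : Eu N × ℝ → ℝ}

theorem Test.setIntegral_eq (h : Test φ) (hF : ∀ z ∉ tsupport φ, F z = 0) :
    ∫ z in univ ×ˢ Ioi 0, F z = ∫ z, F z :=
  setIntegral_eq_integral_of_forall_compl_eq_zero fun z hz => hF z fun hz' => hz (h.supp hz')

theorem fderiv_apply_eq_zero_of_notMem {z : Eu N × ℝ} (hz : z ∉ tsupport φ) (d : Eu N × ℝ) :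
    fderiv ℝ φ z d = 0 :=
  image_eq_zero_of_notMem_tsupport (f := fun z => fderiv ℝ φ z d)
    fun h => hz (tsupport_fderiv_apply d h)

theorem WES.grad_version (hv : WES ρ m v v₀ g)
    (hVe : ∀ᵐ z : Eu N × ℝ, 0 < z.2 → V z = v z.1 z.2) (h : Test φ) (i : Fin N) :
    ∫ z, spow (V z) m * fderiv ℝ φ z (EuclideanSpace.single i 1, 0) =
      -∫ z, g z.1 z.2 i * φ z := by
  rw [← h.setIntegral_eq fun z hz => by rw [fderiv_apply_eq_zero_of_notMem hz, mul_zero],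
    ← h.setIntegral_eq fun z hz => by rw [image_eq_zero_of_notMem_tsupport hz, mul_zero],
    ← hv.gradProp φ h.smooth h.cpt h.supp i]
  refine setIntegral_congr_ae (MeasurableSet.univ.prod measurableSet_Ioi) ?_
  filter_upwards [hVe] with z hz hz0
  rw [hz hz0.2]

theorem WES.weak_version (hv : WES ρ m v v₀ g) (hρe : ρ' =ᵐ[volume] ρ)
    (hVe : ∀ᵐ z : Eu N × ℝ, 0 < z.2 → V z = v z.1 z.2) (h : Test φ) :
    ∫ z, V z * ρ' z.1 * ptder φ z =
      ∫ z, ∑ i : Fin N, g z.1 z.2 i * fderiv ℝ φ z (EuclideanSpace.single i 1, 0) := by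
  rw [← h.setIntegral_eq fun z hz => by
      rw [ptder, fderiv_apply_eq_zero_of_notMem hz, mul_zero],
    ← h.setIntegral_eq fun z hz => Finset.sum_eq_zero fun i _ => by
      rw [fderiv_apply_eq_zero_of_notMem hz, mul_zero],
    ← hv.weakEq φ h.smooth h.cpt h.supp]
  refine setIntegral_congr_ae (MeasurableSet.univ.prod measurableSet_Ioi) ?_
  filter_upwards [hVe, ae_fst hρe] with z hz hzρ hz0
  rw [hz hz0.2, hzρ, mul_right_comm]

theorem Test.integrable_weight (h : Test φ) (hρi : ∀ R, IntegrableOn ρ (ball 0 R))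
    (hV : Measurable V) (hVM : ∀ z, |V z| ≤ M) : Integrable fun z => V z * ρ z.1 * φ z := by
  obtain ⟨L, -, hL⟩ := h.exists_box
  obtain ⟨A, hA⟩ := h.bm.bdd
  have h1 := integrableOn_cyl_of_bounded (T := L) (R := L) hρi
    (hV.mul h.smooth.continuous.measurable) (W := M * A) fun z _ => by
      rw [Pi.mul_apply, abs_mul]
      exact mul_le_mul (hVM z) (hA z) (abs_nonneg _) ((abs_nonneg _).trans (hVM z))
  rw [← integrable_indicator_iff (cyl_measurable N L L)] at h1
  refine h1.congr (Eventually.of_forall fun z => ?_)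
  by_cases hz : φ z = 0
  · by_cases hc : z ∈ cyl N L L <;> simp [hz, hc]
  · have := hL z hz
    rw [indicator_of_mem (mem_cyl.2 ⟨(norm_fst_le z).trans_lt this.1, this.2⟩), Pi.mul_apply]
    ring

/-- A bounded function with vanishing means whose gradient and time derivative are related by
the weak form of the equation solves the very weak form. -/
theorem WES.veryWeak_version (hv : WES ρ m v v₀ g) (hm : 1 < m) (hρe : ρ' =ᵐ[volume] ρ)
    (hρi : ∀ R, IntegrableOn ρ' (ball 0 R)) (hV : Measurable V) (hVM : ∀ z, |V z| ≤ M)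
    (hVe : ∀ᵐ z : Eu N × ℝ, 0 < z.2 → V z = v z.1 z.2)
    (hlim : ∀ L, Tendsto (fun R : ℝ => (∫ z in cyl N R L, |V z| ^ m) / R ^ N) atTop (𝓝 0))
    (h : Test φ) :
    ∫ z, (V z * ρ' z.1 * ptder φ z + spow (V z) m * lapX φ z) = 0 := by
  have hP : Measurable fun z => spow (V z) m := (spow_measurable m).comp hV
  have hPM : ∀ z, |spow (V z) m| ≤ M ^ m := fun z => by
    rw [abs_spow hm]
    exact Real.rpow_le_rpow (abs_nonneg _) (hVM z) (by linarith)
  by_cases hgood : ∀ φ, Test φ → ∀ i : Fin N, Integrable fun z => g z.1 z.2 i * φ z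
  · have hi : ∀ i : Fin N, Integrable fun z => spow (V z) m *
        fderiv ℝ (fun q => fderiv ℝ φ q (EuclideanSpace.single i 1, 0)) z
          (EuclideanSpace.single i 1, 0) := fun i =>
      ((h.fderiv_apply _).fderiv_apply _).bm.integrable_bounded_mul hP hPM
    have h1 : ∫ z, spow (V z) m * lapX φ z =
        -∑ i : Fin N, ∫ z, g z.1 z.2 i * fderiv ℝ φ z (EuclideanSpace.single i 1, 0) := by
      simp only [lapX, Finset.mul_sum]
      rw [integral_finsetSum _ fun i _ => hi i, ← Finset.sum_neg_distrib]
      exact Finset.sum_congr rfl fun i _ => hv.grad_version hVe (h.fderiv_apply _) i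
    have hl : Integrable fun z => spow (V z) m * lapX φ z := by
      simp only [lapX, Finset.mul_sum]
      exact integrable_finsetSum _ fun i _ => hi i
    have ht : Integrable fun z => V z * ρ' z.1 * ptder φ z :=
      (h.fderiv_apply (0, 1)).integrable_weight hρi hV hVM
    rw [integral_add ht hl, h1,
      hv.weak_version hρe hVe h, integral_finsetSum _ fun i _ => hgood _ (h.fderiv_apply _) i,
      add_neg_cancel]
  · push Not at hgood
    obtain ⟨φ₀, h₀, i, hbad⟩ := hgood
    have h0 := ae_eq_zero_of_not_integrable_grad (G := fun z => g z.1 z.2) hP hPM hv.gradL2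
      (fun φ hφ i => hv.grad_version hVe hφ i) (fun L => by simpa only [abs_spow hm] using hlim L)
      h₀ hbad
    refine (integral_congr_ae ?_).trans (integral_zero _ _)
    filter_upwards [h0] with z hz
    by_cases hzt : z ∈ tsupport φ
    · have hs := hz (h.supp hzt).2
      have hVz : V z = 0 := by
        have := abs_spow hm (V z)
        rw [hs, abs_zero, eq_comm, Real.rpow_eq_zero (abs_nonneg _) (by linarith)] at this
        exact abs_eq_zero.1 this
      rw [hs, hVz]; ring
    · have e1 : lapX φ z = 0 := image_eq_zero_of_notMem_tsupport fun h => hzt (tsupport_lapX h)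
      rw [e1, ptder, fderiv_apply_eq_zero_of_notMem hzt]; ring

theorem WES.trace_version (hv : WES ρ m v v₀ g) (hρm : Measurable ρ') (hρe : ρ' =ᵐ[volume] ρ)
    (hρi : ∀ R, IntegrableOn ρ' (ball 0 R)) (hρ0 : ∀ x, 0 ≤ ρ' x)
    (hw : Measurable w₀) (hwe : w₀ =ᵐ[volume] v₀) (hV : Measurable V) (hVM : ∀ z, |V z| ≤ M)
    (hVe : ∀ᵐ z : Eu N × ℝ, 0 < z.2 → V z = v z.1 z.2) (R : ℝ) :
    Tendsto (fun ε : ℝ => ε⁻¹ *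
      ∫ z in (ball (0 : Eu N) R) ×ˢ Ioo 0 ε, |V z - w₀ z.1| * ρ' z.1) (𝓝[>] 0) (𝓝 0) := by
  have hwi : Integrable fun x => |w₀ x| * ρ' x := by
    refine hv.u0int.congr ?_
    filter_upwards [hwe, hρe] with x h1 h2
    rw [h1, h2]
  have hFm : Measurable fun z : Eu N × ℝ => |V z - w₀ z.1| * ρ' z.1 :=
    (hV.sub (hw.comp measurable_fst)).norm.mul (hρm.comp measurable_fst)
  have hFi : ∀ ε : ℝ, IntegrableOn (fun z : Eu N × ℝ => |V z - w₀ z.1| * ρ' z.1)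
      (ball (0 : Eu N) R ×ˢ Ioo 0 ε) := by
    intro ε
    refine (integrableOn_prod_fst (I := Ioo 0 ε)
      (((hρi R).const_mul M).add hwi.integrableOn) (by simp)).mono' hFm.aestronglyMeasurable
      (Eventually.of_forall fun z => ?_)
    rw [Real.norm_eq_abs, abs_mul, abs_abs, abs_of_nonneg (hρ0 _)]
    simp only [Pi.add_apply]
    rw [← add_mul]
    exact mul_le_mul_of_nonneg_right
      ((abs_sub _ _).trans (add_le_add_left (hVM z) _)) (hρ0 _)
  have hslice : ∀ᵐ t : ℝ, 0 < t → ∫ x in ball (0 : Eu N) R, |V (x, t) - w₀ x| * ρ' x ≤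
      ∫ x, |v x t - v x 0| * ρ x := by
    filter_upwards [ae_ae_slice hVe, hv.ae_integrable_version hVe] with t h1 h2 h0
    have h3 : Integrable fun x => |V (x, t) - w₀ x| * ρ' x := by
      have h4 : Integrable fun x => |V (x, t)| * ρ' x := by
        refine (h2 h0).congr ?_
        filter_upwards [hρe] with x hx
        rw [hx]
      refine (h4.add hwi).mono'
        (hFm.comp (measurable_id.prodMk measurable_const)).aestronglyMeasurable
        (Eventually.of_forall fun x => ?_)
      rw [Real.norm_eq_abs, abs_mul, abs_abs, abs_of_nonneg (hρ0 _), Pi.add_apply, ← add_mul]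
      exact mul_le_mul_of_nonneg_right (abs_sub _ _) (hρ0 _)
    refine (setIntegral_le_integral h3
      (Eventually.of_forall fun x => mul_nonneg (abs_nonneg _) (hρ0 x))).trans (le_of_eq ?_)
    refine integral_congr_ae ?_
    filter_upwards [h1, hρe, hwe, hv.init] with x a1 a2 a3 a4
    rw [a1 h0, a2, a3, a4]
  rw [Metric.tendsto_nhdsWithin_nhds]
  intro δ hδ
  obtain ⟨ε₀, hε₀, hd⟩ := Metric.tendsto_nhdsWithin_nhds.1 (hv.contL1 0 le_rfl) (δ / 2) (half_pos hδ)
  refine ⟨ε₀, hε₀, fun ε hε hεd => ?_⟩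
  have hε : 0 < ε := hε
  rw [Real.dist_eq, sub_zero, abs_of_pos hε] at hεd
  have hI0 : 0 ≤ ∫ z in (ball (0 : Eu N) R) ×ˢ Ioo 0 ε, |V z - w₀ z.1| * ρ' z.1 :=
    integral_nonneg fun z => mul_nonneg (abs_nonneg _) (hρ0 _)
  have hI : ∫ z in (ball (0 : Eu N) R) ×ˢ Ioo 0 ε, |V z - w₀ z.1| * ρ' z.1 ≤ δ / 2 * ε := by
    rw [setIntegral_prod_slice (hFi ε)]
    have : ∫ t in Ioo 0 ε, ∫ x in ball (0 : Eu N) R, |V (x, t) - w₀ x| * ρ' x ≤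
        ∫ _ in Ioo 0 ε, δ / 2 := by
      refine integral_mono_of_nonneg (Eventually.of_forall fun t =>
        integral_nonneg fun x => mul_nonneg (abs_nonneg _) (hρ0 _)) (integrable_const _) ?_
      filter_upwards [ae_restrict_mem measurableSet_Ioo, ae_restrict_of_ae hslice] with t ht h1
      have h2 := hd (x := t) ht.1.le (by
        rw [Real.dist_eq, sub_zero, abs_of_pos ht.1]; exact ht.2.trans hεd)
      rw [Real.dist_eq, sub_zero] at h2
      exact (h1 ht.1).trans ((le_abs_self _).trans h2.le)
    refine this.trans (le_of_eq ?_)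
    rw [setIntegral_const, Real.volume_real_Ioo_of_le hε.le, sub_zero, smul_eq_mul, mul_comm]
  rw [Real.dist_eq, sub_zero, abs_of_nonneg (mul_nonneg (inv_nonneg.2 hε.le) hI0),
    inv_mul_lt_iff₀ hε]
  nlinarith

/-- A weak energy solution, as a very weak solution with initial trace and vanishing means. -/
theorem WES.exists_traceSol (hv : WES ρ m v v₀ g) (hN : 3 ≤ N) (hm : 1 < m)
    (hγ : γ < 2) (hCl : 0 < Cl) (hρm : Measurable ρ') (hρe : ρ' =ᵐ[volume] ρ)
    (hρi : ∀ R, IntegrableOn ρ' (ball 0 R)) (hlow : ∀ x, Cl * (1 + ‖x‖) ^ (-γ) ≤ ρ' x)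
    (hw : Measurable w₀) (hwe : w₀ =ᵐ[volume] v₀) :
    ∃ V : Eu N × ℝ → ℝ, (∀ᵐ z : Eu N × ℝ, 0 < z.2 → V z = v z.1 z.2) ∧
      (∀ T, Tendsto (fun R : ℝ => (∫ z in cyl N R T, |V z| ^ m) / R ^ N) atTop (𝓝 0)) ∧
      ∀ T, TraceSol ρ' T V (fun z => spow (V z) m) w₀ := by
  obtain ⟨V, M, hV, hVM, hVe⟩ := hv.exists_version
  have hρ0 : ∀ x, 0 ≤ ρ' x := fun x => le_trans (by positivity) (hlow x)
  have hlim := hv.tendsto_mean_zero hN hm hγ hCl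
    (hρe.mono fun x hx => hx ▸ hlow x) hV hVM hVe
  refine ⟨V, hVe, hlim, fun T => ⟨hV, (spow_measurable m).comp hV, hw, fun R => ⟨M, fun z _ => hVM z⟩,
    fun R => ⟨M ^ m, fun z _ => ?_⟩, fun R => ?_,
    hv.trace_version hρm hρe hρi hρ0 hw hwe hV hVM hVe, fun φ h1 h2 h3 => ?_⟩⟩
  · rw [abs_spow hm]
    exact Real.rpow_le_rpow (abs_nonneg _) (hVM z) (by linarith)
  · refine Integrable.integrableOn (hv.u0int.mono' (hρm.mul hw).aestronglyMeasurable ?_)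
    filter_upwards [hwe, hρe] with x h1 h2
    rw [norm_mul, Real.norm_eq_abs, Real.norm_eq_abs, abs_of_nonneg (hρ0 x), h1, h2, mul_comm]
  · have h : Test φ := ⟨h1, h2, h3.trans (prod_mono Subset.rfl Ioo_subset_Ioi_self)⟩
    rw [setIntegral_eq_integral_of_forall_compl_eq_zero fun z hz => ?_]
    · exact hv.veryWeak_version hm hρe hρi hV hVM hVe hlim h
    · have hz : z ∉ tsupport φ := fun h => hz (h3 h)
      have e1 : lapX φ z = 0 := image_eq_zero_of_notMem_tsupport fun h => hz (tsupport_lapX h)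
      rw [e1, ptder, fderiv_apply_eq_zero_of_notMem hz]; ring

end

theorem aemeasurable_of_mul_weight {α : Type*} [MeasurableSpace α] {μ : Measure α} {f ρ : α → ℝ}
    (hρ : AEMeasurable ρ μ) (hρ0 : ∀ᵐ x ∂μ, 0 < ρ x) (hf0 : ∀ᵐ x ∂μ, 0 ≤ f x)
    (hf : AEMeasurable (fun x => |f x| * ρ x) μ) : AEMeasurable f μ := by
  refine (hf.div hρ).congr ?_
  filter_upwards [hρ0, hf0] with x h1 h2
  rw [Pi.div_apply, mul_div_cancel_right₀ _ h1.ne', abs_of_nonneg h2]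

/-- **Corollary 3.6 (global comparison)**: if `u` is a non-negative, locally bounded very weak
solution of the WPME on `ℝ^N × (0,T)`, `τ₁ ∈ (0,T)` is a Lebesgue time of `u`, and `v` is a
weak energy solution whose initial datum `v₀ ∈ L¹_ρ ∩ L^∞` satisfies `0 ≤ v₀ ≤ u(τ₁)`, then
`v(t) ≤ u(t + τ₁)` on `ℝ^N × (0, T - τ₁)`. -/
theorem stmt_12 {N : ℕ} (hN : 3 ≤ N) (m γ Cl Cu : ℝ) (hm : 1 < m) (T : ℝ) (hT : 0 < T)
    (ρ : Eu N → ℝ) (hρ : WeightCond N γ Cl Cu ρ)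
    (u : Eu N → ℝ → ℝ) (hu : VWS ρ m univ 0 T u)
    (hupos : ∀ᵐ p ∂(volume.restrict ((univ : Set (Eu N)) ×ˢ Ioo 0 T) : Measure (Eu N × ℝ)),
      0 ≤ u p.1 p.2)
    (hubdd : LinftyLoc univ 0 T u)
    -- `τ₁` is a Lebesgue time of `u` in `L¹_{ρ,loc}`
    (τ₁ : ℝ) (hτ₁ : τ₁ ∈ Ioo 0 T)
    (hLeb : ∀ K : Set (Eu N), IsCompact K →
      IntegrableOn (fun x => |u x τ₁| * ρ x) K ∧
      Tendsto (fun ε : ℝ => ε⁻¹ * ∫ t in Ioo (τ₁ - ε) (τ₁ + ε), ∫ x in K,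
          |u x t - u x τ₁| * ρ x)
        (𝓝[>] (0:ℝ)) (𝓝 0))
    -- the weak energy solution `v` with initial datum `v₀`
    (v₀ : Eu N → ℝ) (v : Eu N → ℝ → ℝ) (gv : Eu N → ℝ → Eu N)
    (hv : WES ρ m v v₀ gv)
    (hv₀pos : ∀ᵐ x ∂(volume : Measure (Eu N)), 0 ≤ v₀ x)
    (hv₀le : ∀ᵐ x ∂(volume : Measure (Eu N)), v₀ x ≤ u x τ₁) :
    ∀ᵐ p ∂(volume.restrict ((univ : Set (Eu N)) ×ˢ Ioo 0 (T - τ₁)) : Measure (Eu N × ℝ)),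
      v p.1 p.2 ≤ u p.1 (p.2 + τ₁) := by
  obtain ⟨ρ', hρm, hρe, hρi, hlow⟩ := hρ.exists_regular hN
  obtain ⟨hρM, hγ0, hγ2, hCl, -, -⟩ := hρ
  have hρ0 : ∀ x, 0 < ρ' x := fun x => lt_of_lt_of_le (by positivity) (hlow x)
  have hρpos : ∀ᵐ x, 0 < ρ x := hρe.mono fun x hx => hx ▸ hρ0 x
  have hv₀m : AEMeasurable v₀ volume :=
    aemeasurable_of_mul_weight hρM.aemeasurable hρpos hv₀pos hv.u0int.aemeasurable
  have huτ : AEMeasurable (fun x => u x τ₁) volume := by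
    refine aemeasurable_of_mul_weight hρM.aemeasurable hρpos ?_ ?_
    · filter_upwards [hv₀pos, hv₀le] with x h1 h2 using h1.trans h2
    · exact (locallyIntegrable_iff.2 fun K hK => (hLeb K hK).1).aestronglyMeasurable.aemeasurable
  obtain ⟨w₀, hw, hwe⟩ := hv₀m
  obtain ⟨y, hy, hye⟩ := huτ
  have hyw : ∀ᵐ x, max (y x) (w₀ x) = u x τ₁ := by
    filter_upwards [hwe, hye, hv₀le] with x h1 h2 h3
    rw [← h1, ← h2, max_eq_left h3]
  obtain ⟨V, hVe, hlim, hVt⟩ := hv.exists_traceSol hN hm hγ2 hCl hρm hρe hρi hlow hw hwe.symm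
  have hlb : ∀ R, ∃ c > 0, ∀ x : Eu N, ‖x‖ < R → c ≤ ρ' x := by
    intro R
    refine ⟨Cl * (1 + |R|) ^ (-γ), by positivity, fun x hx => le_trans ?_ (hlow x)⟩
    refine mul_le_mul_of_nonneg_left ?_ hCl.le
    exact Real.rpow_le_rpow_of_nonpos (by positivity)
      (by linarith [le_abs_self R]) (by linarith)
  have key : ∀ q : ℚ, ∀ᵐ z : Eu N × ℝ, (q : ℝ) < T - τ₁ → z.2 ∈ Ioo 0 (q : ℝ) →
      v z.1 z.2 ≤ u z.1 (z.2 + τ₁) := by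
    intro q
    by_cases hq : 0 < (q : ℝ) ∧ (q : ℝ) < T - τ₁
    · obtain ⟨U, hU0, hUe, hUt⟩ := hu.exists_traceSol hupos hubdd hm hτ₁.1 hq.1
        (by linarith [hq.2]) hLeb hρm hρe hρi (fun x => (hρ0 x).le) (hy.max hw) hyw
      have hle := TraceSol.le hN hm hq.1 hρm hρi hlb (hVt q) hUt hU0
        (fun x => le_max_right _ _) (hlim q)
      filter_upwards [hle, hVe, hUe] with z h1 h2 h3 _ hz
      rw [← h2 hz.1, ← h3 hz]
      exact h1 ⟨mem_univ _, hz⟩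
    · exact Eventually.of_forall fun z h1 h2 => absurd ⟨h2.1.trans h2.2, h1⟩ hq
  refine (ae_restrict_iff' (MeasurableSet.univ.prod measurableSet_Ioo)).2 ?_
  filter_upwards [ae_all_iff.2 key] with z hz hzT
  obtain ⟨q, hq1, hq2⟩ := exists_rat_btwn hzT.2.2
  exact hz q hq2 ⟨hzT.2.1, hq1⟩
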